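/- arXiv:1710.02092 — 2 statements merged into one kernel-verified Lean document; each statement's English description precedes it below -/
import Mathlib

section
/- For every binary stream X there exists a Martin-Löf random binary stream Y such that X is computable from Y with oracle-use n ↦ min_{i ≥ max(n,1)} (K(X↾i) + ⌈log₂ i⌉). -/
open scoped ENNReal

abbrev BStr := List Bool

/-- The first `n` bits of the stream `X`, as a binary string. -/
def stake (X : ℕ → Bool) (n : ℕ) : BStr := (List.range n).map X

/-- A set of binary strings is prefix-free if no element is a proper prefix of another. -/
def PrefixFreeSet (S : Set BStr) : Prop :=
  ∀ σ ∈ S, ∀ τ ∈ S, σ <+: τ → σ = τ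

/-- `X` is computable from `Y` with oracle-use `f`. -/
def ComputableWithUse (X Y : ℕ → Bool) (f : ℕ → ℕ) : Prop :=
  ∃ F : ℕ × BStr →. BStr, Partrec F ∧ ∀ n, stake X n ∈ F (n, stake Y (f n))

/-- A prefix-free machine: partial computable with prefix-free domain. -/
def PrefixFreeMachine (M : BStr →. BStr) : Prop :=
  Partrec M ∧ PrefixFreeSet {ρ | (M ρ).Dom}

/-- `K_M σ`: least length of an `M`-description of `σ` (`⊤` if none). -/
noncomputable def KM (M : BStr →. BStr) (σ : BStr) : ℕ∞ :=
  sInf ((fun ρ : BStr => (ρ.length : ℕ∞)) '' {ρ | σ ∈ M ρ})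

/-- Universal prefix-free machine. -/
def UniversalPFM (U : BStr →. BStr) : Prop :=
  PrefixFreeMachine U ∧
    ∀ M : BStr →. BStr, PrefixFreeMachine M →
      ∃ c : ℕ, ∀ σ, KM U σ ≤ KM M σ + (c : ℕ∞)

/-- Prefix-free Kolmogorov complexity w.r.t. `U`, as a natural number. -/
noncomputable def Kof (U : BStr →. BStr) (σ : BStr) : ℕ := (KM U σ).toNat

/-- Martin-Löf randomness via Schnorr's characterization: `K(Y↾n) ≥ n - c`. -/
def MLRandom (U : BStr →. BStr) (Y : ℕ → Bool) : Prop :=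
  ∃ c : ℕ, ∀ n, n ≤ Kof U (stake Y n) + c

/-- The weight `2^{-I(σ)}` contributed by `σ` (zero if `I σ` is undefined). -/
noncomputable def iweight (I : BStr →. ℕ) (σ : BStr) : ℝ≥0∞ :=
  haveI := Classical.propDecidable (I σ).Dom
  if h : (I σ).Dom then ((2 : ℝ≥0∞) ^ ((I σ).get h))⁻¹ else 0

namespace OptUse

/-- The floor of the base-four logarithm. -/
def fourLog (m : ℕ) : ℕ := Nat.findGreatest (fun k => 4 ^ k ≤ m) m

theorem four_pow_fourLog_le {m : ℕ} (hm : 1 ≤ m) : 4 ^ fourLog m ≤ m :=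
  Nat.findGreatest_spec (P := fun k => 4 ^ k ≤ m) (Nat.zero_le m) (by simpa using hm)

theorem lt_four_pow_fourLog (m : ℕ) : m < 4 ^ (fourLog m + 1) := by
  by_contra! h
  have h1 : fourLog m + 1 ≤ m :=
    (Nat.lt_pow_self (by norm_num : 1 < 4)).le.trans h
  have := Nat.le_findGreatest (P := fun k => 4 ^ k ≤ m) h1 h
  unfold fourLog at this h1
  omega

/-- The exponent of the kernel distributing the weight of a string of length `n`
among its prefixes of length `i`. -/
def kexp (i n : ℕ) : ℕ := fourLog (if i = n then n ^ 2 else i ^ 3 * n)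

theorem kexp_self_le_clog {n : ℕ} (hn : 1 ≤ n) : kexp n n ≤ Nat.clog 2 n := by
  have h1 : 4 ^ kexp n n ≤ n ^ 2 := by
    have := four_pow_fourLog_le (m := n ^ 2) (Nat.one_le_pow _ _ hn)
    simpa [kexp] using this
  have h2 : (2 ^ kexp n n) ^ 2 ≤ n ^ 2 := by
    rw [← pow_mul, mul_comm, pow_mul]; simpa using h1
  have h3 : 2 ^ kexp n n ≤ n := (Nat.pow_le_pow_iff_left (by norm_num)).1 h2
  exact (Nat.pow_le_pow_iff_right (by norm_num : 1 < 2)).1 (h3.trans (Nat.le_pow_clog (by norm_num) n))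

theorem kexp_le_two_mul {i n : ℕ} (hi : i ≤ n) : kexp i n ≤ 2 * n := by
  rcases Nat.eq_zero_or_pos (if i = n then n ^ 2 else i ^ 3 * n) with h0 | h0
  · simp [kexp, h0, fourLog]
  have hn : 1 ≤ n := by
    by_contra h
    have : n = 0 := by omega
    subst this
    simp at h0
  have h1 : 4 ^ kexp i n ≤ n ^ 4 := by
    refine (four_pow_fourLog_le h0).trans ?_
    split_ifs
    · exact Nat.pow_le_pow_right hn (by norm_num)
    · calc i ^ 3 * n ≤ n ^ 3 * n := by gcongr
        _ = n ^ 4 := by ring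
  have h2 : 4 ^ kexp i n ≤ 4 ^ (2 * n) := by
    refine h1.trans ?_
    calc n ^ 4 ≤ (2 ^ n) ^ 4 := by gcongr; exact Nat.lt_two_pow_self.le
      _ = 4 ^ (2 * n) := by
        rw [show 4 = 2 ^ 2 by norm_num, ← pow_mul, ← pow_mul]; congr 1; ring
  exact (Nat.pow_le_pow_iff_right (by norm_num : 1 < 4)).1 h2

theorem sq_two_pow_inv (k : ℕ) : (((2 : ℝ) ^ k)⁻¹) ^ 2 = ((4 : ℝ) ^ k)⁻¹ := by
  rw [inv_pow, ← pow_mul, mul_comm, pow_mul]; norm_num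

theorem fourLog_weight_le {m : ℕ} (hm : 1 ≤ m) :
    ((2 : ℝ) ^ fourLog m)⁻¹ ≤ 2 / √m := by
  have hm' : (0 : ℝ) < m := by exact_mod_cast hm
  refine (sq_le_sq₀ (by positivity) (by positivity)).1 ?_
  rw [sq_two_pow_inv, div_pow, Real.sq_sqrt hm'.le, inv_eq_one_div,
    div_le_div_iff₀ (by positivity) hm']
  have := (lt_four_pow_fourLog m).le
  have h : (m : ℝ) ≤ 4 ^ (fourLog m + 1) := by exact_mod_cast this
  rw [pow_succ] at h
  linarith

theorem le_fourLog_weight {m : ℕ} (hm : 1 ≤ m) :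
    1 / √m ≤ ((2 : ℝ) ^ fourLog m)⁻¹ := by
  have hm' : (0 : ℝ) < m := by exact_mod_cast hm
  refine (sq_le_sq₀ (by positivity) (by positivity)).1 ?_
  rw [sq_two_pow_inv, div_pow, Real.sq_sqrt hm'.le, inv_eq_one_div,
    div_le_div_iff₀ hm' (by positivity)]
  have h : (4 : ℝ) ^ fourLog m ≤ m := by exact_mod_cast four_pow_fourLog_le hm
  linarith

theorem sqrt_cube_mul (i n : ℕ) : √((i ^ 3 * n : ℕ) : ℝ) = i * (√i * √n) := by
  push_cast
  rw [Real.sqrt_mul (by positivity), show (i : ℝ) ^ 3 = i ^ 2 * i by ring,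
    Real.sqrt_mul (by positivity), Real.sqrt_sq (by positivity)]
  ring

theorem inv_three_halves_le {j : ℕ} (hj : 1 ≤ j) :
    1 / (j * √j) ≤ 4 * (1 / √j - 1 / √(j + 1 : ℕ)) := by
  have hj' : (1 : ℝ) ≤ j := by exact_mod_cast hj
  set a := √(j : ℝ) with ha
  set b := √((j + 1 : ℕ) : ℝ) with hb
  have ha0 : 0 < a := Real.sqrt_pos.2 (by linarith)
  have hb0 : 0 < b := Real.sqrt_pos.2 (by positivity)
  have ha2 : a ^ 2 = j := Real.sq_sqrt (by linarith)
  have hb2 : b ^ 2 = j + 1 := by rw [hb, Real.sq_sqrt (by positivity)]; push_cast; ring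
  have hab : a ≤ b := Real.sqrt_le_sqrt (by push_cast; linarith)
  have h1 : 1 / a - 1 / b = 1 / (a * b * (a + b)) := by
    have : (b - a) * (a + b) = 1 := by nlinarith
    field_simp
    linarith
  rw [h1, mul_one_div, div_le_div_iff₀ (by positivity) (by positivity), ← ha2]
  have hb15 : b ≤ 3 / 2 * a := by
    refine (sq_le_sq₀ (by positivity) (by positivity)).1 ?_
    nlinarith
  have : b * (a + b) ≤ 4 * a ^ 2 := by nlinarith
  nlinarith

theorem sum_inv_three_halves_le {i n : ℕ} (hi : 1 ≤ i) (hn : i ≤ n) :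
    ∑ j ∈ Finset.Ico i n, 1 / (j * √j) ≤ 4 * (1 / √i - 1 / √n) := by
  induction n, hn using Nat.le_induction with
  | base => simp
  | succ n hn ih =>
    rw [Finset.sum_Ico_succ_top hn]
    have := inv_three_halves_le (hi.trans hn)
    linarith

theorem sum_inv_sqrt_le (n : ℕ) :
    ∑ j ∈ Finset.Ico 1 (n + 1), 1 / √(j : ℝ) ≤ 2 * √n := by
  induction n with
  | zero => simp
  | succ n ih =>
    rw [Finset.sum_Ico_succ_top (by omega)]
    set a := √(n : ℝ) with ha
    set b := √((n + 1 : ℕ) : ℝ) with hb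
    have ha0 : 0 ≤ a := Real.sqrt_nonneg _
    have hb0 : 0 < b := Real.sqrt_pos.2 (by positivity)
    have ha2 : a ^ 2 = n := Real.sq_sqrt (by positivity)
    have hb2 : b ^ 2 = n + 1 := by rw [hb, Real.sq_sqrt (by positivity)]; push_cast; ring
    have hab : a ≤ b := Real.sqrt_le_sqrt (by push_cast; linarith)
    have h1 : 1 / b ≤ 2 * (b - a) := by
      rw [div_le_iff₀ hb0]
      nlinarith
    linarith

theorem kexp_weight_le {i n : ℕ} (hi : 1 ≤ i) (h : i < n) :
    ((2 : ℝ) ^ kexp i n)⁻¹ ≤ 2 / (i * (√i * √n)) := by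
  have := fourLog_weight_le (m := i ^ 3 * n) (Nat.mul_pos (by positivity) (by omega))
  rw [sqrt_cube_mul] at this
  simpa [kexp, h.ne] using this

theorem kexp_self_weight_le {n : ℕ} (hn : 1 ≤ n) :
    ((2 : ℝ) ^ kexp n n)⁻¹ ≤ 2 / n := by
  have := fourLog_weight_le (m := n ^ 2) (Nat.one_le_pow _ _ hn)
  rw [Nat.cast_pow, Real.sqrt_sq (by positivity)] at this
  simpa [kexp] using this

theorem sum_kexp_weight_Icc_le {i n : ℕ} (hi : 1 ≤ i) (hn : i ≤ n) :
    ∑ j ∈ Finset.Icc i n, ((2 : ℝ) ^ kexp j n)⁻¹ ≤ 10 * i * ((2 : ℝ) ^ kexp i n)⁻¹ := by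
  have hi' : (1 : ℝ) ≤ i := by exact_mod_cast hi
  have hn' : (i : ℝ) ≤ n := by exact_mod_cast hn
  rcases hn.eq_or_lt with rfl | hlt
  · rw [Finset.Icc_self, Finset.sum_singleton]
    have : (0 : ℝ) < ((2 : ℝ) ^ kexp i i)⁻¹ := by positivity
    nlinarith
  rw [← Finset.Ico_succ_right_eq_Icc, Nat.succ_eq_succ, Nat.succ_eq_add_one,
    Finset.sum_Ico_succ_top hn]
  set a := √(i : ℝ) with ha
  set b := √(n : ℝ) with hb
  have ha0 : 0 < a := Real.sqrt_pos.2 (by linarith)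
  have hb0 : 0 < b := Real.sqrt_pos.2 (by linarith)
  have ha2 : a ^ 2 = i := Real.sq_sqrt (by linarith)
  have hb2 : b ^ 2 = n := Real.sq_sqrt (by linarith)
  have hab : a ≤ b := Real.sqrt_le_sqrt hn'
  have h1 : ∑ j ∈ Finset.Ico i n, ((2 : ℝ) ^ kexp j n)⁻¹ ≤ 8 / (a * b) := by
    calc ∑ j ∈ Finset.Ico i n, ((2 : ℝ) ^ kexp j n)⁻¹
        ≤ ∑ j ∈ Finset.Ico i n, 2 / b * (1 / (j * √j)) := by
          refine Finset.sum_le_sum fun j hj => ?_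
          rw [Finset.mem_Ico] at hj
          refine (kexp_weight_le (hi.trans hj.1) hj.2).trans (le_of_eq ?_)
          rw [div_mul_div_comm, mul_one]
          congr 1
          ring
      _ ≤ 2 / b * (4 * (1 / a - 1 / b)) := by
          rw [← Finset.mul_sum]
          have := sum_inv_three_halves_le hi hn
          gcongr
      _ ≤ 2 / b * (4 * (1 / a)) := by
          have : 0 < 1 / b := by positivity
          gcongr
          linarith
      _ = 8 / (a * b) := by field_simp; norm_num
  have h2 : ((2 : ℝ) ^ kexp n n)⁻¹ ≤ 2 / (a * b) := by
    refine (kexp_self_weight_le (hi.trans hn)).trans ?_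
    rw [← hb2]
    gcongr
    nlinarith
  have h3 : 1 / (i * (a * b)) ≤ ((2 : ℝ) ^ kexp i n)⁻¹ := by
    have := le_fourLog_weight (m := i ^ 3 * n) (Nat.mul_pos (by positivity) (by omega))
    rw [sqrt_cube_mul] at this
    simpa [kexp, hlt.ne] using this
  calc _ ≤ 8 / (a * b) + 2 / (a * b) := add_le_add h1 h2
    _ = 10 * i * (1 / (i * (a * b))) := by field_simp; norm_num
    _ ≤ _ := by gcongr

theorem sum_mul_kexp_weight_le (n : ℕ) :
    ∑ i ∈ Finset.Icc 1 n, i * ((2 : ℝ) ^ kexp i n)⁻¹ ≤ 6 := by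
  rcases Nat.eq_zero_or_pos n with rfl | hn
  · simp
  have hn' : (1 : ℝ) ≤ n := by exact_mod_cast hn
  rw [← Finset.Ico_succ_right_eq_Icc, Nat.succ_eq_succ, Nat.succ_eq_add_one,
    Finset.sum_Ico_succ_top hn]
  set b := √(n : ℝ) with hb
  have hb0 : 0 < b := Real.sqrt_pos.2 (by linarith)
  have h1 : ∑ j ∈ Finset.Ico 1 n, j * ((2 : ℝ) ^ kexp j n)⁻¹ ≤ 4 := by
    calc ∑ j ∈ Finset.Ico 1 n, j * ((2 : ℝ) ^ kexp j n)⁻¹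
        ≤ ∑ j ∈ Finset.Ico 1 n, 2 / b * (1 / √(j : ℝ)) := by
          refine Finset.sum_le_sum fun j hj => ?_
          rw [Finset.mem_Ico] at hj
          have hj0 : (0 : ℝ) < j := by exact_mod_cast hj.1
          have := mul_le_mul_of_nonneg_left (kexp_weight_le hj.1 hj.2) hj0.le
          refine this.trans (le_of_eq ?_)
          have : 0 < √(j : ℝ) := Real.sqrt_pos.2 hj0
          rw [← hb]
          field_simp
      _ ≤ ∑ j ∈ Finset.Ico 1 (n + 1), 2 / b * (1 / √(j : ℝ)) := by
          refine Finset.sum_le_sum_of_subset_of_nonneg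
            (Finset.Ico_subset_Ico_right (by omega)) fun _ _ _ => by positivity
      _ ≤ 2 / b * (2 * b) := by
          rw [← Finset.mul_sum]
          have := sum_inv_sqrt_le n
          gcongr
      _ = 4 := by field_simp; norm_num
  have h2 : n * ((2 : ℝ) ^ kexp n n)⁻¹ ≤ 2 := by
    have := mul_le_mul_of_nonneg_left (kexp_self_weight_le hn) (by linarith : (0 : ℝ) ≤ n)
    refine this.trans (le_of_eq ?_)
    field_simp
  linarith

theorem ofReal_two_pow_inv (k : ℕ) : ENNReal.ofReal ((2 : ℝ) ^ k)⁻¹ = ((2 : ℝ≥0∞) ^ k)⁻¹ := by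
  rw [ENNReal.ofReal_inv_of_pos (by positivity), ENNReal.ofReal_pow (by norm_num)]
  norm_num

theorem sum_kexp_weight_Icc_le_ennreal {i n : ℕ} (hi : 1 ≤ i) (hn : i ≤ n) :
    ∑ j ∈ Finset.Icc i n, ((2 : ℝ≥0∞) ^ kexp j n)⁻¹ ≤ 10 * i * ((2 : ℝ≥0∞) ^ kexp i n)⁻¹ := by
  have := ENNReal.ofReal_le_ofReal (sum_kexp_weight_Icc_le hi hn)
  rw [ENNReal.ofReal_sum_of_nonneg (fun _ _ => by positivity),
    ENNReal.ofReal_mul (by positivity), ENNReal.ofReal_mul (by positivity)] at this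
  simpa only [ofReal_two_pow_inv, ENNReal.ofReal_natCast, ENNReal.ofReal_ofNat] using this

theorem sum_mul_kexp_weight_le_ennreal (n : ℕ) :
    ∑ i ∈ Finset.Icc 1 n, i * ((2 : ℝ≥0∞) ^ kexp i n)⁻¹ ≤ 6 := by
  have := ENNReal.ofReal_le_ofReal (sum_mul_kexp_weight_le n)
  rw [ENNReal.ofReal_sum_of_nonneg (fun _ _ => by positivity)] at this
  simpa only [ENNReal.ofReal_mul (Nat.cast_nonneg _), ofReal_two_pow_inv,
    ENNReal.ofReal_natCast, ENNReal.ofReal_ofNat] using this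

@[simp] theorem length_stake (X : ℕ → Bool) (n : ℕ) : (stake X n).length = n := by
  simp [stake]

theorem take_stake (X : ℕ → Bool) {m n : ℕ} (h : m ≤ n) : (stake X n).take m = stake X m := by
  simp [stake, ← List.map_take, List.take_range, h]

theorem stake_prefix (X : ℕ → Bool) {m n : ℕ} (h : m ≤ n) : stake X m <+: stake X n := by
  rw [← take_stake X h]; exact List.take_prefix _ _

theorem stake_succ (X : ℕ → Bool) (n : ℕ) : stake X (n + 1) = stake X n ++ [X n] := by
  simp [stake, List.range_succ]

/-- The streams extending a string. -/
def cyl (τ : BStr) : Set (ℕ → Bool) := {y | stake y τ.length = τ}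

theorem mem_cyl {τ : BStr} {y : ℕ → Bool} : y ∈ cyl τ ↔ stake y τ.length = τ := Iff.rfl

theorem mem_cyl_stake (y : ℕ → Bool) (n : ℕ) : y ∈ cyl (stake y n) := by
  simp [mem_cyl]

theorem mem_cyl_nil (y : ℕ → Bool) : y ∈ cyl [] := by simp [mem_cyl, stake]

theorem mem_cyl_of_prefix {σ τ : BStr} {y : ℕ → Bool} (h : σ <+: τ) (hy : y ∈ cyl τ) :
    y ∈ cyl σ := by
  rw [mem_cyl] at *
  rw [← take_stake y h.length_le, hy]
  exact (List.prefix_iff_eq_take.1 h).symm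

theorem mem_cyl_iff_prefix_stake {τ : BStr} {y : ℕ → Bool} {n : ℕ} (h : τ.length ≤ n) :
    y ∈ cyl τ ↔ τ <+: stake y n := by
  rw [mem_cyl]
  constructor
  · intro hy; rw [← hy]; exact stake_prefix y h
  · intro hy
    rw [List.prefix_iff_eq_take, take_stake y h] at hy
    exact hy.symm

theorem prefix_or_prefix_of_mem_cyl {σ τ : BStr} {y : ℕ → Bool} (h1 : y ∈ cyl σ)
    (h2 : y ∈ cyl τ) : σ <+: τ ∨ τ <+: σ := by
  rw [mem_cyl] at *
  rcases le_total σ.length τ.length with h | h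
  · left; rw [← h1, ← h2]; exact stake_prefix y h
  · right; rw [← h1, ← h2]; exact stake_prefix y h

theorem mem_cyl_append_singleton {τ : BStr} {b : Bool} {y : ℕ → Bool} :
    y ∈ cyl (τ ++ [b]) ↔ y ∈ cyl τ ∧ y τ.length = b := by
  rw [mem_cyl, mem_cyl]
  simp [stake_succ]

theorem cyl_eq_pi (τ : BStr) :
    cyl τ = Set.pi (Finset.range τ.length) (fun i => {τ.getD i false}) := by
  ext y
  rw [mem_cyl]
  simp only [Set.mem_pi, Finset.coe_range, Set.mem_Iio, Set.mem_singleton_iff]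
  constructor
  · intro h i hi
    conv_rhs => rw [← h]
    simp [stake, List.getD, hi]
  · intro h
    apply List.ext_getElem (by simp)
    intro i h1 h2
    simpa [stake, List.getD, h2] using h i h2

/-- The fair coin measure on streams. -/
noncomputable def coin : MeasureTheory.Measure (ℕ → Bool) :=
  MeasureTheory.Measure.infinitePi (fun _ : ℕ => (PMF.uniformOfFintype Bool).toMeasure)

instance : MeasureTheory.IsProbabilityMeasure coin := by
  unfold coin; infer_instance

theorem measurableSet_cyl (τ : BStr) : MeasurableSet (cyl τ) := by
  rw [cyl_eq_pi]
  exact MeasurableSet.pi (Finset.countable_toSet _) fun _ _ => MeasurableSet.of_discrete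

theorem coin_cyl (τ : BStr) : coin (cyl τ) = ((2 : ℝ≥0∞) ^ τ.length)⁻¹ := by
  rw [cyl_eq_pi, coin, MeasureTheory.Measure.infinitePi_pi _
    (fun _ _ => MeasurableSet.of_discrete)]
  simp [ENNReal.inv_pow]

theorem disjoint_cyl {σ τ : BStr} (h1 : ¬ σ <+: τ) (h2 : ¬ τ <+: σ) :
    Disjoint (cyl σ) (cyl τ) := by
  rw [Set.disjoint_left]
  intro y hy hy'
  rcases prefix_or_prefix_of_mem_cyl hy hy' with h | h
  exacts [h1 h, h2 h]

theorem kraft_sum_le_one {ι : Type*} [Countable ι] (f : ι → Option BStr)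
    (hf : ∀ i j σ τ, f i = some σ → f j = some τ → σ <+: τ → i = j) :
    ∑' i, ((f i).elim 0 fun σ => ((2 : ℝ≥0∞) ^ σ.length)⁻¹) ≤ 1 := by
  have h : ∀ i, ((f i).elim 0 fun σ => ((2 : ℝ≥0∞) ^ σ.length)⁻¹) =
      coin ((f i).elim ∅ cyl) := by
    intro i
    cases f i with
    | none => simp
    | some σ => simp [coin_cyl]
  simp_rw [h]
  rw [← MeasureTheory.measure_iUnion]
  · exact MeasureTheory.prob_le_one
  · intro i j hij
    cases hi : f i with
    | none => simp [Function.onFun, hi]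
    | some σ =>
      cases hj : f j with
      | none => simp [Function.onFun, hj]
      | some τ =>
        simp only [Function.onFun, hi, hj, Option.elim]
        exact disjoint_cyl (fun h => hij (hf _ _ _ _ hi hj h))
          (fun h => hij (hf _ _ _ _ hj hi h).symm)
  · intro i
    cases f i with
    | none => simp
    | some σ => exact measurableSet_cyl σ

/-- A request: labels with code lengths, the most demanding one first. -/
abbrev Req := List (BStr × ℕ)

/-- The code length demanded by a request. -/
def lev (r : Req) : ℕ := r.head?.elim 0 Prod.snd

@[simp] theorem lev_nil : lev [] = 0 := rfl
@[simp] theorem lev_cons (a : BStr × ℕ) (t : Req) : lev (a :: t) = a.2 := rfl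

/-- The request generated by the first `i` nonempty prefixes of `ρ` when their levels are
given by `lv`. -/
def chainTo (lv : BStr → ℕ) (ρ : BStr) : ℕ → Req
  | 0 => []
  | i + 1 => (ρ.take (i + 1), lv (ρ.take (i + 1))) ::
      (chainTo lv ρ i).filter (fun b => b.2 ≤ lv (ρ.take (i + 1)))

/-- The request generated by the nonempty prefixes of `ρ`. -/
def chain (lv : BStr → ℕ) (ρ : BStr) : Req := chainTo lv ρ ρ.length

variable {lv : BStr → ℕ} {ρ : BStr}

theorem chainTo_congr {lv' : BStr → ℕ} {ρ' : BStr} {i : ℕ}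
    (hρ : ρ.take i = ρ'.take i) (h : ∀ j, 1 ≤ j → j ≤ i → lv (ρ.take j) = lv' (ρ.take j)) :
    chainTo lv ρ i = chainTo lv' ρ' i := by
  induction i with
  | zero => rfl
  | succ i ih =>
    have h1 : ρ.take i = ρ'.take i := by
      have := congrArg (List.take i) hρ
      simpa [List.take_take] using this
    simp only [chainTo]
    rw [ih h1 fun j hj hji => h j hj (by omega), ← hρ, h (i + 1) (by omega) le_rfl]

theorem chain_take {i : ℕ} (h : i ≤ ρ.length) : chain lv (ρ.take i) = chainTo lv ρ i := by
  rw [chain, List.length_take, min_eq_left h]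
  exact chainTo_congr (by simp) fun _ _ _ => rfl

theorem chain_congr {lv' : BStr → ℕ}
    (h : ∀ ρ', ρ' ≠ [] → ρ' <+: ρ → lv ρ' = lv' ρ') : chain lv ρ = chain lv' ρ := by
  rcases ρ.eq_nil_or_concat with rfl | ⟨_, _, rfl⟩
  · rfl
  · refine chainTo_congr rfl fun j hj hj' => h _ ?_ (List.take_prefix _ _)
    intro h0
    have := congrArg List.length h0
    simp at this hj'
    omega

theorem chainTo_filter (L i : ℕ) :
    ∃ j ≤ i, (chainTo lv ρ i).filter (fun b => b.2 ≤ L) = chainTo lv ρ j := by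
  induction i generalizing L with
  | zero => exact ⟨0, le_rfl, rfl⟩
  | succ i ih =>
    by_cases hL : lv (ρ.take (i + 1)) ≤ L
    · refine ⟨i + 1, le_rfl, ?_⟩
      rw [List.filter_eq_self]
      intro b hb
      rw [chainTo, List.mem_cons, List.mem_filter] at hb
      rcases hb with rfl | ⟨_, hb⟩
      · simpa using hL
      · simp only [decide_eq_true_eq] at hb ⊢
        exact hb.trans hL
    · obtain ⟨j, hj, h⟩ := ih L
      refine ⟨j, by omega, ?_⟩
      rw [← h, chainTo, List.filter_cons_of_neg (by simpa using hL), List.filter_filter]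
      refine List.filter_congr fun b _ => ?_
      simp only [← Bool.decide_and, decide_eq_decide]
      omega

/-- A request of the shape produced by `chain`, all of whose suffixes lie in `R`. -/
structure GoodReq (R : Set Req) (r : Req) : Prop where
  mem : ∀ r', r' <:+ r → r' ≠ [] → r' ∈ R
  lev_tail : ∀ a t, a :: t <:+ r → lev t ≤ a.2
  label : ∀ a t, a :: t <:+ r → ∀ b ∈ t, b.1 <+: a.1

theorem GoodReq.of_suffix {R : Set Req} {r r' : Req} (h : GoodReq R r) (hs : r' <:+ r) :
    GoodReq R r' :=
  ⟨fun r'' h1 => h.mem r'' (h1.trans hs), fun a t h1 => h.lev_tail a t (h1.trans hs),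
    fun a t h1 => h.label a t (h1.trans hs)⟩

theorem label_of_mem_chainTo {i : ℕ} {b : BStr × ℕ} (hb : b ∈ chainTo lv ρ i) :
    b.1 <+: ρ.take i := by
  induction i with
  | zero => simp [chainTo] at hb
  | succ i ih =>
    rw [chainTo, List.mem_cons, List.mem_filter] at hb
    rcases hb with rfl | ⟨hb, _⟩
    · exact List.prefix_rfl
    · refine (ih hb).trans ?_
      rw [List.prefix_take_iff]
      exact ⟨List.take_prefix _ _, by simp⟩

theorem goodReq_chainTo {R : Set Req} {i : ℕ}
    (hR : ∀ j, 1 ≤ j → j ≤ i → chainTo lv ρ j ∈ R) : GoodReq R (chainTo lv ρ i) := by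
  induction i using Nat.strong_induction_on with
  | _ i ih =>
  cases i with
  | zero =>
    refine ⟨fun r' h h' => ?_, fun a t h => ?_, fun a t h => ?_⟩ <;>
    simp_all [chainTo]
  | succ i =>
    have hself := hR (i + 1) (by omega) le_rfl
    obtain ⟨j, hj, hf⟩ := chainTo_filter (lv := lv) (ρ := ρ) (lv (ρ.take (i + 1))) i
    have hlev : ∀ b ∈ chainTo lv ρ j, b.2 ≤ lv (ρ.take (i + 1)) ∧ b.1 <+: ρ.take (i + 1) := by
      intro b hb
      rw [← hf, List.mem_filter] at hb
      refine ⟨by simpa using hb.2, ?_⟩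
      have : b ∈ chainTo lv ρ (i + 1) := by
        rw [chainTo, List.mem_cons, List.mem_filter]; exact Or.inr hb
      exact label_of_mem_chainTo this
    have ih' := ih j (by omega) fun k hk hk' => hR k hk (by omega)
    rw [chainTo] at hself ⊢
    rw [hf] at hself ⊢
    refine ⟨fun r' h h' => ?_, fun a t h => ?_, fun a t h => ?_⟩
    · rw [List.suffix_cons_iff] at h
      rcases h with rfl | h
      · exact hself
      · exact ih'.mem r' h h'
    · rw [List.suffix_cons_iff] at h
      rcases h with h | h
      · obtain ⟨rfl, rfl⟩ := List.cons.inj h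
        cases hc : chainTo lv ρ j with
        | nil => simp
        | cons b t => exact (hlev b (by simp [hc])).1
      · exact ih'.lev_tail a t h
    · rw [List.suffix_cons_iff] at h
      rcases h with h | h
      · obtain ⟨rfl, rfl⟩ := List.cons.inj h
        exact fun b hb => (hlev b hb).2
      · exact ih'.label a t h

theorem goodReq_chain {R : Set Req} (hR : ∀ ρ', ρ' ≠ [] → ρ' <+: ρ → chain lv ρ' ∈ R) :
    GoodReq R (chain lv ρ) := by
  refine goodReq_chainTo fun j hj hj' => ?_
  rw [← chain_take hj']
  refine hR _ ?_ (List.take_prefix _ _)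
  intro h0
  have := congrArg List.length h0
  rw [List.length_take, List.length_nil, min_eq_left hj'] at this
  omega

theorem exists_mem_chainTo {i n : ℕ} (hi : 1 ≤ i) (hn : i ≤ n) :
    ∃ b ∈ chainTo lv ρ n, ρ.take i <+: b.1 ∧ b.2 ≤ lv (ρ.take i) := by
  induction n, hn using Nat.le_induction with
  | base =>
    obtain ⟨i, rfl⟩ := Nat.exists_eq_succ_of_ne_zero (by omega : i ≠ 0)
    exact ⟨(ρ.take (i + 1), lv (ρ.take (i + 1))), by simp [chainTo], List.prefix_rfl, le_rfl⟩
  | succ n hn ih =>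
    obtain ⟨b, hb, h1, h2⟩ := ih
    by_cases h : b.2 ≤ lv (ρ.take (n + 1))
    · exact ⟨b, by simp [chainTo, hb, h], h1, h2⟩
    · refine ⟨(ρ.take (n + 1), lv (ρ.take (n + 1))), by simp [chainTo], ?_, ?_⟩
      · rw [List.prefix_take_iff]
        exact ⟨List.take_prefix _ _, by simp; omega⟩
      · simp only
        omega

theorem chain_ne_nil (h : ρ ≠ []) : ∃ t, chain lv ρ = (ρ, lv ρ) :: t := by
  obtain ⟨n, hn⟩ : ∃ n, ρ.length = n + 1 :=
    Nat.exists_eq_succ_of_ne_zero (by simpa using h)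
  rw [chain, hn, chainTo, List.take_of_length_le hn.le]
  exact ⟨_, rfl⟩

/-- Allocated codes and free strings, each with the request it is reserved for. -/
abbrev AllocState := List (Req × BStr) × List (Req × BStr)

/-- A free string of length `l` reserved for `t`. -/
def freeOfLength (free : List (Req × BStr)) (t : Req) (l : ℕ) : Option BStr :=
  ((free.filter (fun e => e.1 = t ∧ e.2.length = l)).head?).map Prod.snd

/-- The longest free string of length at most `l` reserved for `t`. -/
def longestFree (free : List (Req × BStr)) (t : Req) : ℕ → Option BStr
  | 0 => freeOfLength free t 0
  | l + 1 => freeOfLength free t (l + 1) <|> longestFree free t l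

/-- Allocate a code for `a :: t` at the left end of the free string `π`. -/
def splitFree (st : AllocState) (a : BStr × ℕ) (t : Req) (π : BStr) : AllocState :=
  ((a :: t, π ++ List.replicate (a.2 - π.length) false) :: st.1,
    (a :: t, π ++ List.replicate (a.2 - π.length) false) ::
      ((List.range (a.2 - π.length)).map (fun j => (t, π ++ List.replicate j false ++ [true])) ++
        st.2.filter (fun e => e ≠ (t, π))))

/-- Allocate a code for a request, allocating codes for its suffixes first if necessary. -/
def serve : Req → AllocState → AllocState
  | [], st => st
  | a :: t, st =>
    let st1 := if (longestFree st.2 t a.2).isSome then st else serve t st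
    (longestFree st1.2 t a.2).elim st1 (splitFree st1 a t)

theorem freeOfLength_eq_some {free : List (Req × BStr)} {t : Req} {l : ℕ} {π : BStr}
    (h : freeOfLength free t l = some π) : (t, π) ∈ free ∧ π.length = l := by
  rw [freeOfLength, Option.map_eq_some_iff] at h
  obtain ⟨⟨t', π'⟩, h, rfl⟩ := h
  have := List.mem_of_mem_head? h
  simp only [List.mem_filter, Bool.decide_and, Bool.and_eq_true, decide_eq_true_eq] at this
  obtain ⟨h1, rfl, h2⟩ := this
  exact ⟨h1, h2⟩

theorem freeOfLength_eq_none {free : List (Req × BStr)} {t : Req} {l : ℕ}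
    (h : freeOfLength free t l = none) {π : BStr} (hπ : (t, π) ∈ free) : π.length ≠ l := by
  intro hl
  simp only [freeOfLength, Option.map_eq_none_iff, List.head?_eq_none_iff,
    List.filter_eq_nil_iff] at h
  exact h _ hπ (by simp [hl])

theorem longestFree_eq_some {free : List (Req × BStr)} {t : Req} {l : ℕ} {π : BStr}
    (h : longestFree free t l = some π) : (t, π) ∈ free ∧ π.length ≤ l ∧
      ∀ π', (t, π') ∈ free → π'.length ≤ l → π'.length ≤ π.length := by
  induction l with
  | zero =>
    obtain ⟨h1, h2⟩ := freeOfLength_eq_some h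
    exact ⟨h1, h2.le, fun π' _ h' => by omega⟩
  | succ l ih =>
    rw [longestFree] at h
    cases hf : freeOfLength free t (l + 1) with
    | some π' =>
      rw [hf] at h
      obtain rfl : π' = π := Option.some.inj h
      obtain ⟨h1, h2⟩ := freeOfLength_eq_some hf
      exact ⟨h1, h2.le, fun π' _ h' => by omega⟩
    | none =>
      rw [hf] at h
      replace h : longestFree free t l = some π := h
      obtain ⟨h1, h2, h3⟩ := ih h
      refine ⟨h1, by omega, fun π' h4 h5 => h3 π' h4 ?_⟩
      have := freeOfLength_eq_none hf h4
      omega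

theorem longestFree_isSome {free : List (Req × BStr)} {t : Req} {l : ℕ} :
    (longestFree free t l).isSome ↔ ∃ π, (t, π) ∈ free ∧ π.length ≤ l := by
  constructor
  · intro h
    obtain ⟨π, h⟩ := Option.isSome_iff_exists.1 h
    exact ⟨π, (longestFree_eq_some h).1, (longestFree_eq_some h).2.1⟩
  · rintro ⟨π, h1, h2⟩
    induction l with
    | zero =>
      rw [longestFree, Option.isSome_iff_ne_none]
      exact fun h => freeOfLength_eq_none h h1 (by omega)
    | succ l ih =>
      rw [longestFree]
      cases hf : freeOfLength free t (l + 1) with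
      | some π' => simp
      | none =>
        have := freeOfLength_eq_none hf h1
        simpa using ih (by omega)

/-- The invariants of the allocation: `E` is the set of streams that must stay covered, and
`R` the set of admissible requests. -/
structure AllocInv (E : Set (ℕ → Bool)) (R : Set Req) (st : AllocState) : Prop where
  code_ne_nil : ∀ r τ, (r, τ) ∈ st.1 → r ≠ []
  code_length : ∀ r τ, (r, τ) ∈ st.1 → τ.length = lev r
  code_tail : ∀ a t τ, (a :: t, τ) ∈ st.1 → t ≠ [] → ∃ τ', (t, τ') ∈ st.1 ∧ τ' <+: τ
  code_good : ∀ r τ, (r, τ) ∈ st.1 → GoodReq R r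
  free_code : ∀ r π, (r, π) ∈ st.2 → r ≠ [] → ∃ τ, (r, τ) ∈ st.1 ∧ τ <+: π
  free_antichain : ∀ e ∈ st.2, ∀ e' ∈ st.2, e.2 <+: e'.2 → e = e'
  code_free : ∀ e ∈ st.1, ∀ e' ∈ st.2, (e.2 <+: e'.2 ∨ e'.2 <+: e.2) →
    e.2 <+: e'.2 ∧ e.1 <:+ e'.1
  code_code : ∀ e ∈ st.1, ∀ e' ∈ st.1, e.2 <+: e'.2 → (e.1 <:+ e'.1 ∨ e'.1 <:+ e.1)
  free_length_inj : ∀ r π π', (r, π) ∈ st.2 → (r, π') ∈ st.2 → π.length = π'.length → π = π'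
  cover : ∀ y ∈ E, ∃ e ∈ st.2, y ∈ cyl e.2

theorem AllocInv.free_good {E : Set (ℕ → Bool)} {R : Set Req} {st : AllocState}
    (h : AllocInv E R st) {r : Req} {π : BStr} (hr : (r, π) ∈ st.2) : r = [] ∨ r ∈ R := by
  by_cases h0 : r = []
  · exact Or.inl h0
  · obtain ⟨τ, h1, _⟩ := h.free_code r π hr h0
    exact Or.inr ((h.code_good r τ h1).mem r List.suffix_rfl h0)

theorem AllocInv.lev_le_of_free {E : Set (ℕ → Bool)} {R : Set Req} {st : AllocState}
    (h : AllocInv E R st) {r : Req} {π : BStr} (hr : (r, π) ∈ st.2) : lev r ≤ π.length := by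
  by_cases h0 : r = []
  · simp [h0]
  · obtain ⟨τ, h1, h2⟩ := h.free_code r π hr h0
    rw [← h.code_length r τ h1]
    exact h2.length_le

theorem allocInv_init (E : Set (ℕ → Bool)) (R : Set Req) : AllocInv E R ([], [([], [])]) where
  code_ne_nil := by simp
  code_length := by simp
  code_tail := by simp
  code_good := by simp
  free_code := by simp
  free_antichain := by simp
  code_free := by simp
  code_code := by simp
  free_length_inj := by simp +contextual
  cover := fun y _ => ⟨([], []), by simp, mem_cyl_nil y⟩

theorem replicate_split {j m : ℕ} (h : j < m) :
    List.replicate m false = List.replicate j false ++ false :: List.replicate (m - j - 1) false := by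
  rw [← List.replicate_succ, List.replicate_append_replicate]
  congr 1
  omega

theorem not_prefix_replicate {π w : BStr} {j m : ℕ} (h : j < m) :
    ¬ (π ++ List.replicate j false ++ [true] <+: π ++ List.replicate m false ++ w) := by
  rw [replicate_split h]
  simp only [List.append_assoc, List.prefix_append_right_inj]
  simp

theorem not_replicate_prefix {π w : BStr} {j m : ℕ} (h : j < m) :
    ¬ (π ++ List.replicate m false ++ w <+: π ++ List.replicate j false ++ [true]) := by
  rw [replicate_split h]
  simp only [List.append_assoc, List.prefix_append_right_inj]
  simp

theorem mem_cyl_split {π : BStr} {y : ℕ → Bool} (hy : y ∈ cyl π) (k : ℕ) :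
    y ∈ cyl (π ++ List.replicate k false) ∨
      ∃ j < k, y ∈ cyl (π ++ List.replicate j false ++ [true]) := by
  induction k with
  | zero => left; simpa using hy
  | succ k ih =>
    rcases ih with h | ⟨j, hj, h⟩
    · cases hb : y (π ++ List.replicate k false).length with
      | false =>
        left
        rw [List.replicate_succ', ← List.append_assoc, mem_cyl_append_singleton]
        exact ⟨h, hb⟩
      | true =>
        right
        exact ⟨k, by omega, mem_cyl_append_singleton.2 ⟨h, hb⟩⟩
    · exact Or.inr ⟨j, by omega, h⟩

theorem mem_splitFree_free {st : AllocState} {a : BStr × ℕ} {t : Req} {π : BStr}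
    {e : Req × BStr} : e ∈ (splitFree st a t π).2 ↔
      e = (a :: t, π ++ List.replicate (a.2 - π.length) false) ∨
      (∃ j < a.2 - π.length, e = (t, π ++ List.replicate j false ++ [true])) ∨
      (e ∈ st.2 ∧ e ≠ (t, π)) := by
  simp only [splitFree, List.mem_cons, List.mem_append, List.mem_map, List.mem_range,
    List.mem_filter, decide_eq_true_eq, eq_comm (b := e)]

theorem prefix_trans_cases {σ π ν : BStr} (hπ : π <+: ν) (h : σ <+: ν ∨ ν <+: σ) :
    σ <+: π ∨ π <+: σ := by
  rcases h with h | h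
  · exact List.prefix_or_prefix_of_prefix h hπ
  · exact Or.inr (hπ.trans h)

theorem AllocInv.split {E : Set (ℕ → Bool)} {R : Set Req} {st : AllocState}
    (h : AllocInv E R st) {a : BStr × ℕ} {t : Req} {π : BStr} (hr : GoodReq R (a :: t))
    (hπ : (t, π) ∈ st.2) (hle : π.length ≤ a.2)
    (hmax : ∀ π', (t, π') ∈ st.2 → π'.length ≤ a.2 → π'.length ≤ π.length)
    (hfree : ∀ π', (a :: t, π') ∈ st.2 → a.2 < π'.length) :
    AllocInv E R (splitFree st a t π) := by
  set k := a.2 - π.length with hk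
  set ν := π ++ List.replicate k false with hν
  have hνlen : ν.length = a.2 := by simp [hν, hk]; omega
  have hπν : π <+: ν := List.prefix_append _ _
  have hat : ¬ (a :: t <:+ t) := fun h => by simpa using h.length_le
  have hcodes : ∀ e, e ∈ (splitFree st a t π).1 ↔ e = (a :: t, ν) ∨ e ∈ st.1 := by
    intro e; simp only [splitFree, List.mem_cons, hν, hk]
  have hfr : ∀ e, e ∈ (splitFree st a t π).2 ↔ e = (a :: t, ν) ∨
      (∃ j < k, e = (t, π ++ List.replicate j false ++ [true])) ∨
      (e ∈ st.2 ∧ e ≠ (t, π)) := fun e => mem_splitFree_free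
  have hold : ∀ e ∈ st.1, (e.2 <+: π ∨ π <+: e.2) → e.2 <+: π ∧ e.1 <:+ t :=
    fun e he h' => h.code_free e he (t, π) hπ h'
  have hother : ∀ e ∈ st.2, e ≠ (t, π) → ∀ σ, π <+: σ → ¬ (e.2 <+: σ ∨ σ <+: e.2) := by
    intro e he hne σ hσ h'
    rcases prefix_trans_cases hσ h' with h1 | h1
    · exact hne (h.free_antichain e he _ hπ h1)
    · exact hne (h.free_antichain _ hπ e he h1).symm
  have hpj : ∀ j, π <+: π ++ List.replicate j false ++ [true] := fun j => by
    rw [List.append_assoc]; exact List.prefix_append _ _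
  have hνj : ∀ j < k, ¬ (ν <+: π ++ List.replicate j false ++ [true] ∨
      π ++ List.replicate j false ++ [true] <+: ν) := by
    rintro j hj (h1 | h1)
    · exact not_replicate_prefix (w := []) hj (by rw [List.append_nil]; exact h1)
    · exact not_prefix_replicate (w := []) hj (by rw [List.append_nil]; exact h1)
  refine ⟨?_, ?_, ?_, ?_, ?_, ?_, ?_, ?_, ?_, ?_⟩
  · intro r τ hr
    rcases (hcodes _).1 hr with h1 | h1
    · simp [(Prod.mk.inj h1).1]
    · exact h.code_ne_nil r τ h1
  · intro r τ hr
    rcases (hcodes _).1 hr with h1 | h1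
    · obtain ⟨rfl, rfl⟩ := Prod.mk.inj h1; exact hνlen
    · exact h.code_length r τ h1
  · intro a' t' τ hr ht
    rcases (hcodes _).1 hr with h1 | h1
    · obtain ⟨h2, rfl⟩ := Prod.mk.inj h1
      obtain ⟨rfl, rfl⟩ := List.cons.inj h2
      obtain ⟨τ', h3, h4⟩ := h.free_code _ π hπ ht
      exact ⟨τ', (hcodes _).2 (Or.inr h3), h4.trans hπν⟩
    · obtain ⟨τ', h3, h4⟩ := h.code_tail a' t' τ h1 ht
      exact ⟨τ', (hcodes _).2 (Or.inr h3), h4⟩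
  · intro r τ hr'
    rcases (hcodes _).1 hr' with h1 | h1
    · rw [(Prod.mk.inj h1).1]; exact hr
    · exact h.code_good r τ h1
  · intro r σ hr ht
    rcases (hfr _).1 hr with h1 | ⟨j, hj, h1⟩ | ⟨h1, _⟩
    · obtain ⟨rfl, rfl⟩ := Prod.mk.inj h1
      exact ⟨ν, (hcodes _).2 (Or.inl rfl), List.prefix_rfl⟩
    · obtain ⟨rfl, rfl⟩ := Prod.mk.inj h1
      obtain ⟨τ', h3, h4⟩ := h.free_code _ π hπ ht
      exact ⟨τ', (hcodes _).2 (Or.inr h3), h4.trans (hpj j)⟩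
    · obtain ⟨τ', h3, h4⟩ := h.free_code r σ h1 ht
      exact ⟨τ', (hcodes _).2 (Or.inr h3), h4⟩
  · intro e he e' he' hp
    rcases (hfr _).1 he with rfl | ⟨j, hj, rfl⟩ | ⟨h1, hne⟩ <;>
    rcases (hfr _).1 he' with rfl | ⟨j', hj', rfl⟩ | ⟨h1', hne'⟩
    · rfl
    · exact absurd (Or.inl hp) (hνj j' hj')
    · exact absurd (Or.inr hp) (hother e' h1' hne' _ hπν)
    · exact absurd (Or.inr hp) (hνj j hj)
    · rcases lt_trichotomy j j' with hlt | rfl | hlt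
      · exact absurd hp (not_prefix_replicate hlt)
      · rfl
      · exact absurd hp (not_replicate_prefix hlt)
    · exact absurd (Or.inr hp) (hother e' h1' hne' _ (hpj j))
    · exact absurd (Or.inl hp) (hother e h1 hne _ hπν)
    · exact absurd (Or.inl hp) (hother e h1 hne _ (hpj j'))
    · exact h.free_antichain e h1 e' h1' hp
  · intro e he e' he' hp
    rcases (hcodes _).1 he with rfl | h1 <;>
    rcases (hfr _).1 he' with rfl | ⟨j', hj', rfl⟩ | ⟨h1', hne'⟩
    · exact ⟨List.prefix_rfl, List.suffix_rfl⟩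
    · exact absurd hp (hνj j' hj')
    · exact absurd hp.symm (hother e' h1' hne' _ hπν)
    · obtain ⟨h2, h3⟩ := hold e h1 (prefix_trans_cases hπν hp)
      exact ⟨h2.trans hπν, h3.trans (List.suffix_cons a t)⟩
    · obtain ⟨h2, h3⟩ := hold e h1 (prefix_trans_cases (hpj j') hp)
      exact ⟨h2.trans (hpj j'), h3⟩
    · exact h.code_free e h1 e' h1' hp
  · intro e he e' he' hp
    rcases (hcodes _).1 he with rfl | h1 <;> rcases (hcodes _).1 he' with rfl | h1'
    · exact Or.inl List.suffix_rfl
    · exact Or.inr ((hold e' h1' (prefix_trans_cases hπν (Or.inr hp))).2.trans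
        (List.suffix_cons a t))
    · exact Or.inl ((hold e h1 (prefix_trans_cases hπν (Or.inl hp))).2.trans
        (List.suffix_cons a t))
    · exact h.code_code e h1 e' h1' hp
  · intro r σ σ' hσ hσ' hlen
    have key : ∀ j < k, ∀ σ, (t, σ) ∈ st.2 → (t, σ) ≠ (t, π) →
        (π ++ List.replicate j false ++ [true]).length ≠ σ.length := by
      intro j hj σ h1 hne h2
      rw [List.length_append, List.length_append, List.length_replicate,
        List.length_singleton] at h2
      have := hmax σ h1 (by omega)
      omega
    have ha : ∀ σ, (a :: t, σ) ∈ st.2 → ν.length ≠ σ.length := by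
      intro σ h1 h2
      have := hfree σ h1
      omega
    have hta : t ≠ a :: t := fun h => hat (h ▸ List.suffix_rfl)
    rcases (hfr _).1 hσ with h1 | ⟨j, hj, h1⟩ | ⟨h1, hne⟩ <;>
    rcases (hfr _).1 hσ' with h1' | ⟨j', hj', h1'⟩ | ⟨h1', hne'⟩
    · rw [(Prod.mk.inj h1).2, (Prod.mk.inj h1').2]
    · exact absurd ((Prod.mk.inj h1').1.symm.trans (Prod.mk.inj h1).1) hta
    · obtain ⟨rfl, rfl⟩ := Prod.mk.inj h1
      exact absurd hlen (ha _ h1')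
    · exact absurd ((Prod.mk.inj h1).1.symm.trans (Prod.mk.inj h1').1) hta
    · rw [(Prod.mk.inj h1).2, (Prod.mk.inj h1').2] at hlen ⊢
      simp at hlen
      rw [hlen]
    · obtain ⟨rfl, rfl⟩ := Prod.mk.inj h1
      exact absurd hlen (key j hj _ h1' hne')
    · obtain ⟨rfl, rfl⟩ := Prod.mk.inj h1'
      exact absurd hlen.symm (ha _ h1)
    · obtain ⟨rfl, rfl⟩ := Prod.mk.inj h1'
      exact absurd hlen.symm (key j' hj' _ h1 hne)
    · exact h.free_length_inj r σ σ' h1 h1' hlen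
  · intro y hy
    obtain ⟨e, he, hye⟩ := h.cover y hy
    by_cases hne : e = (t, π)
    · subst hne
      rcases mem_cyl_split hye k with h1 | ⟨j, hj, h1⟩
      · exact ⟨_, (hfr _).2 (Or.inl rfl), h1⟩
      · exact ⟨_, (hfr _).2 (Or.inr (Or.inl ⟨j, hj, rfl⟩)), h1⟩
    · exact ⟨e, (hfr _).2 (Or.inr (Or.inr ⟨he, hne⟩)), hye⟩

/-- Free strings reserved for `r` can be dropped when no code of `r` is needed any more. -/
theorem AllocInv.discard {E : Set (ℕ → Bool)} {R : Set Req} {st : AllocState}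
    (h : AllocInv E R st) {r : Req} (hr : r ≠ [])
    (hdead : ∀ τ, (r, τ) ∈ st.1 → Disjoint E (cyl τ)) :
    AllocInv E R (st.1, st.2.filter (fun e => e.1 ≠ r)) := by
  have hsub : ∀ e, e ∈ st.2.filter (fun e => e.1 ≠ r) ↔ e ∈ st.2 ∧ e.1 ≠ r := by
    intro e; simp
  refine ⟨h.code_ne_nil, h.code_length, h.code_tail, h.code_good, ?_, ?_, ?_, h.code_code, ?_, ?_⟩
  · exact fun r' π h1 => h.free_code r' π ((hsub _).1 h1).1
  · exact fun e he e' he' => h.free_antichain e ((hsub _).1 he).1 e' ((hsub _).1 he').1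
  · exact fun e he e' he' => h.code_free e he e' ((hsub _).1 he').1
  · exact fun r' π π' h1 h2 => h.free_length_inj r' π π' ((hsub _).1 h1).1 ((hsub _).1 h2).1
  · intro y hy
    obtain ⟨⟨r', π⟩, he, hye⟩ := h.cover y hy
    refine ⟨(r', π), (hsub _).2 ⟨he, ?_⟩, hye⟩
    rintro rfl
    obtain ⟨τ, h1, h2⟩ := h.free_code r' π he hr
    exact Set.disjoint_left.1 (hdead τ h1) hy (mem_cyl_of_prefix h2 hye)

/-- There is always a short free string at the root. -/
def RootFree (E : Set (ℕ → Bool)) (R : Set Req) : Prop :=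
  ∀ st, AllocInv E R st → ∀ a, [a] ∈ R → ∃ π, (([] : Req), π) ∈ st.2 ∧ π.length ≤ a.2

theorem AllocInv.serve_of_free {E : Set (ℕ → Bool)} {R : Set Req} {st : AllocState}
    (h : AllocInv E R st) {a : BStr × ℕ} {t : Req} (hr : GoodReq R (a :: t))
    (hfree : ∀ π, (a :: t, π) ∈ st.2 → a.2 < π.length)
    (hex : ∃ π, (t, π) ∈ st.2 ∧ π.length ≤ a.2) {st' : AllocState}
    (hst' : st' = (longestFree st.2 t a.2).elim st (splitFree st a t)) :
    AllocInv E R st' ∧ st.1 ⊆ st'.1 ∧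
    (∃ τ, (a :: t, τ) ∈ st'.1 ∧ (a :: t, τ) ∉ st.1) ∧
    (∃ π, (a :: t, π) ∈ st'.2 ∧ π.length = a.2) ∧
    (∀ e ∈ st'.2, e ∈ st.2 ∨ e.1 <:+ a :: t) := by
  obtain ⟨π, hπ⟩ := Option.isSome_iff_exists.1 (longestFree_isSome.2 hex)
  obtain ⟨h1, h2, h3⟩ := longestFree_eq_some hπ
  rw [hπ, Option.elim_some] at hst'
  subst hst'
  refine ⟨h.split hr h1 h2 h3 hfree, ?_, ⟨π ++ List.replicate (a.2 - π.length) false, ?_, ?_⟩,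
    ⟨π ++ List.replicate (a.2 - π.length) false, mem_splitFree_free.2 (Or.inl rfl), ?_⟩, ?_⟩
  · intro e he; simp [splitFree, he]
  · simp [splitFree]
  · intro hc
    have := (h.code_free _ hc _ h1 (Or.inr (List.prefix_append _ _))).2.length_le
    simp at this
  · simp; omega
  · intro e he
    rcases mem_splitFree_free.1 he with rfl | ⟨j, _, rfl⟩ | ⟨he, _⟩
    · exact Or.inr List.suffix_rfl
    · exact Or.inr (List.suffix_cons a t)
    · exact Or.inl he

theorem AllocInv.serve {E : Set (ℕ → Bool)} {R : Set Req} (hroot : RootFree E R)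
    {a : BStr × ℕ} {t : Req} {st : AllocState} (h : AllocInv E R st) (hr : GoodReq R (a :: t))
    (hfree : ∀ π, (a :: t, π) ∈ st.2 → a.2 < π.length) :
    AllocInv E R (serve (a :: t) st) ∧ st.1 ⊆ (OptUse.serve (a :: t) st).1 ∧
    (∃ τ, (a :: t, τ) ∈ (OptUse.serve (a :: t) st).1 ∧ (a :: t, τ) ∉ st.1) ∧
    (∃ π, (a :: t, π) ∈ (OptUse.serve (a :: t) st).2 ∧ π.length = a.2) ∧
    (∀ e ∈ (OptUse.serve (a :: t) st).2, e ∈ st.2 ∨ e.1 <:+ a :: t) := by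
  induction t generalizing a with
  | nil =>
    refine h.serve_of_free hr hfree (hroot st h a (hr.mem _ List.suffix_rfl (by simp))) ?_
    simp [OptUse.serve]
  | cons b t ih =>
    by_cases hc : (longestFree st.2 (b :: t) a.2).isSome
    · refine h.serve_of_free hr hfree (longestFree_isSome.1 hc) ?_
      rw [OptUse.serve, if_pos hc]
    · have hb : b.2 ≤ a.2 := hr.lev_tail a (b :: t) List.suffix_rfl
      have hnone : ∀ π, (b :: t, π) ∈ st.2 → b.2 < π.length := by
        intro π hπ
        by_contra hle
        exact hc (longestFree_isSome.2 ⟨π, hπ, by omega⟩)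
      obtain ⟨h1, h2, _, ⟨π, h4, h5⟩, h6⟩ :=
        ih (hr.of_suffix (List.suffix_cons a (b :: t))) hnone
      have hnot : ∀ t' : Req, ¬ (a :: t' <:+ t') := fun t' h => by simpa using h.length_le
      obtain ⟨k1, k2, ⟨τ, k3, k3'⟩, k4, k5⟩ := h1.serve_of_free hr (fun π' hπ' => by
        rcases h6 _ hπ' with h7 | h7
        · exact hfree π' h7
        · exact absurd h7 (hnot _)) ⟨π, h4, by omega⟩ (st' := OptUse.serve (a :: b :: t) st) (by
          rw [OptUse.serve, if_neg hc])
      refine ⟨k1, fun e he => k2 (h2 he), ⟨τ, k3, fun h => k3' (h2 h)⟩, k4, fun e he => ?_⟩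
      rcases k5 e he with h7 | h7
      · rcases h6 e h7 with h8 | h8
        · exact Or.inl h8
        · exact Or.inr (h8.trans (List.suffix_cons a _))
      · exact Or.inr h7

theorem tsum_geometric_tail (l : ℕ) :
    ∑' k : ℕ, (if l ≤ k then ((2 : ℝ≥0∞) ^ k)⁻¹ else 0) = 2 * ((2 : ℝ≥0∞) ^ l)⁻¹ := by
  have h : Function.support (fun k : ℕ => if l ≤ k then ((2 : ℝ≥0∞) ^ k)⁻¹ else 0) ⊆
      Set.range (fun j => l + j) := by
    intro k hk
    simp only [Function.mem_support, ne_eq, ite_eq_right_iff, not_forall] at hk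
    exact ⟨k - l, Nat.add_sub_cancel' hk.1⟩
  rw [← (add_right_injective l).tsum_eq h]
  simp only [Nat.le_add_right, if_true, pow_add]
  have hmul : ∀ j : ℕ, ((2 : ℝ≥0∞) ^ l * 2 ^ j)⁻¹ = (2 ^ l)⁻¹ * 2⁻¹ ^ j := fun j => by
    rw [ENNReal.mul_inv (Or.inl (by simp)) (Or.inl (by finiteness)), ENNReal.inv_pow (n := j)]
  simp_rw [hmul]
  rw [ENNReal.tsum_mul_left, ENNReal.tsum_geometric, ENNReal.one_sub_inv_two, inv_inv, mul_comm]

/-- The root stays supplied as long as the streams to be covered outweigh the requests. -/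
theorem rootFree_of_weight {E : Set (ℕ → Bool)} {R : Set Req} (hE : 2⁻¹ ≤ coin E)
    (hR : ∑' r : Req, R.indicator (fun r => ((2 : ℝ≥0∞) ^ lev r)⁻¹) r ≤ 8⁻¹)
    (hlev : ∀ a, [a] ∈ R → 3 ≤ a.2) : RootFree E R := by
  intro st h a ha
  by_contra! hcon
  have h1 : coin E ≤ ∑ e ∈ st.2.toFinset, ((2 : ℝ≥0∞) ^ e.2.length)⁻¹ := by
    calc coin E ≤ coin (⋃ e ∈ st.2.toFinset, cyl e.2) := by
          refine MeasureTheory.measure_mono fun y hy => ?_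
          obtain ⟨e, he, hye⟩ := h.cover y hy
          simp only [List.mem_toFinset, Set.mem_iUnion, exists_prop]
          exact ⟨e, he, hye⟩
      _ ≤ ∑ e ∈ st.2.toFinset, coin (cyl e.2) := MeasureTheory.measure_biUnion_finset_le _ _
      _ = _ := by simp_rw [coin_cyl]
  set f : Req × ℕ → ℝ≥0∞ := fun p =>
    R.indicator (fun r => if lev r ≤ p.2 then ((2 : ℝ≥0∞) ^ p.2)⁻¹ else 0) p.1 +
      if p.1 = [] ∧ 4 ≤ p.2 then ((2 : ℝ≥0∞) ^ p.2)⁻¹ else 0 with hf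
  have h2 : ∑ e ∈ st.2.toFinset, ((2 : ℝ≥0∞) ^ e.2.length)⁻¹ ≤ ∑' p, f p := by
    have hinj : Set.InjOn (fun e : Req × BStr => (e.1, e.2.length)) st.2.toFinset := by
      intro e he e' he' hee
      simp only [List.coe_toFinset, Set.mem_ofPred_eq] at he he'
      obtain ⟨r, π⟩ := e
      obtain ⟨r', π'⟩ := e'
      obtain ⟨rfl, hl⟩ := Prod.mk.inj hee
      rw [h.free_length_inj _ _ _ he he' hl]
    calc ∑ e ∈ st.2.toFinset, ((2 : ℝ≥0∞) ^ e.2.length)⁻¹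
        ≤ ∑ e ∈ st.2.toFinset, f (e.1, e.2.length) := by
          refine Finset.sum_le_sum fun e he => ?_
          rw [List.mem_toFinset] at he
          obtain ⟨r, π⟩ := e
          rcases h.free_good he with rfl | hr
          · have h3 := hcon π he
            have h4 := hlev a ha
            have h5 : 4 ≤ π.length := by omega
            simp [hf, h5]
          · have h3 := h.lev_le_of_free he
            simp [hf, hr, h3]
      _ = ∑ p ∈ st.2.toFinset.image (fun e : Req × BStr => (e.1, e.2.length)), f p :=
          (Finset.sum_image hinj).symm
      _ ≤ _ := ENNReal.sum_le_tsum _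
  have h3 : ∑' p, f p ≤ 3 * 8⁻¹ := by
    have h5 : ∑' p : Req × ℕ,
        R.indicator (fun r => if lev r ≤ p.2 then ((2 : ℝ≥0∞) ^ p.2)⁻¹ else 0) p.1 ≤ 2 * 8⁻¹ := by
      rw [ENNReal.tsum_prod']
      calc _ = ∑' r : Req, 2 * R.indicator (fun r => ((2 : ℝ≥0∞) ^ lev r)⁻¹) r := by
            refine tsum_congr fun r => ?_
            by_cases hr : r ∈ R
            · simp only [Set.indicator_of_mem hr]
              exact tsum_geometric_tail _
            · simp [Set.indicator_of_notMem hr]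
        _ ≤ _ := by
            rw [ENNReal.tsum_mul_left]
            gcongr
    have h6 : ∑' p : Req × ℕ, (if p.1 = [] ∧ 4 ≤ p.2 then ((2 : ℝ≥0∞) ^ p.2)⁻¹ else 0) ≤ 8⁻¹ := by
      rw [ENNReal.tsum_prod', tsum_eq_single []]
      · simp only [true_and]
        rw [tsum_geometric_tail]
        refine le_of_eq ?_
        rw [← ENNReal.toReal_eq_toReal_iff' (by finiteness) (by finiteness)]
        norm_num
      · intro r hr
        simp [hr]
    rw [ENNReal.tsum_add]
    calc _ ≤ 2 * 8⁻¹ + 8⁻¹ := add_le_add h5 h6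
      _ = _ := by ring
  have h4 : (2⁻¹ : ℝ≥0∞) ≤ 3 * 8⁻¹ := hE.trans (h1.trans (h2.trans h3))
  rw [← ENNReal.toReal_le_toReal (by finiteness) (by finiteness)] at h4
  norm_num at h4

/-- Serve a request unless it already has a code that is not dead. -/
def demand (dead : BStr → Bool) (r : Req) (st : AllocState) : AllocState :=
  if ∃ e ∈ st.1, e.1 = r ∧ dead e.2 = false then st
  else serve r (st.1, st.2.filter (fun e => e.1 ≠ r))

/-- The allocation process for a sequence of requests. -/
def alloc (req : ℕ → Option Req) (dead : ℕ → BStr → Bool) : ℕ → AllocState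
  | 0 => ([], [([], [])])
  | s + 1 => (req s).elim (alloc req dead s) fun r => demand (dead s) r (alloc req dead s)

theorem AllocInv.demand {E : Set (ℕ → Bool)} {R : Set Req} (hroot : RootFree E R)
    {st : AllocState} (h : AllocInv E R st) {r : Req} (hr : GoodReq R r) (h0 : r ≠ [])
    {dead : BStr → Bool} (hdead : ∀ τ, dead τ = true → Disjoint E (cyl τ)) :
    AllocInv E R (demand dead r st) ∧ st.1 ⊆ (OptUse.demand dead r st).1 ∧
    ∃ τ, (r, τ) ∈ (OptUse.demand dead r st).1 ∧ ((r, τ) ∈ st.1 → dead τ = false) := by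
  by_cases hc : ∃ e ∈ st.1, e.1 = r ∧ dead e.2 = false
  · rw [OptUse.demand, if_pos hc]
    obtain ⟨⟨_, τ⟩, h1, rfl, h2⟩ := hc
    exact ⟨h, fun _ => id, τ, h1, fun _ => h2⟩
  · rw [OptUse.demand, if_neg hc]
    obtain ⟨a, t, rfl⟩ := List.exists_cons_of_ne_nil h0
    have h' := h.discard h0 fun τ hτ => hdead τ (by
      by_contra hτ'
      exact hc ⟨_, hτ, rfl, by simpa using hτ'⟩)
    obtain ⟨h1, h2, ⟨τ, h3, h4⟩, _⟩ := h'.serve hroot hr (fun π hπ => by simp at hπ)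
    exact ⟨h1, h2, τ, h3, fun h => absurd h h4⟩

section
variable {E : Set (ℕ → Bool)} {R : Set Req} {req : ℕ → Option Req} {dead : ℕ → BStr → Bool}

theorem allocInv_alloc (hroot : RootFree E R)
    (hreq : ∀ s r, req s = some r → GoodReq R r ∧ r ≠ [])
    (hdead : ∀ s τ, dead s τ = true → Disjoint E (cyl τ)) (s : ℕ) :
    AllocInv E R (alloc req dead s) := by
  induction s with
  | zero => exact allocInv_init E R
  | succ s ih =>
    rw [alloc]
    cases h : req s with
    | none => exact ih
    | some r => exact (ih.demand hroot (hreq s r h).1 (hreq s r h).2 (hdead s)).1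

theorem alloc_subset_succ (hroot : RootFree E R)
    (hreq : ∀ s r, req s = some r → GoodReq R r ∧ r ≠ [])
    (hdead : ∀ s τ, dead s τ = true → Disjoint E (cyl τ)) (s : ℕ) :
    (alloc req dead s).1 ⊆ (alloc req dead (s + 1)).1 := by
  have ih := allocInv_alloc hroot hreq hdead s
  rw [alloc]
  cases h : req s with
  | none => exact fun _ => id
  | some r => exact (ih.demand hroot (hreq s r h).1 (hreq s r h).2 (hdead s)).2.1

theorem alloc_subset (hroot : RootFree E R)
    (hreq : ∀ s r, req s = some r → GoodReq R r ∧ r ≠ [])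
    (hdead : ∀ s τ, dead s τ = true → Disjoint E (cyl τ)) {s s' : ℕ} (h : s ≤ s') :
    (alloc req dead s).1 ⊆ (alloc req dead s').1 := by
  induction s', h using Nat.le_induction with
  | base => exact fun _ => id
  | succ s' _ ih => exact fun _ he => alloc_subset_succ hroot hreq hdead s' (ih he)

theorem exists_immortal_code (hroot : RootFree E R)
    (hreq : ∀ s r, req s = some r → GoodReq R r ∧ r ≠ [])
    (hdead : ∀ s τ, dead s τ = true → Disjoint E (cyl τ))
    (hmono : ∀ s s' τ, s ≤ s' → dead s τ = true → dead s' τ = true) {r : Req}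
    (hinf : ∀ S, ∃ s ≥ S, req s = some r) :
    ∃ τ, (∃ s, (r, τ) ∈ (alloc req dead s).1) ∧ ∀ s, dead s τ = false := by
  by_contra! hcon
  set C : Set BStr := {τ | ∃ s, (r, τ) ∈ (alloc req dead s).1} with hC
  have hfin : C.Finite := by
    refine (List.finite_length_eq Bool (lev r)).subset ?_
    rintro τ ⟨s, hs⟩
    exact (allocInv_alloc hroot hreq hdead s).code_length r τ hs
  have hb : ∀ τ ∈ C, ∃ S, ∀ s ≥ S, (r, τ) ∈ (alloc req dead s).1 ∧ dead s τ = true := by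
    rintro τ ⟨s, hs⟩
    obtain ⟨s', hs'⟩ := hcon τ ⟨s, hs⟩
    refine ⟨max s s', fun u hu => ⟨alloc_subset hroot hreq hdead (by omega) hs,
      hmono s' u τ (by omega) (by simpa using hs')⟩⟩
  choose! S hS using hb
  obtain ⟨B, hB⟩ := (hfin.image S).bddAbove
  obtain ⟨s, hs, hrs⟩ := hinf B
  obtain ⟨_, _, τ, h1, h2⟩ := (allocInv_alloc hroot hreq hdead s).demand hroot
    (hreq s r hrs).1 (hreq s r hrs).2 (hdead s)
  have hτ : τ ∈ C := ⟨s + 1, by rw [alloc, hrs]; exact h1⟩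
  have h3 := hS τ hτ s ((hB ⟨τ, hτ, rfl⟩).trans hs)
  rw [h2 h3.1] at h3
  exact absurd h3.2 (by simp)

end

/-- Along a stream passing through a code of `r`, all entries of `r` have their own codes. -/
theorem AllocInv.exists_code_of_mem {E : Set (ℕ → Bool)} {R : Set Req} {st : AllocState}
    (h : AllocInv E R st) {r : Req} {τ : BStr} (hτ : (r, τ) ∈ st.1) {b : BStr × ℕ}
    (hb : b ∈ r) : ∃ t τ', (b :: t, τ') ∈ st.1 ∧ τ' <+: τ := by
  induction r generalizing τ with
  | nil => simp at hb
  | cons a t ih =>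
    rcases List.mem_cons.1 hb with rfl | hb
    · exact ⟨t, τ, hτ, List.prefix_rfl⟩
    · obtain ⟨τ', h1, h2⟩ := h.code_tail a t τ hτ (List.ne_nil_of_mem hb)
      obtain ⟨t', τ'', h3, h4⟩ := ih h1 hb
      exact ⟨t', τ'', h3, h4.trans h2⟩

/-- Labels of codes along one stream are comparable. -/
theorem AllocInv.label_comparable {E : Set (ℕ → Bool)} {R : Set Req} {st : AllocState}
    (h : AllocInv E R st) {y : ℕ → Bool} {b b' : BStr × ℕ} {t t' : Req} {τ τ' : BStr}
    (hτ : (b :: t, τ) ∈ st.1) (hτ' : (b' :: t', τ') ∈ st.1) (hy : y ∈ cyl τ) (hy' : y ∈ cyl τ') :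
    b.1 <+: b'.1 ∨ b'.1 <+: b.1 := by
  have key : ∀ {c c' : BStr × ℕ} {u u' : Req} {σ'}, (c' :: u', σ') ∈ st.1 →
      c :: u <:+ c' :: u' → c.1 <+: c'.1 := by
    intro c c' u u' σ' hσ' hs
    rcases List.suffix_cons_iff.1 hs with hs' | hs'
    · rw [(List.cons.inj hs').1]
    · exact (h.code_good _ _ hσ').label c' u' List.suffix_rfl c
        (hs'.subset List.mem_cons_self)
  have : b :: t <:+ b' :: t' ∨ b' :: t' <:+ b :: t := by
    rcases prefix_or_prefix_of_mem_cyl hy hy' with hp | hp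
    · exact h.code_code _ hτ _ hτ' hp
    · exact (h.code_code _ hτ' _ hτ hp).symm
  rcases this with hs | hs
  · exact Or.inl (key hτ' hs)
  · exact Or.inr (key hτ hs)

/-- A staged enumeration of the graph of a prefix-free machine. -/
structure GraphEnum (V : ℕ → ℕ → Option (BStr × BStr)) : Prop where
  mono : ∀ s s' n e, s ≤ s' → V s n = some e → V s' n = some e
  bound : ∀ s n e, V s n = some e → n < s ∧ e.1.length + 2 * e.2.length ≤ s
  prefixFree : ∀ s s' i j e e', V s i = some e → V s' j = some e' → e.1 <+: e'.1 → i = j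

variable {V : ℕ → ℕ → Option (BStr × BStr)}

/-- The weight put on `ρ` by stage `s`, in units of `2 ^ (-s)`. -/
def massNat (V : ℕ → ℕ → Option (BStr × BStr)) (s : ℕ) (ρ : BStr) : ℕ :=
  ∑ n ∈ Finset.range s, (V s n).elim 0 fun e =>
    if ρ <+: e.2 then 2 ^ (s - (e.1.length + kexp ρ.length e.2.length)) else 0

/-- The least `l` such that `ρ` has weight at least `2 ^ (-l)` by stage `s`. -/
def level (V : ℕ → ℕ → Option (BStr × BStr)) (s : ℕ) (ρ : BStr) : ℕ :=
  s - Nat.findGreatest (fun k => 2 ^ k ≤ massNat V s ρ) s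

/-- The weight of `ρ` at stage `s`. -/
noncomputable def mass (V : ℕ → ℕ → Option (BStr × BStr)) (s : ℕ) (ρ : BStr) : ℝ≥0∞ :=
  ∑' n, (V s n).elim 0 fun e =>
    if ρ <+: e.2 then ((2 : ℝ≥0∞) ^ e.1.length)⁻¹ * (2 ^ kexp ρ.length e.2.length)⁻¹ else 0

theorem two_pow_inv_mul (a b : ℕ) :
    ((2 : ℝ≥0∞) ^ a)⁻¹ * (2 ^ b)⁻¹ = (2 ^ (a + b))⁻¹ := by
  rw [pow_add, ENNReal.mul_inv (Or.inl (by simp)) (Or.inl (by finiteness))]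

theorem two_pow_inv_anti {a b : ℕ} : ((2 : ℝ≥0∞) ^ a)⁻¹ ≤ (2 ^ b)⁻¹ ↔ b ≤ a := by
  rw [ENNReal.inv_le_inv]
  have h : ∀ k : ℕ, (2 : ℝ≥0∞) ^ k = ((2 ^ k : ℕ) : ℝ≥0∞) := fun k => by push_cast; rfl
  rw [h, h, Nat.cast_le]
  exact Nat.pow_le_pow_iff_right (by norm_num)

theorem two_mul_two_pow_succ_inv (a : ℕ) : 2 * ((2 : ℝ≥0∞) ^ (a + 1))⁻¹ = (2 ^ a)⁻¹ := by
  rw [← two_pow_inv_mul, mul_left_comm, pow_one,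
    ENNReal.mul_inv_cancel (by norm_num) (by norm_num), mul_one]

theorem two_pow_sub_mul {a s : ℕ} (h : a ≤ s) :
    ((2 : ℝ≥0∞) ^ (s - a)) * (2 ^ s)⁻¹ = (2 ^ a)⁻¹ := by
  obtain ⟨b, rfl⟩ := Nat.exists_eq_add_of_le h
  rw [Nat.add_sub_cancel_left, add_comm a b, ← two_pow_inv_mul, ← mul_assoc,
    ENNReal.mul_inv_cancel (by simp) (by finiteness), one_mul]

theorem GraphEnum.mass_eq (hV : GraphEnum V) (s : ℕ) (ρ : BStr) :
    mass V s ρ = massNat V s ρ * ((2 : ℝ≥0∞) ^ s)⁻¹ := by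
  rw [mass, massNat, tsum_eq_sum (s := Finset.range s)]
  · push_cast
    rw [Finset.sum_mul]
    refine Finset.sum_congr rfl fun n _ => ?_
    cases h : V s n with
    | none => simp
    | some e =>
      simp only [Option.elim]
      split_ifs with hρ
      · have h1 := (hV.bound s n e h).2
        have h2 := kexp_le_two_mul hρ.length_le
        rw [two_pow_inv_mul, ← two_pow_sub_mul (s := s) (by omega)]
        push_cast
        rfl
      · simp
  · intro n hn
    cases h : V s n with
    | none => rfl
    | some e => exact absurd (Finset.mem_range.2 (hV.bound s n e h).1) hn

theorem GraphEnum.kraft (hV : GraphEnum V) (s : ℕ) :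
    ∑' n, ((V s n).elim 0 fun e => ((2 : ℝ≥0∞) ^ e.1.length)⁻¹) ≤ 1 := by
  refine le_trans (le_of_eq ?_) (kraft_sum_le_one (fun n => (V s n).map Prod.fst) ?_)
  · refine tsum_congr fun n => ?_
    cases V s n <;> rfl
  · intro i j σ τ hi hj
    rw [Option.map_eq_some_iff] at hi hj
    obtain ⟨e, hi, rfl⟩ := hi
    obtain ⟨e', hj, rfl⟩ := hj
    exact hV.prefixFree s s i j e e' hi hj

theorem GraphEnum.mass_le_one (hV : GraphEnum V) (s : ℕ) (ρ : BStr) : mass V s ρ ≤ 1 := by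
  refine le_trans (ENNReal.tsum_le_tsum fun n => ?_) (hV.kraft s)
  cases V s n with
  | none => exact le_rfl
  | some e =>
    simp only [Option.elim]
    split_ifs
    · rw [two_pow_inv_mul, two_pow_inv_anti]; omega
    · exact zero_le

theorem GraphEnum.mass_mono (hV : GraphEnum V) {s s' : ℕ} (h : s ≤ s') (ρ : BStr) :
    mass V s ρ ≤ mass V s' ρ := by
  refine ENNReal.tsum_le_tsum fun n => ?_
  cases hs : V s n with
  | none => exact zero_le
  | some e => rw [hV.mono s s' n e h hs]

theorem GraphEnum.mass_pos_iff (hV : GraphEnum V) {s : ℕ} {ρ : BStr} :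
    mass V s ρ ≠ 0 ↔ 0 < massNat V s ρ := by
  rw [hV.mass_eq, Nat.pos_iff_ne_zero, ne_eq, mul_eq_zero]
  simp

theorem GraphEnum.massNat_pos_of_prefix (hV : GraphEnum V) {s : ℕ} {ρ ρ' : BStr}
    (h : ρ <+: ρ') (hρ' : 0 < massNat V s ρ') : 0 < massNat V s ρ := by
  rw [← hV.mass_pos_iff] at *
  contrapose! hρ'
  rw [mass, ENNReal.tsum_eq_zero] at *
  intro n
  have h1 := hρ' n
  cases hs : V s n with
  | none => rfl
  | some e =>
    simp only [hs, Option.elim, ite_eq_right_iff, mul_eq_zero] at h1 ⊢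
    intro h2
    have := h1 (h.trans h2)
    simp at this

theorem GraphEnum.massNat_pos_mono (hV : GraphEnum V) {s s' : ℕ} (h : s ≤ s') {ρ : BStr}
    (hρ : 0 < massNat V s ρ) : 0 < massNat V s' ρ := by
  rw [← hV.mass_pos_iff] at *
  intro h0
  exact hρ (le_antisymm ((hV.mass_mono h ρ).trans h0.le) zero_le)

theorem GraphEnum.massNat_le (hV : GraphEnum V) (s : ℕ) (ρ : BStr) : massNat V s ρ ≤ 2 ^ s := by
  have h := hV.mass_le_one s ρ
  rw [hV.mass_eq, ← div_eq_mul_inv] at h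
  have h' := (ENNReal.div_le_iff (by simp) (by finiteness)).1 h
  rw [one_mul] at h'
  exact_mod_cast h'

theorem GraphEnum.level_le_mass (hV : GraphEnum V) {s : ℕ} {ρ : BStr} (h : 0 < massNat V s ρ) :
    ((2 : ℝ≥0∞) ^ level V s ρ)⁻¹ ≤ mass V s ρ := by
  have h1 : 2 ^ Nat.findGreatest (fun k => 2 ^ k ≤ massNat V s ρ) s ≤ massNat V s ρ :=
    Nat.findGreatest_spec (P := fun k => 2 ^ k ≤ massNat V s ρ) (Nat.zero_le s)
      (by rw [pow_zero]; exact h)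
  have h2 := Nat.findGreatest_le (P := fun k => 2 ^ k ≤ massNat V s ρ) s
  rw [hV.mass_eq, level, ← two_pow_sub_mul (Nat.sub_le s _), Nat.sub_sub_self h2]
  gcongr
  exact_mod_cast h1

theorem GraphEnum.mass_lt_level (hV : GraphEnum V) (s : ℕ) (ρ : BStr) :
    mass V s ρ < 2 * ((2 : ℝ≥0∞) ^ level V s ρ)⁻¹ := by
  set k := Nat.findGreatest (fun k => 2 ^ k ≤ massNat V s ρ) s with hk
  have h1 : massNat V s ρ < 2 ^ (k + 1) := by
    by_contra! hcon
    rcases Nat.lt_or_ge k s with hks | hks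
    · have := Nat.le_findGreatest (P := fun k => 2 ^ k ≤ massNat V s ρ) hks hcon
      omega
    · have h2 := hcon.trans (hV.massNat_le s ρ)
      have := (Nat.pow_le_pow_iff_right (by norm_num : 1 < 2)).1 h2
      omega
  have h2 : k ≤ s := Nat.findGreatest_le s
  have h3 : 2 * ((2 : ℝ≥0∞) ^ level V s ρ)⁻¹ = 2 ^ (k + 1) * (2 ^ s)⁻¹ := by
    rw [level, ← hk, ← two_pow_sub_mul (Nat.sub_le s k), Nat.sub_sub_self h2, pow_succ,
      mul_comm _ (2 : ℝ≥0∞), mul_assoc]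
  rw [h3, hV.mass_eq]
  refine (ENNReal.mul_lt_mul_iff_left (by simp) (by simp)).2 ?_
  exact_mod_cast h1

theorem GraphEnum.level_le_of_le_mass (hV : GraphEnum V) {s l : ℕ} {ρ : BStr}
    (h : ((2 : ℝ≥0∞) ^ l)⁻¹ ≤ mass V s ρ) : level V s ρ ≤ l := by
  have h1 := h.trans_lt (hV.mass_lt_level s ρ)
  rw [← two_mul_two_pow_succ_inv l] at h1
  have h2 := lt_of_mul_lt_mul_left' h1
  rw [← not_le, two_pow_inv_anti] at h2
  omega

theorem GraphEnum.level_anti (hV : GraphEnum V) {s s' : ℕ} (h : s ≤ s') {ρ : BStr}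
    (hρ : 0 < massNat V s ρ) : level V s' ρ ≤ level V s ρ :=
  hV.level_le_of_le_mass ((hV.level_le_mass hρ).trans (hV.mass_mono h ρ))

theorem le_mass_of_mem {s n : ℕ} {p σ : BStr} (h : V s n = some (p, σ)) :
    ((2 : ℝ≥0∞) ^ (p.length + kexp σ.length σ.length))⁻¹ ≤ mass V s σ := by
  refine le_trans (le_of_eq ?_) (ENNReal.le_tsum n)
  simp [h, two_pow_inv_mul]

theorem tsum_prefix (σ : BStr) (f : BStr → ℝ≥0∞) :
    ∑' ρ, (if ρ <+: σ then f ρ else 0) = ∑ j ∈ Finset.range (σ.length + 1), f (σ.take j) := by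
  have hinj : Set.InjOn (fun j => σ.take j) (Finset.range (σ.length + 1)) := by
    intro i hi j hj hij
    have := congrArg List.length hij
    simp only [List.length_take, Finset.coe_range, Set.mem_Iio] at this hi hj
    omega
  rw [tsum_eq_sum (s := (Finset.range (σ.length + 1)).image fun j => σ.take j),
    Finset.sum_image hinj]
  · exact Finset.sum_congr rfl fun j _ => by simp [List.take_prefix]
  · intro ρ hρ
    rw [if_neg]
    intro h
    refine hρ (Finset.mem_image.2 ⟨ρ.length, ?_, (List.prefix_iff_eq_take.1 h).symm⟩)
    have := h.length_le
    simp; omega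

/-- The length of codes for `ρ` requested at stage `s`. -/
def codeLevel (V : ℕ → ℕ → Option (BStr × BStr)) (s : ℕ) (ρ : BStr) : ℕ := level V s ρ + 11

/-- The requests arising by stage `S`. -/
def requestsUpTo (V : ℕ → ℕ → Option (BStr × BStr)) (S : ℕ) : Set Req :=
  {r | ∃ s ≤ S, ∃ ρ, ρ ≠ [] ∧ 0 < massNat V s ρ ∧ r = chain (codeLevel V s) ρ}

/-- The requests arising at any stage. -/
def requests (V : ℕ → ℕ → Option (BStr × BStr)) : Set Req :=
  {r | ∃ s ρ, ρ ≠ [] ∧ 0 < massNat V s ρ ∧ r = chain (codeLevel V s) ρ}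

/-- The weight of `ρ` at stage `s`, rounded down to a power of two. -/
noncomputable def roundMass (V : ℕ → ℕ → Option (BStr × BStr)) (s : ℕ) (ρ : BStr) : ℝ≥0∞ :=
  if 0 < massNat V s ρ then ((2 : ℝ≥0∞) ^ level V s ρ)⁻¹ else 0

theorem GraphEnum.roundMass_le (hV : GraphEnum V) (s : ℕ) (ρ : BStr) :
    roundMass V s ρ ≤ mass V s ρ := by
  rw [roundMass]
  split_ifs with h
  · exact hV.level_le_mass h
  · exact zero_le

theorem GraphEnum.mass_le_roundMass (hV : GraphEnum V) (s : ℕ) (ρ : BStr) :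
    mass V s ρ ≤ 2 * roundMass V s ρ := by
  rw [roundMass]
  split_ifs with h
  · exact (hV.mass_lt_level s ρ).le
  · rw [← hV.mass_pos_iff, not_not] at h
    simp [h]

theorem two_pow_inv_inj {a b : ℕ} (h : ((2 : ℝ≥0∞) ^ a)⁻¹ = (2 ^ b)⁻¹) : a = b :=
  le_antisymm (two_pow_inv_anti.1 h.ge) (two_pow_inv_anti.1 h.le)

theorem GraphEnum.two_mul_roundMass_le (hV : GraphEnum V) {s : ℕ} {ρ : BStr}
    (h : roundMass V s ρ ≠ roundMass V (s + 1) ρ) :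
    2 * roundMass V s ρ ≤ roundMass V (s + 1) ρ := by
  by_cases hs : 0 < massNat V s ρ
  · have hs' := hV.massNat_pos_mono (Nat.le_succ s) hs
    have hl := hV.level_anti (Nat.le_succ s) hs
    rw [roundMass, roundMass, if_pos hs, if_pos hs'] at *
    have hne : level V s ρ ≠ level V (s + 1) ρ := fun he => h (by rw [he])
    obtain ⟨k, hk⟩ : ∃ k, level V s ρ = k + 1 :=
      Nat.exists_eq_succ_of_ne_zero (by simp only [Nat.succ_eq_add_one] at hl; omega)
    rw [hk, two_mul_two_pow_succ_inv, two_pow_inv_anti]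
    simp only [Nat.succ_eq_add_one] at hl
    omega
  · rw [roundMass, if_neg hs, mul_zero]
    exact zero_le

theorem GraphEnum.roundMass_mono (hV : GraphEnum V) (s : ℕ) (ρ : BStr) :
    roundMass V s ρ ≤ roundMass V (s + 1) ρ := by
  by_cases h : roundMass V s ρ = roundMass V (s + 1) ρ
  · exact h.le
  · refine le_trans ?_ (hV.two_mul_roundMass_le h)
    rw [two_mul]
    exact le_self_add

/-- The weight of the extensions of `ρ` is comparable to the weight of `ρ`. -/
theorem tsum_mass_extensions_le (s : ℕ) {ρ : BStr} (hρ : ρ ≠ []) :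
    ∑' ρ', (if ρ <+: ρ' then mass V s ρ' else 0) ≤ 10 * ρ.length * mass V s ρ := by
  have h1 : ∀ ρ', (if ρ <+: ρ' then mass V s ρ' else 0) = ∑' n, (V s n).elim 0 fun e =>
      if ρ' <+: e.2 then (if ρ <+: ρ' then ((2 : ℝ≥0∞) ^ e.1.length)⁻¹ *
        (2 ^ kexp ρ'.length e.2.length)⁻¹ else 0) else 0 := by
    intro ρ'
    split_ifs with h
    · rfl
    · rw [eq_comm, ENNReal.tsum_eq_zero]
      intro n
      cases V s n <;> simp
  simp_rw [h1]
  rw [ENNReal.tsum_comm, mass, ← ENNReal.tsum_mul_left]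
  refine ENNReal.tsum_le_tsum fun n => ?_
  cases V s n with
  | none => simp
  | some e =>
    simp only [Option.elim]
    rw [tsum_prefix]
    split_ifs with h
    · have hlen : 1 ≤ ρ.length := List.length_pos_iff.2 hρ
      calc _ ≤ ∑ j ∈ Finset.range (e.2.length + 1), if j ∈ Finset.Icc ρ.length e.2.length then
              ((2 : ℝ≥0∞) ^ e.1.length)⁻¹ * (2 ^ kexp j e.2.length)⁻¹ else 0 := by
            refine Finset.sum_le_sum fun j hj => ?_
            rw [Finset.mem_range] at hj
            have hl : (e.2.take j).length = j := by rw [List.length_take]; omega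
            rw [hl]
            split_ifs with h1 h2
            · exact le_rfl
            · exact absurd (Finset.mem_Icc.2 ⟨by rw [← hl]; exact h1.length_le, by omega⟩) h2
            · exact zero_le
            · exact le_rfl
        _ = ((2 : ℝ≥0∞) ^ e.1.length)⁻¹ *
              ∑ j ∈ Finset.Icc ρ.length e.2.length, (2 ^ kexp j e.2.length)⁻¹ := by
            rw [← Finset.sum_filter, Finset.mul_sum]
            refine Finset.sum_congr ?_ fun _ _ => rfl
            ext j
            simp only [Finset.mem_filter, Finset.mem_range, Finset.mem_Icc]
            omega
        _ ≤ ((2 : ℝ≥0∞) ^ e.1.length)⁻¹ * (10 * ρ.length * (2 ^ kexp ρ.length e.2.length)⁻¹) := by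
            gcongr
            exact sum_kexp_weight_Icc_le_ennreal hlen h.length_le
        _ = _ := by ring
    · rw [mul_zero]
      refine (Finset.sum_eq_zero fun j _ => ?_).le
      rw [if_neg fun h' => h (h'.trans (List.take_prefix _ _))]

theorem GraphEnum.tsum_length_mul_mass_le (hV : GraphEnum V) (s : ℕ) :
    ∑' ρ : BStr, ρ.length * mass V s ρ ≤ 6 := by
  have h1 : ∀ ρ : BStr, ρ.length * mass V s ρ = ∑' n, (V s n).elim 0 fun e =>
      if ρ <+: e.2 then ρ.length * (((2 : ℝ≥0∞) ^ e.1.length)⁻¹ *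
        (2 ^ kexp ρ.length e.2.length)⁻¹) else 0 := by
    intro ρ
    rw [mass, ← ENNReal.tsum_mul_left]
    refine tsum_congr fun n => ?_
    cases V s n <;> simp
  simp_rw [h1]
  rw [ENNReal.tsum_comm]
  calc _ ≤ ∑' n, 6 * ((V s n).elim 0 fun e => ((2 : ℝ≥0∞) ^ e.1.length)⁻¹) := by
        refine ENNReal.tsum_le_tsum fun n => ?_
        cases V s n with
        | none => simp
        | some e =>
          simp only [Option.elim]
          rw [tsum_prefix]
          calc _ = ((2 : ℝ≥0∞) ^ e.1.length)⁻¹ * ∑ j ∈ Finset.range (e.2.length + 1),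
                (j : ℝ≥0∞) * ((2 : ℝ≥0∞) ^ kexp j e.2.length)⁻¹ := by
                rw [Finset.mul_sum]
                refine Finset.sum_congr rfl fun j hj => ?_
                rw [Finset.mem_range] at hj
                have hl : (e.2.take j).length = j := by rw [List.length_take]; omega
                rw [hl]
                ring
            _ = ((2 : ℝ≥0∞) ^ e.1.length)⁻¹ * ∑ j ∈ Finset.Icc 1 e.2.length,
                (j : ℝ≥0∞) * ((2 : ℝ≥0∞) ^ kexp j e.2.length)⁻¹ := by
                congr 1
                refine (Finset.sum_subset ?_ ?_).symm
                · intro j; simp only [Finset.mem_range, Finset.mem_Icc]; omega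
                · intro j hj hj'
                  simp only [Finset.mem_range, Finset.mem_Icc] at hj hj'
                  obtain rfl : j = 0 := by omega
                  simp
            _ ≤ ((2 : ℝ≥0∞) ^ e.1.length)⁻¹ * 6 := by
                gcongr
                exact sum_mul_kexp_weight_le_ennreal _
            _ = _ := mul_comm _ _
    _ ≤ 6 * 1 := by
        rw [ENNReal.tsum_mul_left]
        gcongr
        exact hV.kraft s
    _ = 6 := mul_one _

theorem chain_eq_of_roundMass_eq {s s' : ℕ} {ρ : BStr} (hρ : ρ ≠ [])
    (h : ∀ ρ', ρ' ≠ [] → ρ' <+: ρ → 0 < massNat V s' ρ' → roundMass V s ρ' = roundMass V s' ρ')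
    (hpos : ∀ ρ', ρ' <+: ρ → 0 < massNat V s' ρ') :
    0 < massNat V s ρ ∧ chain (codeLevel V s) ρ = chain (codeLevel V s') ρ := by
  have key : ∀ ρ', ρ' ≠ [] → ρ' <+: ρ → 0 < massNat V s ρ' ∧ level V s ρ' = level V s' ρ' := by
    intro ρ' h1 h2
    have h3 := hpos ρ' h2
    have h4 := h ρ' h1 h2 h3
    rw [roundMass, roundMass, if_pos h3] at h4
    split_ifs at h4 with h5
    · exact ⟨h5, two_pow_inv_inj h4⟩
    · exact absurd h4.symm (ENNReal.inv_ne_zero.2 (by finiteness))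
  exact ⟨(key ρ hρ List.prefix_rfl).1, chain_congr fun ρ' h1 h2 => by
    rw [codeLevel, codeLevel, (key ρ' h1 h2).2]⟩

theorem GraphEnum.requestsUpTo_succ (hV : GraphEnum V) (s : ℕ) {r : Req}
    (hr : r ∈ requestsUpTo V (s + 1)) : r ∈ requestsUpTo V s ∨
      ∃ ρ' ρ, ρ ≠ [] ∧ ρ <+: ρ' ∧ roundMass V s ρ ≠ roundMass V (s + 1) ρ ∧
        0 < massNat V (s + 1) ρ' ∧ r = chain (codeLevel V (s + 1)) ρ' := by
  obtain ⟨s', hs', ρ, h1, h2, rfl⟩ := hr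
  rcases Nat.lt_or_ge s s' with h | h
  · obtain rfl : s' = s + 1 := by omega
    by_cases hc : ∃ ρ', ρ' ≠ [] ∧ ρ' <+: ρ ∧ roundMass V s ρ' ≠ roundMass V (s + 1) ρ'
    · obtain ⟨ρ', k1, k2, k3⟩ := hc
      exact Or.inr ⟨ρ, ρ', k1, k2, k3, h2, rfl⟩
    · push Not at hc
      obtain ⟨k1, k2⟩ := chain_eq_of_roundMass_eq (V := V) (s := s) (s' := s + 1) h1
        (fun ρ' h3 h4 _ => hc ρ' h3 h4) fun ρ' h3 => hV.massNat_pos_of_prefix h3 h2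
      exact Or.inl ⟨s, le_rfl, ρ, h1, k1, k2.symm⟩
  · exact Or.inl ⟨s', h, ρ, h1, h2, rfl⟩

theorem lev_chain_codeLevel {s : ℕ} {ρ : BStr} (hρ : ρ ≠ []) :
    lev (chain (codeLevel V s) ρ) = level V s ρ + 11 := by
  obtain ⟨t, ht⟩ := chain_ne_nil (lv := codeLevel V s) hρ
  rw [ht]; rfl

theorem GraphEnum.weight_requestsUpTo_le (hV : GraphEnum V) (s : ℕ) :
    ∑' r : Req, (requestsUpTo V s).indicator (fun r => ((2 : ℝ≥0∞) ^ lev r)⁻¹) r ≤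
      (2 ^ 11)⁻¹ * ∑' ρ : BStr, 40 * ρ.length * roundMass V s ρ := by
  classical
  induction s with
  | zero =>
    have : requestsUpTo V 0 = ∅ := by
      rw [Set.eq_empty_iff_forall_notMem]
      rintro r ⟨s, hs, ρ, _, h, _⟩
      obtain rfl : s = 0 := by omega
      simp [massNat] at h
    simp [this]
  | succ s ih =>
    have hnew : ∑' r : Req, (requestsUpTo V (s + 1)).indicator (fun r => ((2 : ℝ≥0∞) ^ lev r)⁻¹) r ≤
        ∑' r : Req, (requestsUpTo V s).indicator (fun r => ((2 : ℝ≥0∞) ^ lev r)⁻¹) r +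
        ∑' r : Req, ∑' ρ : BStr, ∑' ρ' : BStr,
          if r = chain (codeLevel V (s + 1)) ρ' then
            (if ρ ≠ [] ∧ roundMass V s ρ ≠ roundMass V (s + 1) ρ then
              if ρ <+: ρ' then (2 ^ 11)⁻¹ * roundMass V (s + 1) ρ' else 0 else 0) else 0 := by
      rw [← ENNReal.tsum_add]
      refine ENNReal.tsum_le_tsum fun r => ?_
      by_cases hr : r ∈ requestsUpTo V (s + 1)
      · rcases hV.requestsUpTo_succ s hr with h | ⟨ρ', ρ, h1, h2, h3, h4, rfl⟩
        · rw [Set.indicator_of_mem hr, Set.indicator_of_mem h]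
          exact le_self_add
        · rw [Set.indicator_of_mem hr]
          refine le_trans ?_ le_add_self
          refine le_trans ?_ (ENNReal.le_tsum ρ)
          refine le_trans ?_ (ENNReal.le_tsum ρ')
          rw [if_pos rfl, if_pos ⟨h1, h3⟩, if_pos h2, roundMass, if_pos h4, two_pow_inv_mul,
            lev_chain_codeLevel, add_comm]
          rintro rfl
          exact h1 (List.prefix_nil.1 h2)
      · rw [Set.indicator_of_notMem hr]
        exact zero_le
    have hswap : ∑' r : Req, ∑' ρ : BStr, ∑' ρ' : BStr,
          (if r = chain (codeLevel V (s + 1)) ρ' then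
            (if ρ ≠ [] ∧ roundMass V s ρ ≠ roundMass V (s + 1) ρ then
              if ρ <+: ρ' then ((2 : ℝ≥0∞) ^ 11)⁻¹ * roundMass V (s + 1) ρ' else 0 else 0) else 0) ≤
        (2 ^ 11)⁻¹ * ∑' ρ : BStr, if ρ ≠ [] ∧ roundMass V s ρ ≠ roundMass V (s + 1) ρ then
          20 * ρ.length * roundMass V (s + 1) ρ else 0 := by
      rw [ENNReal.tsum_comm, ← ENNReal.tsum_mul_left]
      refine ENNReal.tsum_le_tsum fun ρ => ?_
      rw [ENNReal.tsum_comm]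
      simp_rw [tsum_ite_eq]
      split_ifs with h
      · calc _ ≤ ∑' ρ', (2 ^ 11)⁻¹ * (if ρ <+: ρ' then mass V (s + 1) ρ' else 0) := by
              refine ENNReal.tsum_le_tsum fun ρ' => ?_
              split_ifs
              · gcongr
                exact hV.roundMass_le _ _
              · simp
          _ ≤ (2 ^ 11)⁻¹ * (10 * ρ.length * (2 * roundMass V (s + 1) ρ)) := by
              rw [ENNReal.tsum_mul_left]
              gcongr
              refine (tsum_mass_extensions_le (s + 1) h.1).trans ?_
              gcongr
              exact hV.mass_le_roundMass _ _
          _ = _ := by ring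
      · simp
    refine hnew.trans ((add_le_add ih hswap).trans ?_)
    rw [← mul_add, ← ENNReal.tsum_add]
    gcongr with ρ
    split_ifs with h
    · have h1 := hV.two_mul_roundMass_le h.2
      calc 40 * ↑ρ.length * roundMass V s ρ + 20 * ↑ρ.length * roundMass V (s + 1) ρ
          = 20 * ρ.length * (2 * roundMass V s ρ) + 20 * ρ.length * roundMass V (s + 1) ρ := by ring
        _ ≤ 20 * ρ.length * roundMass V (s + 1) ρ + 20 * ρ.length * roundMass V (s + 1) ρ := by
          gcongr
        _ = _ := by ring
    · rw [add_zero]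
      gcongr
      exact hV.roundMass_mono s ρ

theorem GraphEnum.weight_requests_le (hV : GraphEnum V) :
    ∑' r : Req, (requests V).indicator (fun r => ((2 : ℝ≥0∞) ^ lev r)⁻¹) r ≤ 8⁻¹ := by
  have hS : ∀ s, ∑' r : Req, (requestsUpTo V s).indicator (fun r => ((2 : ℝ≥0∞) ^ lev r)⁻¹) r ≤
      8⁻¹ := by
    intro s
    calc _ ≤ (2 ^ 11)⁻¹ * ∑' ρ : BStr, 40 * (ρ.length * mass V s ρ) := by
          refine (hV.weight_requestsUpTo_le s).trans ?_
          simp_rw [mul_assoc]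
          refine mul_le_mul_right (ENNReal.tsum_le_tsum fun ρ => ?_) _
          refine mul_le_mul_right (mul_le_mul_right ?_ _) _
          exact hV.roundMass_le s ρ
      _ ≤ (2 ^ 11)⁻¹ * (40 * 6) := by
          rw [ENNReal.tsum_mul_left]
          gcongr
          exact hV.tsum_length_mul_mass_le s
      _ ≤ 8⁻¹ := by
          rw [← ENNReal.toReal_le_toReal (by finiteness) (by finiteness)]
          norm_num
  rw [ENNReal.tsum_eq_iSup_sum]
  refine iSup_le fun F => ?_
  have hex : ∀ r : Req, ∃ s, r ∈ requests V → r ∈ requestsUpTo V s := by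
    intro r
    by_cases hr : r ∈ requests V
    · obtain ⟨s, ρ, h⟩ := hr
      exact ⟨s, fun _ => ⟨s, le_rfl, ρ, h⟩⟩
    · exact ⟨0, fun h => absurd h hr⟩
  choose S h using hex
  refine le_trans (Finset.sum_le_sum fun r hr => ?_)
    ((ENNReal.sum_le_tsum F).trans (hS (F.sup S)))
  by_cases hr' : r ∈ requests V
  · obtain ⟨s, hs, h1⟩ := h r hr'
    have : r ∈ requestsUpTo V (F.sup S) := ⟨s, hs.trans (Finset.le_sup hr), h1⟩
    rw [Set.indicator_of_mem hr', Set.indicator_of_mem this]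
  · rw [Set.indicator_of_notMem hr']
    exact zero_le

section
variable {α β : Type} [Primcodable α] [Primcodable β]

theorem primrec_filter {f : α → List β} {p : α → β → Prop} [∀ a b, Decidable (p a b)]
    (hf : Primrec f) (hp : PrimrecRel p) :
    Primrec fun a => (f a).filter (fun b => p a b) := by
  refine (Primrec.listFilterMap hf
    (g := fun a b => if p a b then some b else none) ?_).of_eq fun a => ?_
  · exact Primrec.ite hp (Primrec.option_some.comp Primrec.snd) (Primrec.const none)
  · rw [← List.filterMap_eq_filter]
    congr 1
    funext b
    by_cases h : p a b <;> simp [Option.guard, h]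

theorem primrecPred_exists_mem {f : α → List β} {p : α → β → Prop}
    (hf : Primrec f) (hp : PrimrecRel p) : PrimrecPred fun a => ∃ b ∈ f a, p a b :=
  (PrimrecRel.exists_mem_list (R := fun b a => p a b) (hp.comp Primrec.snd Primrec.fst)).comp hf
    Primrec.id

theorem primrecPred_forall_mem {f : α → List β} {p : α → β → Prop}
    (hf : Primrec f) (hp : PrimrecRel p) : PrimrecPred fun a => ∀ b ∈ f a, p a b :=
  (PrimrecRel.forall_mem_list (R := fun b a => p a b) (hp.comp Primrec.snd Primrec.fst)).comp hf
    Primrec.id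

theorem primrecPred_prefix {f g : α → BStr} (hf : Primrec f) (hg : Primrec g) :
    PrimrecPred fun a => f a <+: g a :=
  (Primrec.eq.comp (Primrec.list_take.comp (Primrec.list_length.comp hf) hg) hf).of_eq fun a => by
    rw [List.prefix_iff_eq_take, eq_comm]

theorem primrec_pow {f g : α → ℕ} (hf : Primrec f) (hg : Primrec g) :
    Primrec fun a => f a ^ g a := by
  refine (Primrec.nat_rec' (f := g) (g := fun _ => 1) (h := fun a x => x.2 * f a) hg
    (Primrec.const 1) ?_).of_eq fun a => ?_
  · exact Primrec.nat_mul.comp (Primrec.snd.comp Primrec.snd) (hf.comp Primrec.fst)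
  · induction g a with
    | zero => simp
    | succ n ih => rw [pow_succ, ← ih]

theorem primrec_sum_range {f : α → ℕ} {g : α → ℕ → ℕ} (hf : Primrec f) (hg : Primrec₂ g) :
    Primrec fun a => ∑ n ∈ Finset.range (f a), g a n := by
  refine (Primrec.nat_rec' (f := f) (g := fun _ => 0) (h := fun a x => x.2 + g a x.1) hf
    (Primrec.const 0) ?_).of_eq fun a => ?_
  · exact Primrec.nat_add.comp (Primrec.snd.comp Primrec.snd)
      (hg.comp Primrec.fst (Primrec.fst.comp Primrec.snd))
  · induction f a with
    | zero => simp
    | succ n ih => rw [Finset.sum_range_succ, ← ih]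

theorem primrec_replicate {f : α → ℕ} (hf : Primrec f) (b : Bool) :
    Primrec fun a => List.replicate (f a) b :=
  (Primrec.list_map (Primrec.list_range.comp hf) (g := fun _ _ => b) (Primrec.const b)).of_eq
    fun a => by simp [List.map_const']

theorem primrec_option_isSome {f : α → Option β} (hf : Primrec f) :
    PrimrecPred fun a => (f a).isSome = true :=
  Primrec.eq.comp (Primrec.option_isSome.comp hf) (Primrec.const true)

theorem primrec_option_elim {γ : Type} [Primcodable γ] {f : α → Option β} {g : α → γ}
    {h : α → β → γ} (hf : Primrec f) (hg : Primrec g) (hh : Primrec₂ h) :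
    Primrec fun a => (f a).elim (g a) (h a) :=
  (Primrec.option_casesOn hf hg hh).of_eq fun a => by cases f a <;> rfl

theorem primrec_freeOfLength {f : α → List (Req × BStr)} {g : α → Req} {l : α → ℕ}
    (hf : Primrec f) (hg : Primrec g) (hl : Primrec l) :
    Primrec fun a => freeOfLength (f a) (g a) (l a) := by
  unfold freeOfLength
  refine Primrec.option_map (Primrec.list_head?.comp (primrec_filter hf ?_))
    (Primrec.snd.comp Primrec.snd)
  exact (Primrec.eq.comp (Primrec.fst.comp Primrec.snd) (hg.comp Primrec.fst)).and
    (Primrec.eq.comp (Primrec.list_length.comp (Primrec.snd.comp Primrec.snd))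
      (hl.comp Primrec.fst))

theorem primrec_longestFree {f : α → List (Req × BStr)} {g : α → Req} {l : α → ℕ}
    (hf : Primrec f) (hg : Primrec g) (hl : Primrec l) :
    Primrec fun a => longestFree (f a) (g a) (l a) := by
  refine (Primrec.nat_rec' (f := l) (g := fun a => freeOfLength (f a) (g a) 0)
    (h := fun a x => freeOfLength (f a) (g a) (x.1 + 1) <|> x.2) hl
    (primrec_freeOfLength hf hg (Primrec.const 0)) ?_).of_eq fun a => ?_
  · exact Primrec.option_orElse.comp
      (primrec_freeOfLength (hf.comp Primrec.fst) (hg.comp Primrec.fst)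
        (Primrec.succ.comp (Primrec.fst.comp Primrec.snd)))
      (Primrec.snd.comp Primrec.snd)
  · induction l a with
    | zero => rfl
    | succ n ih => rw [longestFree, ← ih]

theorem primrec_splitFree {f : α → AllocState} {b : α → BStr × ℕ} {t : α → Req} {π : α → BStr}
    (hf : Primrec f) (hb : Primrec b) (ht : Primrec t) (hπ : Primrec π) :
    Primrec fun a => splitFree (f a) (b a) (t a) (π a) := by
  have hd : Primrec fun a => (b a).2 - (π a).length :=
    Primrec.nat_sub.comp (Primrec.snd.comp hb) (Primrec.list_length.comp hπ)
  have hcode : Primrec fun a => (b a :: t a,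
      π a ++ List.replicate ((b a).2 - (π a).length) false) :=
    (Primrec.list_cons.comp hb ht).pair
      (Primrec.list_append.comp hπ (primrec_replicate hd false))
  unfold splitFree
  refine Primrec.pair (Primrec.list_cons.comp hcode (Primrec.fst.comp hf))
    (Primrec.list_cons.comp hcode (Primrec.list_append.comp ?_ ?_))
  · refine Primrec.list_map (Primrec.list_range.comp hd) ?_
    refine Primrec.pair (ht.comp Primrec.fst) ?_
    exact Primrec.list_append.comp (Primrec.list_append.comp (hπ.comp Primrec.fst)
      (primrec_replicate Primrec.snd false)) (Primrec.const [true])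
  · refine primrec_filter (Primrec.snd.comp hf) ?_
    exact (Primrec.eq.comp Primrec.snd ((ht.pair hπ).comp Primrec.fst)).not

theorem primrec_serve {r : α → Req} {f : α → AllocState} (hr : Primrec r) (hf : Primrec f) :
    Primrec fun a => serve (r a) (f a) := by
  have hst1 : Primrec fun x : α × ((BStr × ℕ) × Req × AllocState) =>
      if (longestFree (f x.1).2 x.2.2.1 x.2.1.2).isSome then f x.1 else x.2.2.2 := by
    refine Primrec.ite (primrec_option_isSome (primrec_longestFree ?_ ?_ ?_))
      (hf.comp Primrec.fst) (Primrec.snd.comp (Primrec.snd.comp Primrec.snd))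
    · exact Primrec.snd.comp (hf.comp Primrec.fst)
    · exact Primrec.fst.comp (Primrec.snd.comp Primrec.snd)
    · exact Primrec.snd.comp (Primrec.fst.comp Primrec.snd)
  refine (Primrec.list_rec (h := fun a x =>
    (longestFree (if (longestFree (f a).2 x.2.1 x.1.2).isSome then f a else x.2.2).2
      x.2.1 x.1.2).elim (if (longestFree (f a).2 x.2.1 x.1.2).isSome then f a else x.2.2)
      (splitFree (if (longestFree (f a).2 x.2.1 x.1.2).isSome then f a else x.2.2) x.1 x.2.1))
    hr hf ?_).of_eq fun a => ?_
  · refine primrec_option_elim (primrec_longestFree (Primrec.snd.comp hst1) ?_ ?_) hst1 ?_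
    · exact Primrec.fst.comp (Primrec.snd.comp Primrec.snd)
    · exact Primrec.snd.comp (Primrec.fst.comp Primrec.snd)
    · exact primrec_splitFree (hst1.comp Primrec.fst)
        (Primrec.fst.comp (Primrec.snd.comp Primrec.fst))
        (Primrec.fst.comp (Primrec.snd.comp (Primrec.snd.comp Primrec.fst))) Primrec.snd
  · induction r a with
    | nil => rfl
    | cons b t ih => simp only [serve, ← ih]

theorem primrec_demand {dead : α → BStr → Bool} {r : α → Req} {f : α → AllocState}
    (hdead : Primrec₂ dead) (hr : Primrec r) (hf : Primrec f) :
    Primrec fun a => demand (dead a) (r a) (f a) := by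
  unfold demand
  refine Primrec.ite (primrecPred_exists_mem (Primrec.fst.comp hf) ?_) hf
    (primrec_serve hr ((Primrec.fst.comp hf).pair (primrec_filter (Primrec.snd.comp hf) ?_)))
  · exact (Primrec.eq.comp (Primrec.fst.comp Primrec.snd) (hr.comp Primrec.fst)).and
      (Primrec.eq.comp (hdead.comp Primrec.fst (Primrec.snd.comp Primrec.snd))
        (Primrec.const false))
  · exact (Primrec.eq.comp (Primrec.fst.comp Primrec.snd) (hr.comp Primrec.fst)).not

theorem primrec_alloc {req : ℕ → Option Req} {dead : ℕ → BStr → Bool} (hreq : Primrec req)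
    (hdead : Primrec₂ dead) : Primrec (alloc req dead) := by
  refine (Primrec.nat_rec₁ (f := fun s st => (req s).elim st fun r => demand (dead s) r st)
    (([], [([], [])]) : AllocState) ?_).of_eq fun s => ?_
  · refine primrec_option_elim (hreq.comp Primrec.fst) Primrec.snd ?_
    exact primrec_demand (hdead.comp (Primrec.fst.comp (Primrec.fst.comp Primrec.fst))
      Primrec.snd) Primrec.snd (Primrec.snd.comp Primrec.fst)
  · induction s with
    | zero => rfl
    | succ s ih => rw [alloc, ← ih]

theorem primrec_fourLog : Primrec fourLog :=
  Primrec.nat_findGreatest Primrec.id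
    (Primrec.nat_le.comp (primrec_pow (Primrec.const 4) Primrec.snd) Primrec.fst)

theorem primrec_kexp {f g : α → ℕ} (hf : Primrec f) (hg : Primrec g) :
    Primrec fun a => kexp (f a) (g a) := by
  unfold kexp
  refine primrec_fourLog.comp (Primrec.ite (Primrec.eq.comp hf hg)
    (primrec_pow hg (Primrec.const 2)) ?_)
  exact Primrec.nat_mul.comp (primrec_pow hf (Primrec.const 3)) hg

theorem primrec_massNat (hV : Primrec₂ V) {s : α → ℕ} {ρ : α → BStr} (hs : Primrec s)
    (hρ : Primrec ρ) : Primrec fun a => massNat V (s a) (ρ a) := by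
  unfold massNat
  refine primrec_sum_range hs (primrec_option_elim
    (hV.comp (hs.comp Primrec.fst) Primrec.snd) (Primrec.const 0) ?_)
  have hσ : Primrec fun x : (α × ℕ) × BStr × BStr => x.2.2 := Primrec.snd.comp Primrec.snd
  have hρ' : Primrec fun x : (α × ℕ) × BStr × BStr => ρ x.1.1 :=
    hρ.comp (Primrec.fst.comp Primrec.fst)
  refine Primrec.ite (primrecPred_prefix hρ' hσ) (primrec_pow (Primrec.const 2) ?_)
    (Primrec.const 0)
  refine Primrec.nat_sub.comp (hs.comp (Primrec.fst.comp Primrec.fst)) (Primrec.nat_add.comp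
    (Primrec.list_length.comp (Primrec.fst.comp Primrec.snd)) ?_)
  exact primrec_kexp (Primrec.list_length.comp hρ') (Primrec.list_length.comp hσ)

theorem primrec_codeLevel (hV : Primrec₂ V) {s : α → ℕ} {ρ : α → BStr} (hs : Primrec s)
    (hρ : Primrec ρ) : Primrec fun a => codeLevel V (s a) (ρ a) := by
  unfold codeLevel level
  refine Primrec.nat_add.comp (Primrec.nat_sub.comp hs (Primrec.nat_findGreatest hs ?_))
    (Primrec.const 11)
  exact Primrec.nat_le.comp (primrec_pow (Primrec.const 2) Primrec.snd)
    ((primrec_massNat hV hs hρ).comp Primrec.fst)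

theorem primrec_chain {lv : α → BStr → ℕ} {ρ : α → BStr} (hlv : Primrec₂ lv) (hρ : Primrec ρ) :
    Primrec fun a => chain (lv a) (ρ a) := by
  have htake : Primrec fun x : α × ℕ × Req => (ρ x.1).take (x.2.1 + 1) :=
    Primrec.list_take.comp (Primrec.succ.comp (Primrec.fst.comp Primrec.snd))
      (hρ.comp Primrec.fst)
  have hl : Primrec fun x : α × ℕ × Req => lv x.1 ((ρ x.1).take (x.2.1 + 1)) :=
    hlv.comp Primrec.fst htake
  refine (Primrec.nat_rec' (f := fun a => (ρ a).length) (g := fun _ => ([] : Req))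
    (h := fun a x => ((ρ a).take (x.1 + 1), lv a ((ρ a).take (x.1 + 1))) ::
      x.2.filter (fun b => b.2 ≤ lv a ((ρ a).take (x.1 + 1))))
    (Primrec.list_length.comp hρ) (Primrec.const []) ?_).of_eq fun a => ?_
  · refine Primrec.list_cons.comp (htake.pair hl)
      (primrec_filter (Primrec.snd.comp Primrec.snd) ?_)
    exact Primrec.nat_le.comp (Primrec.snd.comp Primrec.snd) (hl.comp Primrec.fst)
  · rw [chain]
    generalize (ρ a).length = n
    induction n with
    | zero => rfl
    | succ n ih => rw [chainTo, ← ih]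

end

/-- The outputs enumerated by stage `s` that are longer than their programs. -/
def compressed (V : ℕ → ℕ → Option (BStr × BStr)) (s : ℕ) : List BStr :=
  (List.range s).filterMap fun n =>
    (V s n).bind fun e => if e.1.length < e.2.length then some e.2 else none

theorem mem_compressed {s : ℕ} {σ : BStr} :
    σ ∈ compressed V s ↔ ∃ n < s, ∃ p, V s n = some (p, σ) ∧ p.length < σ.length := by
  simp only [compressed, List.mem_filterMap, List.mem_range, Option.bind_eq_some_iff,
    Option.ite_none_right_eq_some, Option.some.injEq, Prod.exists]
  constructor
  · rintro ⟨n, hn, p, σ, h, h', rfl⟩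
    exact ⟨n, hn, p, h, h'⟩
  · rintro ⟨n, hn, p, h, h'⟩
    exact ⟨n, hn, p, σ, h, h', rfl⟩

theorem GraphEnum.compressed_mono (hV : GraphEnum V) {s s' : ℕ} (h : s ≤ s') {σ : BStr}
    (hσ : σ ∈ compressed V s) : σ ∈ compressed V s' := by
  rw [mem_compressed] at *
  obtain ⟨n, hn, p, h1, h2⟩ := hσ
  exact ⟨n, by omega, p, hV.mono s s' n _ h h1, h2⟩

theorem GraphEnum.length_le_of_mem_compressed (hV : GraphEnum V) {s : ℕ} {σ : BStr}
    (hσ : σ ∈ compressed V s) : σ.length ≤ s := by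
  obtain ⟨n, _, p, h, _⟩ := mem_compressed.1 hσ
  have := (hV.bound s n _ h).2
  dsimp only at this
  omega

/-- The streams without compressed prefixes. -/
def incompressible (V : ℕ → ℕ → Option (BStr × BStr)) : Set (ℕ → Bool) :=
  {y | ∀ s, ∀ σ ∈ compressed V s, y ∉ cyl σ}

theorem GraphEnum.half_le_coin_incompressible (hV : GraphEnum V) :
    2⁻¹ ≤ coin (incompressible V) := by
  classical
  set f : ℕ → Option (BStr × BStr) := fun n =>
    if h : ∃ e s, V s n = some e then some h.choose else none with hf
  have hf1 : ∀ n e, f n = some e → ∃ s, V s n = some e := by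
    intro n e h
    simp only [hf] at h
    split_ifs at h with h'
    rw [← Option.some.inj h]
    exact h'.choose_spec
  have hf2 : ∀ s n e, V s n = some e → f n = some e := by
    intro s n e h
    have h' : ∃ e s, V s n = some e := ⟨e, s, h⟩
    obtain ⟨s', hs'⟩ := h'.choose_spec
    have h1 := hV.mono s (max s s') n _ (le_max_left _ _) h
    have h2 := hV.mono s' (max s s') n _ (le_max_right _ _) hs'
    simp only [hf]
    rw [dif_pos h', ← h1, h2]
  have hk : ∑' n, ((f n).elim 0 fun e => ((2 : ℝ≥0∞) ^ e.1.length)⁻¹) ≤ 1 := by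
    refine le_trans (le_of_eq ?_) (kraft_sum_le_one (fun n => (f n).map Prod.fst) ?_)
    · refine tsum_congr fun n => ?_
      cases f n <;> rfl
    · intro i j σ τ hi hj
      rw [Option.map_eq_some_iff] at hi hj
      obtain ⟨e, hi, rfl⟩ := hi
      obtain ⟨e', hj, rfl⟩ := hj
      obtain ⟨s, hi⟩ := hf1 i e hi
      obtain ⟨s', hj⟩ := hf1 j e' hj
      exact hV.prefixFree s s' i j e e' hi hj
  have hc : coin (incompressible V)ᶜ ≤ 2⁻¹ := by
    calc coin (incompressible V)ᶜ
        ≤ coin (⋃ n, (f n).elim ∅ fun e => if e.1.length < e.2.length then cyl e.2 else ∅) := by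
          refine MeasureTheory.measure_mono fun y hy => ?_
          simp only [incompressible, Set.mem_compl_iff, Set.mem_ofPred_eq, not_forall,
            not_not] at hy
          obtain ⟨s, σ, hσ, hy⟩ := hy
          obtain ⟨n, _, p, h1, h2⟩ := mem_compressed.1 hσ
          refine Set.mem_iUnion.2 ⟨n, ?_⟩
          rw [hf2 s n _ h1]
          simpa [h2] using hy
      _ ≤ ∑' n, coin ((f n).elim ∅ fun e => if e.1.length < e.2.length then cyl e.2 else ∅) :=
          MeasureTheory.measure_iUnion_le _
      _ ≤ ∑' n, 2⁻¹ * ((f n).elim 0 fun e => ((2 : ℝ≥0∞) ^ e.1.length)⁻¹) := by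
          refine ENNReal.tsum_le_tsum fun n => ?_
          cases f n with
          | none => simp
          | some e =>
            simp only [Option.elim]
            split_ifs with h
            · rw [coin_cyl, show (2⁻¹ : ℝ≥0∞) = (2 ^ 1)⁻¹ by rw [pow_one], two_pow_inv_mul,
                two_pow_inv_anti]
              omega
            · simp
      _ ≤ 2⁻¹ := by
          rw [ENNReal.tsum_mul_left]
          exact mul_le_of_le_one_right' hk
  have h1 : (1 : ℝ≥0∞) ≤ coin (incompressible V) + coin (incompressible V)ᶜ := by
    calc (1 : ℝ≥0∞) = coin Set.univ := MeasureTheory.measure_univ.symm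
      _ ≤ _ := by
        rw [← Set.union_compl_self (incompressible V)]
        exact MeasureTheory.measure_union_le _ _
  have h2 : (2⁻¹ : ℝ≥0∞) + 2⁻¹ ≤ coin (incompressible V) + 2⁻¹ := by
    rw [ENNReal.inv_two_add_inv_two]
    exact h1.trans (by gcongr)
  exact (ENNReal.add_le_add_iff_right (by norm_num)).1 h2

/-- All strings of length `n`. -/
def allStrings : ℕ → List BStr
  | 0 => [[]]
  | n + 1 => (allStrings n).flatMap fun w => [false :: w, true :: w]

theorem mem_allStrings {n : ℕ} {w : BStr} : w ∈ allStrings n ↔ w.length = n := by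
  induction n generalizing w with
  | zero => simp [allStrings]
  | succ n ih =>
    simp only [allStrings, List.mem_flatMap, List.mem_cons, List.not_mem_nil, or_false]
    constructor
    · rintro ⟨w', h, rfl | rfl⟩ <;> simp [ih.1 h]
    · intro h
      cases w with
      | nil => simp at h
      | cons b w => exact ⟨w, ih.2 (by simpa using h), by cases b <;> simp⟩

/-- Whether `τ` is seen at stage `s` to have no incompressible extension. -/
def deadAt (V : ℕ → ℕ → Option (BStr × BStr)) (s : ℕ) (τ : BStr) : Bool :=
  decide (∀ w ∈ allStrings s, ∃ q ∈ compressed V s, q <+: τ ++ w)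

theorem GraphEnum.deadAt_mono (hV : GraphEnum V) {s s' : ℕ} {τ : BStr} (h : s ≤ s')
    (hd : deadAt V s τ = true) : deadAt V s' τ = true := by
  simp only [deadAt, decide_eq_true_eq] at *
  intro w hw
  rw [mem_allStrings] at hw
  obtain ⟨q, hq, hq'⟩ := hd (w.take s) (mem_allStrings.2 (by rw [List.length_take]; omega))
  exact ⟨q, hV.compressed_mono h hq,
    hq'.trans ((List.prefix_append_right_inj τ).2 (List.take_prefix _ _))⟩

theorem disjoint_of_deadAt {s : ℕ} {τ : BStr} (hd : deadAt V s τ = true) :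
    Disjoint (incompressible V) (cyl τ) := by
  simp only [deadAt, decide_eq_true_eq] at hd
  rw [Set.disjoint_left]
  intro y hy hτ
  rw [mem_cyl_iff_prefix_stake (Nat.le_add_right τ.length s)] at hτ
  obtain ⟨w, hw⟩ := hτ
  have hl : w.length = s := by
    have := congrArg List.length hw
    simpa using this
  obtain ⟨q, hq, hq'⟩ := hd w (mem_allStrings.2 hl)
  refine hy s q hq ?_
  rw [hw] at hq'
  exact mem_cyl_of_prefix hq' (mem_cyl_stake _ _)

theorem GraphEnum.exists_stream_of_not_deadAt (hV : GraphEnum V) {s : ℕ} {τ : BStr}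
    (hd : deadAt V s τ = false) : ∃ y ∈ cyl τ, ∀ q ∈ compressed V s, y ∉ cyl q := by
  simp only [deadAt, decide_eq_false_iff_not, not_forall, not_exists, not_and] at hd
  obtain ⟨w, hw, h⟩ := hd
  rw [mem_allStrings] at hw
  have hy : (fun i => (τ ++ w).getD i false) ∈ cyl (τ ++ w) := by
    rw [mem_cyl]
    refine List.ext_getElem (by simp) fun i h1 h2 => ?_
    simp only [stake, List.getElem_map, List.getElem_range]
    rw [List.getD_eq_getElem _ _ h2]
  refine ⟨_, mem_cyl_of_prefix (List.prefix_append τ w) hy, fun q hq hyq => h q hq ?_⟩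
  have hq1 := hV.length_le_of_mem_compressed hq
  have hq2 : q.length ≤ (τ ++ w).length := by rw [List.length_append]; omega
  rw [mem_cyl_iff_prefix_stake hq2, mem_cyl.1 hy] at hyq
  exact hyq

/-- The request considered at stage `s`. -/
def requestAt (V : ℕ → ℕ → Option (BStr × BStr)) (s : ℕ) : Option Req :=
  (Encodable.decode (α := BStr) s.unpair.1).bind fun ρ =>
    if ρ ≠ [] ∧ 0 < massNat V s ρ then some (chain (codeLevel V s) ρ) else none

theorem GraphEnum.goodReq_of_requestAt (hV : GraphEnum V) {s : ℕ} {r : Req}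
    (h : requestAt V s = some r) : GoodReq (requests V) r ∧ r ≠ [] := by
  simp only [requestAt, Option.bind_eq_some_iff, Option.ite_none_right_eq_some,
    Option.some.injEq] at h
  obtain ⟨ρ, _, ⟨h1, h2⟩, rfl⟩ := h
  refine ⟨goodReq_chain fun ρ' h3 h4 => ⟨s, ρ', h3, hV.massNat_pos_of_prefix h4 h2, rfl⟩, ?_⟩
  obtain ⟨t, ht⟩ := chain_ne_nil (lv := codeLevel V s) h1
  simp [ht]

theorem GraphEnum.rootFree (hV : GraphEnum V) : RootFree (incompressible V) (requests V) := by
  refine rootFree_of_weight hV.half_le_coin_incompressible hV.weight_requests_le ?_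
  rintro a ⟨s, ρ, h1, _, h2⟩
  have := lev_chain_codeLevel (V := V) (s := s) h1
  rw [← h2, lev_cons] at this
  omega

/-- The stages of the allocation of codes for the enumeration `V`. -/
def codes (V : ℕ → ℕ → Option (BStr × BStr)) (s : ℕ) : List (Req × BStr) :=
  (alloc (requestAt V) (deadAt V) s).1

theorem GraphEnum.allocInv (hV : GraphEnum V) (s : ℕ) :
    AllocInv (incompressible V) (requests V) (alloc (requestAt V) (deadAt V) s) :=
  allocInv_alloc hV.rootFree (fun _ _ => hV.goodReq_of_requestAt) (fun _ _ => disjoint_of_deadAt) s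

theorem GraphEnum.codes_mono (hV : GraphEnum V) {s s' : ℕ} (h : s ≤ s') :
    codes V s ⊆ codes V s' :=
  alloc_subset hV.rootFree (fun _ _ => hV.goodReq_of_requestAt) (fun _ _ => disjoint_of_deadAt) h

theorem GraphEnum.label_comparable (hV : GraphEnum V) {s s' : ℕ} {y : ℕ → Bool}
    {b b' : BStr × ℕ} {t t' : Req} {τ τ' : BStr} (hτ : (b :: t, τ) ∈ codes V s)
    (hτ' : (b' :: t', τ') ∈ codes V s') (hy : y ∈ cyl τ) (hy' : y ∈ cyl τ') :
    b.1 <+: b'.1 ∨ b'.1 <+: b.1 :=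
  (hV.allocInv (max s s')).label_comparable (hV.codes_mono (le_max_left s s') hτ)
    (hV.codes_mono (le_max_right s s') hτ') hy hy'

theorem exists_forall_ge_eq_of_anti {f : ℕ → ℕ} {S₀ : ℕ}
    (hf : ∀ s s', S₀ ≤ s → s ≤ s' → f s' ≤ f s) : ∃ S, ∀ s ≥ S, f s = f S := by
  have hne : (f '' Set.Ici S₀).Nonempty := ⟨f S₀, S₀, Set.mem_Ici.2 le_rfl, rfl⟩
  obtain ⟨S, hS, hmin⟩ := Nat.sInf_mem hne
  refine ⟨S, fun s hs => le_antisymm (hf S s hS hs) ?_⟩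
  rw [hmin]
  exact Nat.sInf_le ⟨s, le_trans hS hs, rfl⟩

theorem GraphEnum.exists_stable_chain (hV : GraphEnum V) {ρ : BStr} {S₀ : ℕ}
    (hρ : 0 < massNat V S₀ ρ) :
    ∃ S ≥ S₀, ∀ s ≥ S, chain (codeLevel V s) ρ = chain (codeLevel V S) ρ := by
  have h : ∀ i, ∃ S, ∀ s ≥ S, codeLevel V s (ρ.take i) = codeLevel V S (ρ.take i) := fun i =>
    exists_forall_ge_eq_of_anti (S₀ := S₀) fun s s' h1 h2 => by
      have := hV.level_anti h2 (hV.massNat_pos_mono h1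
        (hV.massNat_pos_of_prefix (List.take_prefix i ρ) hρ))
      rw [codeLevel, codeLevel]
      omega
  choose S hS using h
  refine ⟨max S₀ ((Finset.range (ρ.length + 1)).sup S), le_max_left _ _, fun s hs => ?_⟩
  refine chain_congr fun ρ' _ h2 => ?_
  have h3 : S ρ'.length ≤ (Finset.range (ρ.length + 1)).sup S :=
    Finset.le_sup (Finset.mem_range.2 (Nat.lt_succ_of_le h2.length_le))
  have h4 : ρ' = ρ.take ρ'.length := List.prefix_iff_eq_take.1 h2
  rw [h4, hS ρ'.length s (by omega), hS ρ'.length (max S₀ _) (by omega)]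

theorem GraphEnum.exists_approx_stream (hV : GraphEnum V) {X : ℕ → Bool} {K : ℕ → ℕ}
    (hK : ∀ i, 1 ≤ i → ∃ s n p, V s n = some (p, stake X i) ∧ p.length ≤ K i) {n : ℕ}
    (hn : 1 ≤ n) :
    ∃ y : ℕ → Bool, (∀ q ∈ compressed V n, y ∉ cyl q) ∧ ∀ i, 1 ≤ i → i ≤ n →
      ∃ b t τ s, (b :: t, τ) ∈ codes V s ∧ y ∈ cyl τ ∧ stake X i <+: b.1 ∧
        b.1 <+: stake X n ∧ τ.length ≤ K i + Nat.clog 2 i + 11 := by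
  choose! s₀ m p hV₀ hp using hK
  set S₀ := (Finset.range (n + 1)).sup s₀ with hS₀
  have hV₁ : ∀ i, 1 ≤ i → i ≤ n → ∀ s ≥ S₀, V s (m i) = some (p i, stake X i) := by
    intro i h1 h2 s hs
    have : s₀ i ≤ S₀ := Finset.le_sup (Finset.mem_range.2 (by omega))
    exact hV.mono _ _ _ _ (this.trans hs) (hV₀ i h1)
  have hpos : 0 < massNat V S₀ (stake X n) := by
    rw [← hV.mass_pos_iff]
    have := le_mass_of_mem (hV₁ n hn le_rfl S₀ le_rfl)
    intro h0
    rw [h0] at this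
    simp at this
  have hne : stake X n ≠ [] := by
    rw [ne_eq, ← List.length_eq_zero_iff, length_stake]
    omega
  obtain ⟨S, hS, hchain⟩ := hV.exists_stable_chain hpos
  obtain ⟨τ, ⟨s, hs⟩, hdead⟩ := exists_immortal_code (req := requestAt V) (dead := deadAt V)
    (r := chain (codeLevel V S) (stake X n))
    hV.rootFree (fun _ _ => hV.goodReq_of_requestAt) (fun _ _ => disjoint_of_deadAt)
    (fun _ _ _ => hV.deadAt_mono) fun T => by
      have h1 : max T S ≤ Nat.pair (Encodable.encode (stake X n)) (max T S) :=
        Nat.right_le_pair _ _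
      refine ⟨Nat.pair (Encodable.encode (stake X n)) (max T S), by omega, ?_⟩
      rw [requestAt, Nat.unpair_pair, Encodable.encodek, Option.bind_some,
        if_pos ⟨hne, hV.massNat_pos_mono (by omega) hpos⟩, hchain _ (by omega)]
  obtain ⟨y, hy, hyq⟩ := hV.exists_stream_of_not_deadAt (hdead n)
  refine ⟨y, hyq, fun i hi hin => ?_⟩
  obtain ⟨b, hb, h1, h2⟩ := exists_mem_chainTo (lv := codeLevel V S) (ρ := stake X n) hi hin
  rw [take_stake X hin] at h1 h2
  have hb' : b ∈ chain (codeLevel V S) (stake X n) := by rwa [chain, length_stake]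
  obtain ⟨t, τ', h3, h4⟩ := (hV.allocInv s).exists_code_of_mem hs hb'
  refine ⟨b, t, τ', s, h3, mem_cyl_of_prefix h4 hy, h1,
    (label_of_mem_chainTo hb).trans (List.take_prefix _ _), ?_⟩
  rw [(hV.allocInv s).code_length _ _ h3, lev_cons]
  have h5 := hV.level_le_of_le_mass (le_mass_of_mem (hV₁ i hi hin S hS))
  rw [length_stake] at h5
  have h6 := kexp_self_le_clog hi
  have h7 := hp i hi
  rw [codeLevel] at h2
  omega

theorem GraphEnum.exists_stream (hV : GraphEnum V) {X : ℕ → Bool} {K : ℕ → ℕ}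
    (hK : ∀ i, 1 ≤ i → ∃ s n p, V s n = some (p, stake X i) ∧ p.length ≤ K i) :
    ∃ Y ∈ incompressible V, ∀ i, 1 ≤ i →
      ∃ b t τ s, (b :: t, τ) ∈ codes V s ∧ Y ∈ cyl τ ∧ stake X i <+: b.1 ∧
        (∃ n, b.1 <+: stake X n) ∧ τ.length ≤ K i + Nat.clog 2 i + 11 := by
  choose! y hy1 hy2 using fun n hn => hV.exists_approx_stream hK (n := n) hn
  obtain ⟨Y, φ, hφ, hlim⟩ := CompactSpace.tendsto_subseq y
  have hev : ∀ m, ∀ᶠ k in Filter.atTop, stake (y (φ k)) m = stake Y m := by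
    intro m
    have h : ∀ i, ∀ᶠ k in Filter.atTop, y (φ k) i = Y i := fun i => by
      have := (tendsto_pi_nhds.1 hlim) i
      rw [nhds_discrete, Filter.tendsto_pure] at this
      exact this
    have h' : ∀ᶠ k in Filter.atTop, ∀ i ∈ Finset.range m, y (φ k) i = Y i :=
      (Filter.eventually_all_finset _).2 fun i _ => h i
    filter_upwards [h'] with k hk
    exact List.map_congr_left fun i hi => hk i (by simpa using hi)
  have hcyl : ∀ m, ∃ n ≥ max m 1, ∀ τ : BStr, τ.length ≤ m → (y n ∈ cyl τ ↔ Y ∈ cyl τ) := by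
    intro m
    obtain ⟨k, hk1, hk2⟩ := ((hev m).and (Filter.eventually_ge_atTop (max m 1))).exists
    refine ⟨φ k, hk2.trans (hφ.id_le k), fun τ hτ => ?_⟩
    rw [mem_cyl_iff_prefix_stake hτ, mem_cyl_iff_prefix_stake hτ, hk1]
  refine ⟨Y, fun s q hq hYq => ?_, fun i hi => ?_⟩
  · obtain ⟨n, hn, h⟩ := hcyl s
    exact hy1 n (by omega) q (hV.compressed_mono (by omega) hq)
      ((h q (hV.length_le_of_mem_compressed hq)).2 hYq)
  · obtain ⟨n, hn, h⟩ := hcyl (max i (K i + Nat.clog 2 i + 11))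
    obtain ⟨b, t, τ, s, h1, h2, h3, h4, h5⟩ := hy2 n (by omega) i hi (by omega)
    exact ⟨b, t, τ, s, h1, (h τ (by omega)).1 h2, h3, ⟨n, h4⟩, h5⟩

section
variable {α : Type} [Primcodable α]

theorem primrec_compressed (hV : Primrec₂ V) : Primrec (compressed V) := by
  refine Primrec.listFilterMap Primrec.list_range (Primrec.option_bind hV ?_)
  refine Primrec.ite (Primrec.nat_lt.comp
    (Primrec.list_length.comp (Primrec.fst.comp Primrec.snd))
    (Primrec.list_length.comp (Primrec.snd.comp Primrec.snd)))
    (Primrec.option_some.comp (Primrec.snd.comp Primrec.snd)) (Primrec.const none)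

theorem primrec_allStrings : Primrec allStrings := by
  refine (Primrec.nat_rec₁ (f := fun _ l => l.flatMap fun w => [false :: w, true :: w])
    ([[]] : List BStr) ?_).of_eq fun n => ?_
  · refine Primrec.list_flatMap Primrec.snd ?_
    exact Primrec.list_cons.comp (Primrec.list_cons.comp (Primrec.const false) Primrec.snd)
      (Primrec.list_cons.comp (Primrec.list_cons.comp (Primrec.const true) Primrec.snd)
        (Primrec.const []))
  · induction n with
    | zero => rfl
    | succ n ih => rw [allStrings, ← ih]

theorem primrec_deadAt (hV : Primrec₂ V) : Primrec₂ (deadAt V) := by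
  refine PrimrecPred.decide (p := fun x : ℕ × BStr =>
    ∀ w ∈ allStrings x.1, ∃ q ∈ compressed V x.1, q <+: x.2 ++ w) ?_
  refine primrecPred_forall_mem (primrec_allStrings.comp Primrec.fst)
    (primrecPred_exists_mem ((primrec_compressed hV).comp (Primrec.fst.comp Primrec.fst)) ?_)
  exact primrecPred_prefix Primrec.snd (Primrec.list_append.comp
    (Primrec.snd.comp (Primrec.fst.comp Primrec.fst)) (Primrec.snd.comp Primrec.fst))

theorem primrec_requestAt (hV : Primrec₂ V) : Primrec (requestAt V) := by
  refine Primrec.option_bind (Primrec.decode.comp (Primrec.fst.comp Primrec.unpair)) ?_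
  refine Primrec.ite ((Primrec.eq.comp Primrec.snd (Primrec.const [])).not.and
    (Primrec.nat_lt.comp (Primrec.const 0) (primrec_massNat hV Primrec.fst Primrec.snd)))
    (Primrec.option_some.comp (primrec_chain ?_ Primrec.snd)) (Primrec.const none)
  exact primrec_codeLevel hV (Primrec.fst.comp Primrec.fst) Primrec.snd

theorem primrec_codes (hV : Primrec₂ V) : Primrec (codes V) :=
  Primrec.fst.comp (primrec_alloc (primrec_requestAt hV) (primrec_deadAt hV))

end

/-- The graph of the machine with code `c`, enumerated in stages. -/
def graphAt (c : Nat.Partrec.Code) (s n : ℕ) : Option (BStr × BStr) :=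
  (Encodable.decode (α := BStr) n).bind fun p => (Nat.Partrec.Code.evaln s c n).bind fun m =>
    (Encodable.decode (α := BStr) m).bind fun σ =>
      if Encodable.encode p = n ∧ p.length + 2 * σ.length ≤ s then some (p, σ) else none

theorem graphAt_eq_some {c : Nat.Partrec.Code} {s n : ℕ} {e : BStr × BStr} :
    graphAt c s n = some e ↔ ∃ m, m ∈ Nat.Partrec.Code.evaln s c n ∧
      Encodable.decode (α := BStr) m = some e.2 ∧ Encodable.encode e.1 = n ∧
      e.1.length + 2 * e.2.length ≤ s := by
  simp only [graphAt, Option.bind_eq_some_iff, Option.ite_none_right_eq_some, Option.some.injEq]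
  constructor
  · rintro ⟨p, _, m, hm, σ, hσ, ⟨h1, h2⟩, rfl⟩
    exact ⟨m, hm, hσ, h1, h2⟩
  · rintro ⟨m, hm, hσ, h1, h2⟩
    exact ⟨e.1, by rw [← h1, Encodable.encodek], m, hm, e.2, hσ, ⟨h1, h2⟩, rfl⟩

theorem primrec_graphAt (c : Nat.Partrec.Code) : Primrec₂ (graphAt c) := by
  refine Primrec.option_bind (Primrec.decode.comp Primrec.snd) ?_
  refine Primrec.option_bind (Nat.Partrec.Code.primrec_evaln.comp
    (Primrec.pair (Primrec.pair (Primrec.fst.comp Primrec.fst) (Primrec.const c))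
      (Primrec.snd.comp Primrec.fst))) ?_
  refine Primrec.option_bind (Primrec.decode.comp Primrec.snd) ?_
  have hx : Primrec fun x : (((ℕ × ℕ) × BStr) × ℕ) × BStr => x.1.1.1 :=
    Primrec.fst.comp (Primrec.fst.comp Primrec.fst)
  have hp : Primrec fun x : (((ℕ × ℕ) × BStr) × ℕ) × BStr => x.1.1.2 :=
    Primrec.snd.comp (Primrec.fst.comp Primrec.fst)
  refine Primrec.ite ((Primrec.eq.comp (Primrec.encode.comp hp) (Primrec.snd.comp hx)).and
    (Primrec.nat_le.comp (Primrec.nat_add.comp (Primrec.list_length.comp hp)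
      (Primrec.nat_mul.comp (Primrec.const 2) (Primrec.list_length.comp Primrec.snd)))
      (Primrec.fst.comp hx)))
    (Primrec.option_some.comp (hp.pair Primrec.snd)) (Primrec.const none)

section
variable {U : BStr →. BStr} {c : Nat.Partrec.Code}

theorem mem_of_graphAt (hc : c.eval = fun n => Part.bind (Encodable.decode (α := BStr) n)
    fun a => (U a).map Encodable.encode) {s n : ℕ} {e : BStr × BStr}
    (h : graphAt c s n = some e) : e.2 ∈ U e.1 ∧ Encodable.encode e.1 = n := by
  obtain ⟨m, hm, hσ, rfl, _⟩ := graphAt_eq_some.1 h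
  have h1 := Nat.Partrec.Code.evaln_sound hm
  rw [hc] at h1
  simp only [Encodable.encodek, Part.coe_some, Part.bind_some, Part.mem_map_iff] at h1
  obtain ⟨σ, h2, rfl⟩ := h1
  rw [Encodable.encodek, Option.some.injEq] at hσ
  exact ⟨hσ ▸ h2, rfl⟩

theorem exists_graphAt (hc : c.eval = fun n => Part.bind (Encodable.decode (α := BStr) n)
    fun a => (U a).map Encodable.encode) {p σ : BStr} (h : σ ∈ U p) :
    ∃ s, graphAt c s (Encodable.encode p) = some (p, σ) := by
  have h1 : Encodable.encode σ ∈ c.eval (Encodable.encode p) := by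
    rw [hc]
    simp only [Encodable.encodek, Part.coe_some, Part.bind_some, Part.mem_map_iff]
    exact ⟨σ, h, rfl⟩
  obtain ⟨k, hk⟩ := Nat.Partrec.Code.evaln_complete.1 h1
  refine ⟨max k (p.length + 2 * σ.length), graphAt_eq_some.2 ⟨Encodable.encode σ,
    Nat.Partrec.Code.evaln_mono (le_max_left _ _) hk, Encodable.encodek σ, rfl, le_max_right _ _⟩⟩

theorem graphEnum_graphAt (hU : PrefixFreeSet {ρ | (U ρ).Dom})
    (hc : c.eval = fun n => Part.bind (Encodable.decode (α := BStr) n)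
      fun a => (U a).map Encodable.encode) : GraphEnum (graphAt c) where
  mono s s' n e hs h := by
    obtain ⟨m, hm, hσ, h1, h2⟩ := graphAt_eq_some.1 h
    exact graphAt_eq_some.2 ⟨m, Nat.Partrec.Code.evaln_mono hs hm, hσ, h1, h2.trans hs⟩
  bound s n e h := by
    obtain ⟨m, hm, _, _, h2⟩ := graphAt_eq_some.1 h
    exact ⟨Nat.Partrec.Code.evaln_bound hm, h2⟩
  prefixFree s s' i j e e' h h' hp := by
    obtain ⟨h1, rfl⟩ := mem_of_graphAt hc h
    obtain ⟨h2, rfl⟩ := mem_of_graphAt hc h'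
    exact congrArg _ (hU _ (Part.dom_iff_mem.2 ⟨_, h1⟩) _ (Part.dom_iff_mem.2 ⟨_, h2⟩) hp)

end

theorem KM_le {M : BStr →. BStr} {p σ : BStr} (h : σ ∈ M p) : KM M σ ≤ p.length :=
  sInf_le ⟨p, h, rfl⟩

theorem exists_length_eq_KM {M : BStr →. BStr} {σ : BStr} (h : KM M σ ≠ ⊤) :
    ∃ p, σ ∈ M p ∧ (p.length : ℕ∞) = KM M σ := by
  have hne : ((fun ρ : BStr => (ρ.length : ℕ∞)) '' {ρ | σ ∈ M ρ}).Nonempty := by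
    by_contra h0
    rw [Set.not_nonempty_iff_eq_empty] at h0
    rw [KM, h0, sInf_empty] at h
    exact h rfl
  obtain ⟨p, hp, h1⟩ := csInf_mem hne
  exact ⟨p, hp, h1⟩

theorem KM_ne_top_of_universal {U : BStr →. BStr} (hU : UniversalPFM U) (σ : BStr) :
    KM U σ ≠ ⊤ := by
  have hM : PrefixFreeMachine fun ρ : BStr => ((if ρ = [] then some σ else none : Option BStr) :
      Part BStr) := by
    constructor
    · refine Computable.ofOption (Primrec.ite (Primrec.eq.comp Primrec.id (Primrec.const []))
        (Primrec.const (some σ)) (Primrec.const none)).to_comp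
    · intro ρ hρ ρ' hρ' _
      have h : ∀ ρ : BStr, ((if ρ = [] then some σ else none : Option BStr) : Part BStr).Dom →
          ρ = [] := by
        intro ρ h
        by_contra h0
        rw [if_neg h0] at h
        exact h
      rw [h ρ hρ, h ρ' hρ']
  obtain ⟨c, hc⟩ := hU.2 _ hM
  have h1 := (hc σ).trans (add_le_add_left (KM_le (p := []) (by simp)) _)
  exact ne_top_of_le_ne_top (by simp) h1

theorem exists_length_eq_Kof {U : BStr →. BStr} (hU : UniversalPFM U) (σ : BStr) :
    ∃ p, σ ∈ U p ∧ p.length = Kof U σ := by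
  obtain ⟨p, hp, h⟩ := exists_length_eq_KM (KM_ne_top_of_universal hU σ)
  exact ⟨p, hp, by rw [Kof, ← h, ENat.toNat_natCast]⟩

theorem stake_add (Y : ℕ → Bool) (k n : ℕ) :
    stake Y (k + n) = stake Y k ++ stake (fun i => Y (k + i)) n := by
  simp [stake, List.range_add, Function.comp_def]

/-- Deleting finitely many bits of an incompressible stream leaves a random stream. -/
theorem mlRandom_shift {U : BStr →. BStr} (hU : UniversalPFM U) {Y : ℕ → Bool}
    (hY : ∀ n p, stake Y n ∈ U p → n ≤ p.length) (k : ℕ) :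
    MLRandom U fun i => Y (k + i) := by
  have hM : PrefixFreeMachine fun ρ => (U ρ).map fun τ => stake Y k ++ τ := by
    refine ⟨hU.1.1.map ?_, hU.1.2⟩
    exact (Primrec.list_append.comp (Primrec.const (stake Y k)) Primrec.snd).to_comp
  obtain ⟨c, hc⟩ := hU.2 _ hM
  refine ⟨c, fun n => ?_⟩
  obtain ⟨p, hp, hpl⟩ := exists_length_eq_Kof hU (stake (fun i => Y (k + i)) n)
  obtain ⟨q, hq, hql⟩ := exists_length_eq_KM (KM_ne_top_of_universal hU (stake Y (k + n)))
  have h1 : KM (fun ρ => (U ρ).map fun τ => stake Y k ++ τ) (stake Y (k + n)) ≤ p.length := by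
    refine KM_le ?_
    rw [stake_add]
    exact Part.mem_map _ hp
  have h2 := (hc (stake Y (k + n))).trans (add_le_add_left h1 _)
  rw [← hql] at h2
  have h3 : q.length ≤ p.length + c := by exact_mod_cast h2
  have h4 := hY _ q hq
  omega

/-- The label of the first code at stage `s` that is a prefix of `z` and whose label has length
at least `n`, truncated to length `n`. -/
def decodeAt (V : ℕ → ℕ → Option (BStr × BStr)) (n : ℕ) (z : BStr) (s : ℕ) : Option BStr :=
  (((codes V s).filter fun e =>
    e.2 <+: z ∧ n ≤ (e.1.head?.elim [] Prod.fst).length).head?).map fun e =>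
      (e.1.head?.elim [] Prod.fst).take n

theorem computable_decodeAt (hV : Primrec₂ V) (z : BStr) :
    Computable₂ fun (x : ℕ × BStr) s => decodeAt V x.1 (z ++ x.2) s := by
  have hlabel : Primrec fun e : Req × BStr => (e.1.head?.elim [] Prod.fst : BStr) :=
    primrec_option_elim (Primrec.list_head?.comp Primrec.fst) (Primrec.const [])
      (Primrec.fst.comp Primrec.snd)
  refine Primrec.to_comp (Primrec.option_map (Primrec.list_head?.comp
    (primrec_filter ((primrec_codes hV).comp Primrec.snd) ?_)) ?_)
  · refine (primrecPred_prefix (Primrec.snd.comp Primrec.snd) (Primrec.list_append.comp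
      (Primrec.const z) (Primrec.snd.comp (Primrec.fst.comp Primrec.fst)))).and ?_
    exact Primrec.nat_le.comp (Primrec.fst.comp (Primrec.fst.comp Primrec.fst))
      (Primrec.list_length.comp (hlabel.comp Primrec.snd))
  · exact Primrec.list_take.comp (Primrec.fst.comp (Primrec.fst.comp Primrec.fst))
      (hlabel.comp Primrec.snd)

theorem GraphEnum.exists_of_decodeAt_eq_some (hV : GraphEnum V) {n s : ℕ} {z σ : BStr}
    (h : decodeAt V n z s = some σ) :
    ∃ b t τ, (b :: t, τ) ∈ codes V s ∧ τ <+: z ∧ n ≤ b.1.length ∧ σ = b.1.take n := by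
  simp only [decodeAt, Option.map_eq_some_iff] at h
  obtain ⟨⟨r, τ⟩, h, rfl⟩ := h
  have := List.mem_of_mem_head? h
  simp only [List.mem_filter, decide_eq_true_eq] at this
  obtain ⟨h1, h2, h3⟩ := this
  obtain ⟨b, t, rfl⟩ := List.exists_cons_of_ne_nil ((hV.allocInv s).code_ne_nil r τ h1)
  exact ⟨b, t, τ, h1, h2, h3, rfl⟩

theorem exists_decodeAt_eq_some {n s : ℕ} {z : BStr} {b : BStr × ℕ} {t : Req} {τ : BStr}
    (h : (b :: t, τ) ∈ codes V s) (hτ : τ <+: z) (hn : n ≤ b.1.length) :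
    ∃ σ, decodeAt V n z s = some σ := by
  have h1 : (b :: t, τ) ∈ (codes V s).filter fun e =>
      e.2 <+: z ∧ n ≤ (e.1.head?.elim [] Prod.fst).length := by
    simp [List.mem_filter, h, hτ, hn]
  rw [decodeAt]
  cases h2 : (codes V s).filter fun e =>
      e.2 <+: z ∧ n ≤ (e.1.head?.elim [] Prod.fst).length with
  | nil => rw [h2] at h1; simp at h1
  | cons e l => exact ⟨_, rfl⟩

/-- A code of small length for a long enough prefix can be found and decoded. -/
theorem GraphEnum.stake_mem_rfindOpt_decodeAt (hV : GraphEnum V) {X Y : ℕ → Bool} {n m s : ℕ}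
    {b : BStr × ℕ} {t : Req} {τ : BStr} (h : (b :: t, τ) ∈ codes V s) (hY : Y ∈ cyl τ)
    (hτ : τ.length ≤ m) (hn : n ≤ b.1.length) (hb : ∃ k, b.1 <+: stake X k) :
    stake X n ∈ Nat.rfindOpt (decodeAt V n (stake Y m)) := by
  obtain ⟨σ₀, hσ₀⟩ := exists_decodeAt_eq_some h ((mem_cyl_iff_prefix_stake hτ).1 hY) hn
  have hdom : (Nat.rfindOpt (decodeAt V n (stake Y m))).Dom :=
    Nat.rfindOpt_dom.2 ⟨s, σ₀, hσ₀⟩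
  obtain ⟨σ, hσ⟩ := Part.dom_iff_mem.1 hdom
  obtain ⟨s', hs'⟩ := Nat.rfindOpt_spec hσ
  obtain ⟨b', t', τ', h1, h2, h3, rfl⟩ := hV.exists_of_decodeAt_eq_some hs'
  have hY' : Y ∈ cyl τ' := mem_cyl_of_prefix h2 (mem_cyl_stake Y m)
  have heq : b'.1.take n = b.1.take n := by
    rcases hV.label_comparable h1 h hY' hY with hp | hp
    · obtain ⟨u, hu⟩ := hp
      rw [← hu, List.take_append_of_le_length h3]
    · obtain ⟨u, hu⟩ := hp
      rw [← hu, List.take_append_of_le_length hn]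
  obtain ⟨k, u, hk⟩ := hb
  have hnk : n ≤ k := by
    have := congrArg List.length hk
    rw [List.length_append, length_stake] at this
    omega
  have hX : stake X n = b'.1.take n := by
    rw [heq, ← take_stake X hnk, ← hk, List.take_append_of_le_length hn]
  rw [hX]
  exact hσ

end OptUse

/-- Theorem: every binary stream `X` is computable from a Martin-Löf random `Y` with
oracle-use `n ↦ min_{i ≥ max(n,1)} (K(X↾i) + ⌈log₂ i⌉)`, where `⌈log₂ i⌉` is the least
`m` with `i ≤ 2^m` (i.e. `Nat.clog 2 i`). -/
theorem stmt3 (U : BStr →. BStr) (hU : UniversalPFM U) (X : ℕ → Bool) :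
    ∃ Y : ℕ → Bool, MLRandom U Y ∧
      ComputableWithUse X Y
        (fun n => sInf {m : ℕ | ∃ i, max n 1 ≤ i ∧
          m = Kof U (stake X i) + Nat.clog 2 i}) := by
  obtain ⟨c, hc⟩ := Nat.Partrec.Code.exists_code.1 hU.1.1
  have hV := OptUse.graphEnum_graphAt hU.1.2 hc
  obtain ⟨Y, hYE, hY⟩ := hV.exists_stream (X := X) (K := fun i => Kof U (stake X i)) fun i _ => by
    obtain ⟨p, hp, hpl⟩ := OptUse.exists_length_eq_Kof hU (stake X i)
    obtain ⟨s, hs⟩ := OptUse.exists_graphAt hc hp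
    exact ⟨s, _, p, hs, hpl.le⟩
  refine ⟨fun i => Y (11 + i), OptUse.mlRandom_shift hU (fun n p hp => ?_) 11,
    fun x => Nat.rfindOpt fun s => OptUse.decodeAt (OptUse.graphAt c) x.1 (stake Y 11 ++ x.2) s,
    Partrec.rfindOpt (OptUse.computable_decodeAt (OptUse.primrec_graphAt c) (stake Y 11)),
    fun n => ?_⟩
  · by_contra! hlt
    obtain ⟨s, hs⟩ := OptUse.exists_graphAt hc hp
    refine hYE s (stake Y n) (OptUse.mem_compressed.2 ⟨_, (hV.bound s _ _ hs).1, p, hs, ?_⟩)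
      (OptUse.mem_cyl_stake Y n)
    rwa [OptUse.length_stake]
  · have hne : {m : ℕ | ∃ i, max n 1 ≤ i ∧
        m = Kof U (stake X i) + Nat.clog 2 i}.Nonempty := ⟨_, max n 1, le_rfl, rfl⟩
    obtain ⟨i, hi, hm⟩ := Nat.sInf_mem hne
    obtain ⟨b, t, τ, s, h1, h2, h3, h4, h5⟩ := hY i (by omega)
    dsimp only
    rw [hm, ← OptUse.stake_add]
    refine hV.stake_mem_rfindOpt_decodeAt h1 h2 (by omega) ?_ h4
    have := h3.length_le
    rw [OptUse.length_stake] at this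
    omega
end

section
/- Every infinite layered KC-sequence ⟨(u_i, ℓ_i), i∈ℕ⟩ of weight at most 1 has a uniform solution. Moreover, if the map i ↦ (u_i, ℓ_i) is computable, then there is a uniform solution (S_i[t]) in which each S_i[t] is a finite set of binary strings and the map (i, t) ↦ S_i[t] is computable. -/
open scoped ENNReal

/-- An (infinite) layered KC-sequence `⟨(u i, ℓ i), i ∈ ℕ⟩`:
`ℓ 0 = 0` and for `i > 0`, `u i < i` and `ℓ i > ℓ (u i)`. -/
def LayeredKC (u ℓ : ℕ → ℕ) : Prop :=
  ℓ 0 = 0 ∧ ∀ i, 0 < i → u i < i ∧ ℓ (u i) < ℓ i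

/-- `⟨S i, i < t⟩` is a solution to the layered KC-sequence `⟨(u i, ℓ i), i < t⟩`:
each `S i` is nonempty, consists of strings of length `ℓ i` each properly extending
a member of `S (u i)` (for `i > 0`), and members of distinct `S i`, `S j` with
`u i = u j` are mutually non-prefixes. -/
def IsLayeredSolution (u ℓ : ℕ → ℕ) (t : ℕ) (S : ℕ → Set BStr) : Prop :=
  (∀ i, i < t → (S i).Nonempty) ∧
  (∀ i, i < t → ∀ σ ∈ S i, σ.length = ℓ i) ∧
  (∀ i, 0 < i → i < t → ∀ σ ∈ S i, ∃ τ ∈ S (u i), τ <+: σ ∧ τ ≠ σ) ∧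
  (∀ i j, 0 < i → i < t → 0 < j → j < t → i ≠ j → u i = u j →
    ∀ σ ∈ S i, ∀ τ ∈ S j, ¬ σ <+: τ)

/-- `owners u ℓ n` lists, for each bit position of a string of length `ℓ n` in `S n`, the node
on the path from the root to `n` which owns that bit, i.e. the last node `a` on the path, other
than `n`, with `ℓ a` at most that position. -/
def owners (u ℓ : ℕ → ℕ) (n : ℕ) : List ℕ :=
  if u n < n then owners u ℓ (u n) ++ List.replicate (ℓ n - ℓ (u n)) (u n) else []
termination_by n

/-- The owners of the bits of a free string `x.2` held by node `x.1`. -/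
def leafOwners (u ℓ : ℕ → ℕ) (x : ℕ × BStr) : List ℕ :=
  owners u ℓ x.1 ++ List.replicate (x.2.length - ℓ x.1) x.1

/-- The free string `x.2` of node `x.1` may be used to serve a request with list of owners `L`. -/
def Eligible (L : List ℕ) (x : ℕ × BStr) : Prop := x.1 ∈ L.drop (x.2.length - 1)

instance (L : List ℕ) (x : ℕ × BStr) : Decidable (Eligible L x) := by
  unfold Eligible; infer_instance

/-- Precedence of free strings: larger nodes come first, then longer strings. -/
def Precedes (x y : ℕ × BStr) : Prop :=
  y.1 < x.1 ∨ (y.1 = x.1 ∧ y.2.length ≤ x.2.length)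

instance (x y : ℕ × BStr) : Decidable (Precedes x y) := by
  unfold Precedes; infer_instance

/-- `x` is a free string of highest precedence among those in `F` eligible for `L`. -/
def IsBest (L : List ℕ) (F : List (ℕ × BStr)) (x : ℕ × BStr) : Prop :=
  Eligible L x ∧ ∀ y ∈ F, ¬ Eligible L y ∨ Precedes x y

instance (L : List ℕ) (F : List (ℕ × BStr)) (x : ℕ × BStr) : Decidable (IsBest L F x) := by
  unfold IsBest; infer_instance

/-- A best eligible free string, if there is one. -/
def pick (L : List ℕ) (F : List (ℕ × BStr)) : ℕ × BStr := (F.filter (IsBest L F ·)).headI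

/-- The string `σ` extended to length `m` by zeros. -/
def padTo (σ : BStr) (m : ℕ) : BStr := σ ++ List.replicate (m - σ.length) false

/-- The free strings obtained when splitting `x` to serve the node `t` with list of owners `L`. -/
def residue (L : List ℕ) (t : ℕ) (x : ℕ × BStr) : List (ℕ × BStr) :=
  (List.range (L.length - x.2.length)).map (fun i =>
    (L.getD (x.2.length + i) 0, padTo x.2 (x.2.length + i) ++ [true])) ++
  [(t, padTo x.2 L.length)]

/-- The free strings after node `t` with list of owners `L` has been served. -/
def serve (L : List ℕ) (t : ℕ) (F : List (ℕ × BStr)) : List (ℕ × BStr) :=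
  F.filter (· ≠ pick L F) ++ residue L t (pick L F)

/-- The free strings after the nodes `0, …, n` have been served. -/
def leaves (u ℓ : ℕ → ℕ) : ℕ → List (ℕ × BStr)
  | 0 => [(0, [])]
  | n + 1 => serve (owners u ℓ (n + 1)) (n + 1) (leaves u ℓ n)

/-- The string used to serve node `n`. -/
def code (u ℓ : ℕ → ℕ) : ℕ → BStr
  | 0 => []
  | n + 1 => padTo (pick (owners u ℓ (n + 1)) (leaves u ℓ n)).2 (ℓ (n + 1))

/-- The strings of node `i` after the nodes `0, …, t` have been served. -/
def strings (u ℓ : ℕ → ℕ) (i : ℕ) : ℕ → List BStr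
  | 0 => if i ∈ owners u ℓ 0 ∨ i = 0 then [(code u ℓ 0).take (ℓ i)] else []
  | t + 1 => strings u ℓ i t ++
      if i ∈ owners u ℓ (t + 1) ∨ i = t + 1 then [(code u ℓ (t + 1)).take (ℓ i)] else []

section Owners

variable {u ℓ : ℕ → ℕ}

theorem LayeredKC.owners_eq (hL : LayeredKC u ℓ) {n : ℕ} (hn : 0 < n) :
    owners u ℓ n = owners u ℓ (u n) ++ List.replicate (ℓ n - ℓ (u n)) (u n) := by
  rw [owners, if_pos (hL.2 n hn).1]

theorem owners_zero (u ℓ : ℕ → ℕ) : owners u ℓ 0 = [] := by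
  rw [owners, if_neg (Nat.not_lt_zero _)]

theorem LayeredKC.length_owners (hL : LayeredKC u ℓ) (n : ℕ) : (owners u ℓ n).length = ℓ n := by
  induction n using Nat.strong_induction_on with
  | _ n ih =>
    rcases n.eq_zero_or_pos with rfl | hn
    · rw [owners_zero, hL.1, List.length_nil]
    · have := hL.2 n hn
      rw [hL.owners_eq hn, List.length_append, List.length_replicate, ih _ this.1]
      omega

theorem LayeredKC.owners_getElem?_of_le (hL : LayeredKC u ℓ) {n r : ℕ} (hn : 0 < n)
    (h : ℓ (u n) ≤ r) (hr : r < ℓ n) : (owners u ℓ n)[r]? = some (u n) := by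
  rw [hL.owners_eq hn, List.getElem?_append_right (by rwa [hL.length_owners]),
    hL.length_owners, List.getElem?_replicate, if_pos (by omega)]

theorem LayeredKC.owners_getElem?_of_lt (hL : LayeredKC u ℓ) {n r : ℕ} (hn : 0 < n)
    (h : r < ℓ (u n)) : (owners u ℓ n)[r]? = (owners u ℓ (u n))[r]? := by
  rw [hL.owners_eq hn, List.getElem?_append_left (by rwa [hL.length_owners])]

theorem LayeredKC.lt_of_getElem? (hL : LayeredKC u ℓ) {n r b : ℕ}
    (h : (owners u ℓ n)[r]? = some b) : r < ℓ n := by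
  rw [← hL.length_owners n]
  exact (List.getElem?_eq_some_iff.1 h).1

theorem LayeredKC.owners_spec (hL : LayeredKC u ℓ) {n r b : ℕ}
    (h : (owners u ℓ n)[r]? = some b) :
    b < n ∧ ℓ b ≤ r ∧ owners u ℓ b ++ List.replicate (r + 1 - ℓ b) b <+: owners u ℓ n := by
  induction n using Nat.strong_induction_on with
  | _ n ih =>
    rcases n.eq_zero_or_pos with rfl | hn
    · simp [owners_zero] at h
    · have hu := hL.2 n hn
      have hrn := hL.lt_of_getElem? h
      rcases lt_or_ge r (ℓ (u n)) with hr | hr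
      · rw [hL.owners_getElem?_of_lt hn hr] at h
        obtain ⟨h1, h2, h3⟩ := ih _ hu.1 h
        refine ⟨h1.trans hu.1, h2, h3.trans ?_⟩
        rw [hL.owners_eq hn]
        exact List.prefix_append _ _
      · rw [hL.owners_getElem?_of_le hn hr hrn, Option.some_inj] at h
        subst h
        refine ⟨hu.1, hr, ?_⟩
        rw [hL.owners_eq hn, List.prefix_append_right_inj, List.prefix_replicate_iff]
        simp
        omega

theorem LayeredKC.prefix_of_mem (hL : LayeredKC u ℓ) {n b : ℕ} (h : b ∈ owners u ℓ n) :
    owners u ℓ b ++ [b] <+: owners u ℓ n := by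
  obtain ⟨r, hr⟩ := List.mem_iff_getElem?.1 h
  obtain ⟨-, h2, h3⟩ := hL.owners_spec hr
  refine List.IsPrefix.trans ?_ h3
  rw [List.prefix_append_right_inj, List.prefix_replicate_iff]
  simp
  omega

theorem LayeredKC.prefix_of_mem_or_eq (hL : LayeredKC u ℓ) {n b : ℕ}
    (h : b ∈ owners u ℓ n ∨ b = n) : owners u ℓ b ++ [b] <+: owners u ℓ n ++ [n] := by
  rcases h with h | rfl
  · exact (hL.prefix_of_mem h).trans (List.prefix_append _ _)
  · exact List.prefix_rfl

theorem LayeredKC.le_of_mem_or_eq (hL : LayeredKC u ℓ) {n b : ℕ}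
    (h : b ∈ owners u ℓ n ∨ b = n) : ℓ b ≤ ℓ n := by
  have := (hL.prefix_of_mem_or_eq h).length_le
  simpa [hL.length_owners] using this

theorem LayeredKC.lt_of_mem (hL : LayeredKC u ℓ) {n b : ℕ} (h : b ∈ owners u ℓ n) : b < n := by
  obtain ⟨r, hr⟩ := List.mem_iff_getElem?.1 h
  exact (hL.owners_spec hr).1

theorem LayeredKC.le_getElem? (hL : LayeredKC u ℓ) {n r b c : ℕ} (h : b ∈ owners u ℓ n)
    (hr : ℓ b ≤ r) (hc : (owners u ℓ n)[r]? = some c) : b ≤ c := by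
  induction n using Nat.strong_induction_on with
  | _ n ih =>
    rcases n.eq_zero_or_pos with rfl | hn
    · simp [owners_zero] at h
    · have hu := hL.2 n hn
      have hrn := hL.lt_of_getElem? hc
      have hb : b ∈ owners u ℓ (u n) ∨ b = u n := by
        rw [hL.owners_eq hn, List.mem_append] at h
        exact h.imp_right List.eq_of_mem_replicate
      rcases lt_or_ge r (ℓ (u n)) with hr' | hr'
      · rw [hL.owners_getElem?_of_lt hn hr'] at hc
        rcases hb with hb | rfl
        · exact ih _ hu.1 hb hc
        · omega
      · rw [hL.owners_getElem?_of_le hn hr' hrn, Option.some_inj] at hc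
        rcases hb with hb | hb
        · have := hL.lt_of_mem hb
          omega
        · omega

theorem LayeredKC.exists_child (hL : LayeredKC u ℓ) {n b : ℕ} (h : b ∈ owners u ℓ n) :
    ∃ a, 0 < a ∧ u a = b ∧ (a ∈ owners u ℓ n ∨ a = n) ∧
      (owners u ℓ n)[ℓ a - 1]? = some b := by
  induction n using Nat.strong_induction_on with
  | _ n ih =>
    rcases n.eq_zero_or_pos with rfl | hn
    · simp [owners_zero] at h
    · have hu := hL.2 n hn
      have hmem : ∀ {a}, a ∈ owners u ℓ (u n) ∨ a = u n → a ∈ owners u ℓ n := by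
        intro a ha
        rw [hL.owners_eq hn, List.mem_append, List.mem_replicate]
        exact ha.imp_right fun h => ⟨by omega, h⟩
      have hb : b ∈ owners u ℓ (u n) ∨ b = u n := by
        rw [hL.owners_eq hn, List.mem_append] at h
        exact h.imp_right List.eq_of_mem_replicate
      rcases hb with hb | rfl
      · obtain ⟨a, ha, hua, ha', hg⟩ := ih _ hu.1 hb
        refine ⟨a, ha, hua, Or.inl (hmem ha'), ?_⟩
        rw [hL.owners_getElem?_of_lt hn (hL.lt_of_getElem? hg), hg]
      · exact ⟨n, hn, rfl, Or.inr rfl, hL.owners_getElem?_of_le hn (by omega) (by omega)⟩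

theorem LayeredKC.eq_of_siblings (hL : LayeredKC u ℓ) {a b : ℕ} {K : List ℕ} (ha : 0 < a)
    (hb : 0 < b) (hu : u a = u b) (hle : ℓ a ≤ ℓ b) (hKa : owners u ℓ a ++ [a] <+: K)
    (hKb : owners u ℓ b ++ [b] <+: K) : a = b := by
  have hp : owners u ℓ a ++ [a] <+: owners u ℓ b ++ [b] :=
    List.prefix_of_prefix_length_le hKa hKb (by simpa [hL.length_owners] using hle)
  have hg : (owners u ℓ b ++ [b])[ℓ a]? = some a := by
    obtain ⟨s, hs⟩ := hp
    rw [← hs, ← hL.length_owners a, List.getElem?_append_left (by simp),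
      List.getElem?_concat_length]
  have h1 := hL.2 a ha
  rcases hle.lt_or_eq with h | h
  · rw [List.getElem?_append_left (by rwa [hL.length_owners]),
      hL.owners_getElem?_of_le hb (hu ▸ h1.2.le) h, Option.some_inj] at hg
    omega
  · rw [h, ← hL.length_owners b, List.getElem?_concat_length, Option.some_inj] at hg
    exact hg.symm

theorem Eligible.leafOwners_eq (hL : LayeredKC u ℓ) {n : ℕ} {x : ℕ × BStr} (hx : ℓ x.1 ≤ x.2.length)
    (h : Eligible (owners u ℓ n) x) :
    x.1 ∈ owners u ℓ n ∧ x.2.length ≤ ℓ n ∧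
      leafOwners u ℓ x = (owners u ℓ n).take x.2.length := by
  obtain ⟨r, hr⟩ := List.mem_iff_getElem?.1 h
  rw [List.getElem?_drop] at hr
  have hlt := hL.lt_of_getElem? hr
  obtain ⟨h1, h2, h3⟩ := hL.owners_spec hr
  refine ⟨List.mem_of_getElem? hr, by omega, ?_⟩
  have h4 : leafOwners u ℓ x <+: owners u ℓ n := by
    refine List.IsPrefix.trans ?_ h3
    rw [leafOwners, List.prefix_append_right_inj, List.prefix_replicate_iff]
    simp
    omega
  have h5 : (leafOwners u ℓ x).length = x.2.length := by
    simp [leafOwners, hL.length_owners]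
    omega
  rw [← h5]
  exact List.prefix_iff_eq_take.1 h4

theorem LayeredKC.length_leafOwners (hL : LayeredKC u ℓ) {x : ℕ × BStr}
    (hx : ℓ x.1 ≤ x.2.length) : (leafOwners u ℓ x).length = x.2.length := by
  simp [leafOwners, hL.length_owners]
  omega

end Owners

section Splitting

theorem length_padTo (σ : BStr) {m : ℕ} (h : σ.length ≤ m) : (padTo σ m).length = m := by
  simp [padTo]
  omega

theorem mem_residue {L : List ℕ} {t : ℕ} {x y : ℕ × BStr} :
    y ∈ residue L t x ↔
      (∃ i, x.2.length + i < L.length ∧ L[x.2.length + i]? = some y.1 ∧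
        y.2 = x.2 ++ (List.replicate i false ++ [true])) ∨
      y = (t, x.2 ++ List.replicate (L.length - x.2.length) false) := by
  simp only [residue, padTo, List.mem_append, List.mem_map, List.mem_range, List.mem_singleton]
  refine or_congr_left (exists_congr fun i => ?_)
  constructor
  · rintro ⟨hi, rfl⟩
    have : x.2.length + i < L.length := by omega
    simp [this]
  · rintro ⟨hi, hg, hy⟩
    refine ⟨by omega, Prod.ext ?_ ?_⟩
    · simp [List.getD, hg]
    · simp [hy]

theorem prefix_of_mem_residue {L : List ℕ} {t : ℕ} {x y : ℕ × BStr} (hy : y ∈ residue L t x) :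
    x.2 <+: y.2 := by
  rcases mem_residue.1 hy with ⟨i, -, -, h⟩ | rfl
  · rw [h]
    exact List.prefix_append _ _
  · exact List.prefix_append _ _

theorem replicate_concat_not_prefix {i k : ℕ} {w : BStr} (h : i < k) :
    ¬ List.replicate i false ++ [true] <+: List.replicate k false ++ w := by
  rintro ⟨s, hs⟩
  have := congrArg (·[i]?) hs
  simp [h, List.getElem?_append_left] at this

theorem eq_of_prefix_of_mem_residue {L : List ℕ} {t : ℕ} {x y z : ℕ × BStr}
    (hy : y ∈ residue L t x) (hz : z ∈ residue L t x) (h : y.2 <+: z.2) : y = z := by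
  rcases mem_residue.1 hy with ⟨i, hi, hyi, hy⟩ | rfl <;>
    rcases mem_residue.1 hz with ⟨j, hj, hzj, hz⟩ | rfl
  · rw [hy, hz, List.prefix_append_right_inj] at h
    have hle : i ≤ j := by simpa using h.length_le
    obtain rfl : i = j := by
      by_contra hne
      exact replicate_concat_not_prefix (by omega) h
    exact Prod.ext (Option.some_inj.1 (hyi ▸ hzj)) (hy.trans hz.symm)
  · rw [hy, List.prefix_append_right_inj] at h
    exact absurd (by simpa using h) (replicate_concat_not_prefix (w := [])
      (show i < L.length - x.2.length by omega))
  · rw [hz, List.prefix_append_right_inj] at h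
    have hle := h.length_le
    simp at hle
    have := h.eq_of_length (by simp; omega)
    rw [this] at h
    have hk : j + 1 = L.length - x.2.length := by
      simpa using (congrArg List.length this).symm
    rw [← hk, List.replicate_succ'] at this
    simp at this
  · rfl

theorem eq_of_length_eq_of_mem_residue {L : List ℕ} {t : ℕ} {x y z : ℕ × BStr}
    (hL : t ∉ L) (hy : y ∈ residue L t x) (hz : z ∈ residue L t x) (h : y.1 = z.1)
    (hl : y.2.length = z.2.length) : y = z := by
  rcases mem_residue.1 hy with ⟨i, hi, hyi, hy⟩ | rfl <;>
    rcases mem_residue.1 hz with ⟨j, hj, hzj, hz⟩ | rfl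
  · obtain rfl : i = j := by simpa [hy, hz] using hl
    exact Prod.ext h (hy.trans hz.symm)
  · rw [show y.1 = t from h] at hyi
    exact absurd (List.mem_of_getElem? hyi) hL
  · rw [← show t = z.1 from h] at hzj
    exact absurd (List.mem_of_getElem? hzj) hL
  · rfl

/-- The measure of the set of infinite sequences extending a free string in `F`, if these are
pairwise incomparable. -/
noncomputable def mass (F : List (ℕ × BStr)) : ℝ := (F.map fun x => (2 : ℝ)⁻¹ ^ x.2.length).sum

theorem mass_residue {L : List ℕ} {x : ℕ × BStr} (t : ℕ) (hx : x.2.length ≤ L.length) :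
    mass (residue L t x) = 2⁻¹ ^ x.2.length := by
  have key (s k : ℕ) : ((List.range k).map fun i => (2 : ℝ)⁻¹ ^ (s + i + 1)).sum + 2⁻¹ ^ (s + k) =
      2⁻¹ ^ s := by
    induction k with
    | zero => simp
    | succ k ih =>
      rw [← ih, List.range_succ, List.map_append, List.sum_append]
      simp only [List.map_cons, List.map_nil, List.sum_singleton]
      ring
  rw [← key x.2.length (L.length - x.2.length)]
  simp only [mass, residue, List.map_append, List.map_map, List.sum_append]
  congr 1
  · congr 2
    funext i
    simp [length_padTo]
  · simp [length_padTo _ hx, hx]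

theorem nodup_residue {L : List ℕ} {t : ℕ} {x : ℕ × BStr} (hx : x.2.length ≤ L.length)
    (hL : t ∉ L) :
    (residue L t x).Nodup := by
  rw [residue, List.nodup_append]
  refine ⟨List.Nodup.map_on ?_ List.nodup_range, List.nodup_singleton _, ?_⟩
  · intro i _ j _ h
    simpa [length_padTo] using congrArg (fun y => y.2.length) h
  · rintro y hy z hz rfl
    simp only [List.mem_map, List.mem_range, List.mem_singleton] at hy hz
    obtain ⟨i, hi, rfl⟩ := hy
    have hlt : x.2.length + i < L.length := by omega
    have := (Prod.ext_iff.1 hz).1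
    simp [hlt] at this
    exact hL (this ▸ List.getElem_mem _)

end Splitting

section Invariant

/-- The free strings in `F` partition the Cantor space into pieces held by nodes `≤ n`, no node
holds two pieces of the same size, and any two free strings assign the same owners to the bits
of their longest common prefix and the bit following it. -/
structure IsPartition (u ℓ : ℕ → ℕ) (n : ℕ) (F : List (ℕ × BStr)) : Prop where
  nodup : F.Nodup
  mass_eq : mass F = 1
  le : ∀ x ∈ F, x.1 ≤ n
  le_length : ∀ x ∈ F, ℓ x.1 ≤ x.2.length
  eq_of_prefix : ∀ x ∈ F, ∀ y ∈ F, x.2 <+: y.2 → x = y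
  eq_of_length : ∀ x ∈ F, ∀ y ∈ F, x.1 = y.1 → x.2.length = y.2.length → x = y
  eq_of_whole : ∀ x ∈ F, ∀ y ∈ F, x.1 = y.1 → x.2.length = ℓ x.1 → x = y
  coherent : ∀ x ∈ F, ∀ y ∈ F, ∀ d, d < x.2.length → d < y.2.length →
    x.2.take d = y.2.take d → (leafOwners u ℓ x).take (d + 1) = (leafOwners u ℓ y).take (d + 1)

variable {u ℓ : ℕ → ℕ} {n : ℕ} {F : List (ℕ × BStr)}

theorem leafOwners_of_mem_residue (hL : LayeredKC u ℓ) {x y : ℕ × BStr}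
    (hx : x.2.length ≤ ℓ n) (hy : y ∈ residue (owners u ℓ n) n x) :
    ℓ y.1 ≤ y.2.length ∧ leafOwners u ℓ y = (owners u ℓ n).take y.2.length := by
  rcases mem_residue.1 hy with ⟨i, hi, hg, h⟩ | rfl
  · obtain ⟨h1, h2, h3⟩ := hL.owners_spec hg
    have hl : y.2.length = x.2.length + i + 1 := by simp [h]; omega
    have hle : ℓ y.1 ≤ y.2.length := by omega
    refine ⟨hle, ?_⟩
    rw [← hl] at h3
    have := List.prefix_iff_eq_take.1 h3
    rwa [← leafOwners, hL.length_leafOwners hle] at this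
  · have : x.2.length + (ℓ n - x.2.length) = ℓ n := by omega
    simp [leafOwners, hL.length_owners, this, List.take_of_length_le]

theorem mem_serve {L : List ℕ} {t : ℕ} {y : ℕ × BStr} :
    y ∈ serve L t F ↔ (y ∈ F ∧ y ≠ pick L F) ∨ y ∈ residue L t (pick L F) := by
  simp [serve]

theorem IsPartition.serve (hL : LayeredKC u ℓ) (hF : IsPartition u ℓ n F)
    (hc : pick (owners u ℓ (n + 1)) F ∈ F)
    (hb : IsBest (owners u ℓ (n + 1)) F (pick (owners u ℓ (n + 1)) F)) :
    IsPartition u ℓ (n + 1) (serve (owners u ℓ (n + 1)) (n + 1) F) := by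
  set L := owners u ℓ (n + 1)
  have hmem {y} : y ∈ _root_.serve L (n + 1) F ↔ _ := mem_serve
  have hserve : _root_.serve L (n + 1) F = F.erase (pick L F) ++ residue L (n + 1) (pick L F) := by
    rw [_root_.serve, hF.nodup.erase_eq_filter]
    congr 2
    ext y
    by_cases h : y = pick L F <;> simp [h]
  set c := pick L F
  have hlen : L.length = ℓ (n + 1) := hL.length_owners _
  have htL : n + 1 ∉ L := fun h => lt_irrefl _ (hL.lt_of_mem h)
  obtain ⟨hcL, hcl, hcO⟩ := hb.1.leafOwners_eq hL (hF.le_length c hc)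
  have hclL : c.2.length ≤ L.length := hlen ▸ hcl
  have hnew {y} (hy : y ∈ residue L (n + 1) c) := leafOwners_of_mem_residue hL hcl hy
  -- an old free string other than `c` is incomparable with the new ones
  have hsep {x y} (hx : x ∈ F) (hxc : x ≠ c) (hy : y ∈ residue L (n + 1) c) :
      ¬ x.2 <+: y.2 ∧ ¬ y.2 <+: x.2 := by
    have hcy := prefix_of_mem_residue hy
    refine ⟨fun h => ?_, fun h => hxc (hF.eq_of_prefix c hc x hx (hcy.trans h)).symm⟩
    rcases List.prefix_or_prefix_of_prefix h hcy with h | h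
    · exact hxc (hF.eq_of_prefix x hx c hc h)
    · exact hxc (hF.eq_of_prefix c hc x hx h).symm
  -- an old free string with the owner of a new one is longer or a shorter piece of the same node
  have hlong {x y} (hx : x ∈ F) (hxc : x ≠ c) (hy : y ∈ residue L (n + 1) c) (h : x.1 = y.1) :
      y.2.length < x.2.length ∨
        (x.1 = c.1 ∧ x.2.length ≤ c.2.length ∧ c.2.length < y.2.length) := by
    have hxn := hF.le x hx
    rcases mem_residue.1 hy with ⟨i, hi, hg, hyi⟩ | rfl
    · by_contra! hle
      have hyl : y.2.length = c.2.length + i + 1 := by simp [hyi]; omega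
      have hel : Eligible L x := by
        refine List.mem_iff_getElem?.2 ⟨c.2.length + i - (x.2.length - 1), ?_⟩
        rw [List.getElem?_drop, h, ← hg]
        congr 1
        omega
      have hge : c.1 ≤ y.1 :=
        hL.le_getElem? hcL ((hF.le_length c hc).trans (Nat.le_add_right _ i)) hg
      rcases (hb.2 x hx).resolve_left (not_not.2 hel) with h' | ⟨h1, h2⟩ <;> omega
    · simp at h
      omega
  have hdisj {x y} (hx : x ∈ F) (hxc : x ≠ c) (hy : y ∈ residue L (n + 1) c) (h : x.1 = y.1) :
      x.2.length ≠ y.2.length ∧ x.2.length ≠ ℓ x.1 ∧ y.2.length ≠ ℓ y.1 := by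
    have h1 := hF.le_length x hx
    have h2 := (hnew hy).1
    have h3 := hF.le x hx
    have h4 := hlong hx hxc hy h
    have h5 := congrArg ℓ h
    have hwhole : x.1 = c.1 → x.2.length ≠ ℓ x.1 := fun h h' =>
      hxc (hF.eq_of_whole x hx c hc h h')
    rcases mem_residue.1 hy with ⟨i, hi, hg, hyi⟩ | rfl
    · have h6 := (hL.owners_spec hg).2.1
      have hyl : y.2.length = c.2.length + i + 1 := by simp [hyi]; omega
      refine ⟨by omega, fun h' => ?_, by omega⟩
      rcases h4 with h4 | ⟨h4, -, -⟩
      · omega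
      · exact hwhole h4 h'
    · simp at h
      omega
  have hcoh {x y} (hx : x ∈ F) (hxc : x ≠ c) (hy : y ∈ residue L (n + 1) c) {d : ℕ}
      (hdx : d < x.2.length) (hdy : d < y.2.length) (h : x.2.take d = y.2.take d) :
      (leafOwners u ℓ x).take (d + 1) = (leafOwners u ℓ y).take (d + 1) := by
    have hcy := List.prefix_iff_eq_take.1 (prefix_of_mem_residue hy)
    have hdc : d < c.2.length := by
      by_contra! hle
      have hcx : c.2 <+: x.2 := by
        rw [hcy, ← min_eq_left hle, ← List.take_take, ← h, List.take_take]
        exact List.take_prefix _ _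
      exact hxc (hF.eq_of_prefix c hc x hx hcx).symm
    have hxd : x.2.take d = c.2.take d := by
      rw [h, hcy, List.take_take, min_eq_left hdc.le]
    rw [hF.coherent x hx c hc d hdx hdc hxd, hcO, (hnew hy).2, List.take_take, List.take_take,
      min_eq_left (by omega), min_eq_left (by omega)]
  constructor
  · rw [hserve, List.nodup_append]
    refine ⟨hF.nodup.erase _, nodup_residue hclL htL, ?_⟩
    rintro x hx y hy rfl
    rw [hF.nodup.mem_erase_iff] at hx
    exact (hsep hx.2 hx.1 hy).1 List.prefix_rfl
  · rw [hserve, mass, List.map_append, List.sum_append, ← mass, ← mass,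
      mass_residue _ hclL, ← hF.mass_eq, mass, mass,
      ((List.perm_cons_erase hc).map fun x => (2 : ℝ)⁻¹ ^ x.2.length).sum_eq]
    simp [add_comm]
  · intro y hy
    rcases hmem.1 hy with ⟨hy, -⟩ | hy
    · exact (hF.le y hy).trans n.le_succ
    · rcases mem_residue.1 hy with ⟨i, hi, hg, -⟩ | rfl
      · exact (hL.owners_spec hg).1.le
      · exact le_rfl
  · intro y hy
    rcases hmem.1 hy with ⟨hy, -⟩ | hy
    · exact hF.le_length y hy
    · exact (hnew hy).1
  · intro x hx y hy h
    rcases hmem.1 hx with ⟨hx, hxc⟩ | hx <;> rcases hmem.1 hy with ⟨hy, hyc⟩ | hy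
    · exact hF.eq_of_prefix x hx y hy h
    · exact absurd h (hsep hx hxc hy).1
    · exact absurd h (hsep hy hyc hx).2
    · exact eq_of_prefix_of_mem_residue hx hy h
  · intro x hx y hy h hl
    rcases hmem.1 hx with ⟨hx, hxc⟩ | hx <;> rcases hmem.1 hy with ⟨hy, hyc⟩ | hy
    · exact hF.eq_of_length x hx y hy h hl
    · exact absurd hl (hdisj hx hxc hy h).1
    · exact absurd hl.symm (hdisj hy hyc hx h.symm).1
    · exact eq_of_length_eq_of_mem_residue htL hx hy h hl
  · intro x hx y hy h hl
    rcases hmem.1 hx with ⟨hx, hxc⟩ | hx <;> rcases hmem.1 hy with ⟨hy, hyc⟩ | hy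
    · exact hF.eq_of_whole x hx y hy h hl
    · exact absurd hl (hdisj hx hxc hy h).2.1
    · exact absurd hl (hdisj hy hyc hx h.symm).2.2
    · rcases mem_residue.1 hx with ⟨i, hi, hg, hxi⟩ | rfl
      · have h6 := (hL.owners_spec hg).2.1
        have hxl : x.2.length = c.2.length + i + 1 := by simp [hxi]; omega
        omega
      · rcases mem_residue.1 hy with ⟨i, hi, hg, -⟩ | rfl
        · rw [← h] at hg
          exact absurd (List.mem_of_getElem? hg) htL
        · rfl
  · intro x hx y hy d hdx hdy h
    rcases hmem.1 hx with ⟨hx, hxc⟩ | hx <;> rcases hmem.1 hy with ⟨hy, hyc⟩ | hy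
    · exact hF.coherent x hx y hy d hdx hdy h
    · exact hcoh hx hxc hy hdx hdy h
    · exact (hcoh hy hyc hx hdy hdx h.symm).symm
    · rw [(hnew hx).2, (hnew hy).2, List.take_take, List.take_take, min_eq_left (by omega),
        min_eq_left (by omega)]

theorem isPartition_zero (hL : LayeredKC u ℓ) : IsPartition u ℓ 0 [(0, [])] := by
  constructor <;> simp [mass, hL.1]

end Invariant

section Existence

variable {u ℓ : ℕ → ℕ} {n : ℕ} {F : List (ℕ × BStr)}

theorem sum_two_inv_pow_lt {ι : Type*} (G : Finset ι) (f : ι → ℕ) {m : ℕ}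
    (hinj : Set.InjOn f G) (hm : ∀ x ∈ G, m < f x) :
    ∑ x ∈ G, (2 : ℝ)⁻¹ ^ f x < 2⁻¹ ^ m := by
  have key (N : ℕ) : ∑ i ∈ Finset.range N, (2 : ℝ)⁻¹ ^ (m + i + 1) + 2⁻¹ ^ (m + N) = 2⁻¹ ^ m := by
    induction N with
    | zero => simp
    | succ N ih =>
      rw [← ih, Finset.sum_range_succ]
      ring
  set N := G.sup f
  calc ∑ x ∈ G, (2 : ℝ)⁻¹ ^ f x = ∑ k ∈ G.image f, (2 : ℝ)⁻¹ ^ k := by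
        rw [Finset.sum_image hinj]
    _ ≤ ∑ k ∈ (Finset.range N).image (m + · + 1), (2 : ℝ)⁻¹ ^ k := by
        refine Finset.sum_le_sum_of_subset_of_nonneg ?_ fun _ _ _ => by positivity
        intro k hk
        obtain ⟨x, hx, rfl⟩ := Finset.mem_image.1 hk
        have h1 := hm x hx
        have h2 : f x ≤ N := Finset.le_sup hx
        exact Finset.mem_image.2 ⟨f x - m - 1, Finset.mem_range.2 (by omega), by omega⟩
    _ = ∑ i ∈ Finset.range N, (2 : ℝ)⁻¹ ^ (m + i + 1) :=
        Finset.sum_image fun a _ b _ h => by simpa using h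
    _ < 2⁻¹ ^ m := by
        rw [← key N]
        exact lt_add_of_pos_right _ (by positivity)

theorem LayeredKC.zero_mem_owners (hL : LayeredKC u ℓ) (hn : 0 < n) : 0 ∈ owners u ℓ n := by
  induction n using Nat.strong_induction_on with
  | _ n ih =>
    have hu := hL.2 n hn
    rw [hL.owners_eq hn, List.mem_append]
    rcases (u n).eq_zero_or_pos with h | h
    · exact Or.inr (List.mem_replicate.2 ⟨by omega, h.symm⟩)
    · exact Or.inl (ih _ hu.1 h)

theorem IsPartition.exists_eligible (hL : LayeredKC u ℓ) (hF : IsPartition u ℓ n F)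
    (hw : ∑ j ∈ Finset.Ioc 0 (n + 1), (2 : ℝ)⁻¹ ^ ℓ j ≤ 1) :
    ∃ x ∈ F, Eligible (owners u ℓ (n + 1)) x := by
  by_contra! hno
  set L := owners u ℓ (n + 1)
  choose! child hpos hparent hchild hget using fun b (hb : b ∈ L) => hL.exists_child hb
  set φ : ℕ → ℕ := fun b => if b ∈ L then child b else b with hφ
  have h0 : 0 ∈ L := hL.zero_mem_owners n.succ_pos
  set piece : ℕ → Finset (ℕ × BStr) := fun b => F.toFinset.filter (·.1 = b) with hpiece
  have hmem {b x} : x ∈ piece b ↔ x ∈ F ∧ x.1 = b := by simp [hpiece]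
  have hinj (b : ℕ) : Set.InjOn (fun x : ℕ × BStr => x.2.length) (piece b) := by
    intro x hx y hy h
    rw [Finset.mem_coe, hmem] at hx hy
    exact hF.eq_of_length x hx.1 y hy.1 (hx.2.trans hy.2.symm) h
  have hlt {b : ℕ} (hb : b ∈ L) :
      ∑ x ∈ piece b, (2 : ℝ)⁻¹ ^ x.2.length < 2⁻¹ ^ ℓ (φ b) := by
    simp only [hφ, if_pos hb]
    refine sum_two_inv_pow_lt _ _ (hinj b) fun x hx => ?_
    obtain ⟨hxF, rfl⟩ := hmem.1 hx
    by_contra! hle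
    refine hno x hxF (List.mem_iff_getElem?.2 ⟨ℓ (child x.1) - 1 - (x.2.length - 1), ?_⟩)
    rw [List.getElem?_drop, ← hget x.1 hb]
    congr 1
    omega
  have hle (b : ℕ) : ∑ x ∈ piece b, (2 : ℝ)⁻¹ ^ x.2.length ≤ 2⁻¹ ^ ℓ (φ b) := by
    by_cases hb : b ∈ L
    · exact (hlt hb).le
    simp only [hφ, if_neg hb]
    by_cases hx : ∃ x ∈ piece b, x.2.length = ℓ b
    · obtain ⟨x, hx, hxl⟩ := hx
      have : piece b = {x} := by
        refine Finset.eq_singleton_iff_unique_mem.2 ⟨hx, fun y hy => ?_⟩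
        rw [hmem] at hx hy
        exact (hF.eq_of_whole x hx.1 y hy.1 (hx.2.trans hy.2.symm) (by rw [hxl, hx.2])).symm
      rw [this, Finset.sum_singleton, hxl]
    · push Not at hx
      refine (sum_two_inv_pow_lt _ _ (hinj b) fun x h => ?_).le
      have h1 := hF.le_length x (hmem.1 h).1
      rw [(hmem.1 h).2] at h1
      exact lt_of_le_of_ne h1 (hx x h).symm
  have hφinj : Set.InjOn φ (Finset.range (n + 1)) := by
    have aux {b b' : ℕ} (hb : b ∈ L) (hb' : b' ∉ L) (hn : b' ∈ Finset.range (n + 1)) :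
        child b ≠ b' := by
      rintro rfl
      rw [Finset.mem_range] at hn
      rcases hchild b hb with h | h
      · exact hb' h
      · omega
    intro b hbn b' hbn' h
    by_cases hb : b ∈ L <;> by_cases hb' : b' ∈ L <;> simp only [hφ, hb, hb', if_true, if_false] at h
    · rw [← hparent b hb, h, hparent b' hb']
    · exact absurd h (aux hb hb' hbn')
    · exact absurd h.symm (aux hb' hb hbn)
    · exact h
  have hφmem : (Finset.range (n + 1)).image φ ⊆ Finset.Ioc 0 (n + 1) := by
    intro a ha
    obtain ⟨b, hbn, rfl⟩ := Finset.mem_image.1 ha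
    rw [Finset.mem_range] at hbn
    rw [Finset.mem_Ioc]
    by_cases hb : b ∈ L <;> simp only [hφ, hb, if_true, if_false]
    · refine ⟨hpos b hb, ?_⟩
      rcases hchild b hb with h | h
      · exact (hL.lt_of_mem h).le
      · exact h.le
    · exact ⟨Nat.pos_of_ne_zero fun h => hb (h ▸ h0), hbn.le⟩
  refine lt_irrefl (1 : ℝ) ?_
  calc (1 : ℝ) = ∑ x ∈ F.toFinset, (2 : ℝ)⁻¹ ^ x.2.length := by
        rw [← hF.mass_eq, mass, List.sum_toFinset _ hF.nodup]
    _ = ∑ b ∈ Finset.range (n + 1), ∑ x ∈ piece b, (2 : ℝ)⁻¹ ^ x.2.length := by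
        refine (Finset.sum_fiberwise_of_maps_to (fun x hx => ?_) _).symm
        exact Finset.mem_range.2 (Nat.lt_succ_of_le (hF.le x (List.mem_toFinset.1 hx)))
    _ < ∑ b ∈ Finset.range (n + 1), (2 : ℝ)⁻¹ ^ ℓ (φ b) :=
        Finset.sum_lt_sum (fun b _ => hle b) ⟨0, Finset.mem_range.2 n.succ_pos, hlt h0⟩
    _ = ∑ j ∈ (Finset.range (n + 1)).image φ, (2 : ℝ)⁻¹ ^ ℓ j :=
        (Finset.sum_image (f := fun j => (2 : ℝ)⁻¹ ^ ℓ j) hφinj).symm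
    _ ≤ ∑ j ∈ Finset.Ioc 0 (n + 1), (2 : ℝ)⁻¹ ^ ℓ j :=
        Finset.sum_le_sum_of_subset_of_nonneg hφmem fun _ _ _ => by positivity
    _ ≤ 1 := hw

theorem pick_spec {L : List ℕ} (h : ∃ x ∈ F, Eligible L x) :
    pick L F ∈ F ∧ IsBest L F (pick L F) := by
  obtain ⟨x, hx, hxL⟩ := h
  obtain ⟨c, hc, hmax⟩ := (F.toFinset.filter (Eligible L ·)).exists_max_image
    (fun x => toLex (x.1, x.2.length)) ⟨x, by simp [hx, hxL]⟩
  simp only [Finset.mem_filter, List.mem_toFinset] at hc hmax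
  have hcF : c ∈ F.filter (IsBest L F ·) := by
    rw [List.mem_filter, decide_eq_true_eq]
    refine ⟨hc.1, hc.2, fun y hy => or_iff_not_imp_left.2 fun hyL => ?_⟩
    exact Prod.Lex.toLex_le_toLex.1 (hmax y ⟨hy, not_not.1 hyL⟩)
  have hmem : pick L F ∈ F.filter (IsBest L F ·) := by
    rw [pick]
    generalize F.filter (IsBest L F ·) = G at hcF
    cases G with
    | nil => simp at hcF
    | cons a G => simp
  simpa using hmem

variable (hL : LayeredKC u ℓ) (hw : ∀ n, ∑ j ∈ Finset.Ioc 0 n, (2 : ℝ)⁻¹ ^ ℓ j ≤ 1)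
include hL hw

theorem isPartition_leaves (n : ℕ) : IsPartition u ℓ n (leaves u ℓ n) := by
  induction n with
  | zero => exact isPartition_zero hL
  | succ n ih =>
    obtain ⟨h1, h2⟩ := pick_spec (ih.exists_eligible hL (hw _))
    exact ih.serve hL h1 h2

theorem pick_leaves_spec (n : ℕ) :
    pick (owners u ℓ (n + 1)) (leaves u ℓ n) ∈ leaves u ℓ n ∧
      IsBest (owners u ℓ (n + 1)) (leaves u ℓ n) (pick (owners u ℓ (n + 1)) (leaves u ℓ n)) :=
  pick_spec ((isPartition_leaves hL hw n).exists_eligible hL (hw _))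

theorem length_code (n : ℕ) : (code u ℓ n).length = ℓ n := by
  cases n with
  | zero => simp [code, hL.1]
  | succ n =>
    obtain ⟨h1, h2⟩ := pick_leaves_spec hL hw n
    exact length_padTo _ (h2.1.leafOwners_eq hL ((isPartition_leaves hL hw n).le_length _ h1)).2.1

theorem exists_leaf_of_le {n j : ℕ} (hj : j ≤ n) :
    ∃ x ∈ leaves u ℓ n, code u ℓ j <+: x.2 ∧
      owners u ℓ j ++ [j] <+: leafOwners u ℓ x ++ [x.1] := by
  induction n with
  | zero =>
    obtain rfl := Nat.le_zero.1 hj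
    exact ⟨(0, []), by simp [leaves], by simp [code], by simp [leafOwners]⟩
  | succ n ih =>
    obtain ⟨hcF, hb⟩ := pick_leaves_spec hL hw n
    set c := pick (owners u ℓ (n + 1)) (leaves u ℓ n)
    obtain ⟨h1, h2, h3⟩ := hb.1.leafOwners_eq hL ((isPartition_leaves hL hw n).le_length _ hcF)
    have hlast : ((n + 1, code u ℓ (n + 1)) : ℕ × BStr) ∈ leaves u ℓ (n + 1) := by
      refine mem_serve.2 (Or.inr (mem_residue.2 (Or.inr ?_)))
      rw [hL.length_owners, code, padTo]
    have hlastO : leafOwners u ℓ (n + 1, code u ℓ (n + 1)) = owners u ℓ (n + 1) := by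
      simp [leafOwners, length_code hL hw]
    rcases hj.lt_or_eq with hj | rfl
    · obtain ⟨x, hx, hx1, hx2⟩ := ih (Nat.le_of_lt_succ hj)
      by_cases hxc : x = c
      · subst hxc
        refine ⟨_, hlast, hx1.trans (List.prefix_append _ _), ?_⟩
        rw [hlastO]
        refine List.IsPrefix.trans ?_ (List.prefix_append _ _)
        rcases List.prefix_concat_iff.1 hx2 with h | h
        · obtain rfl : j = c.1 := by simpa using (List.append_inj' h rfl).2
          exact hL.prefix_of_mem h1
        · exact h.trans (h3 ▸ List.take_prefix _ _)
      · exact ⟨x, mem_serve.2 (Or.inl ⟨hx, hxc⟩), hx1, hx2⟩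
    · exact ⟨_, hlast, List.prefix_rfl, by rw [hlastO]⟩

theorem eq_of_take_prefix {a b j k : ℕ} (ha : 0 < a) (hb : 0 < b) (hu : u a = u b)
    (hj : a ∈ owners u ℓ j ∨ a = j) (hk : b ∈ owners u ℓ k ∨ b = k)
    (h : (code u ℓ j).take (ℓ a) <+: (code u ℓ k).take (ℓ b)) : a = b := by
  have hlj := hL.le_of_mem_or_eq hj
  have hlk := hL.le_of_mem_or_eq hk
  have hab : ℓ a ≤ ℓ b := by
    have := h.length_le
    simpa [length_code hL hw, hlj, hlk] using this
  set n := max j k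
  have hP := isPartition_leaves hL hw n
  obtain ⟨x, hx, hx1, hx2⟩ := exists_leaf_of_le hL hw (le_max_left j k)
  obtain ⟨y, hy, hy1, hy2⟩ := exists_leaf_of_le hL hw (le_max_right j k)
  have hax := (hL.prefix_of_mem_or_eq hj).trans hx2
  have hby := (hL.prefix_of_mem_or_eq hk).trans hy2
  by_cases hxy : x = y
  · subst hxy
    exact hL.eq_of_siblings ha hb hu hab hax hby
  have hlen : ((code u ℓ j).take (ℓ a)).length = ℓ a := by simp [length_code hL hw, hlj]
  have hpx : (code u ℓ j).take (ℓ a) <+: x.2 := (List.take_prefix _ _).trans hx1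
  have hpy : (code u ℓ j).take (ℓ a) <+: y.2 := h.trans ((List.take_prefix _ _).trans hy1)
  have hax' := List.prefix_iff_eq_take.1 hpx
  have hay' := List.prefix_iff_eq_take.1 hpy
  rw [hlen] at hax' hay'
  have hdx : ℓ a < x.2.length := by
    by_contra! hle
    rw [List.take_of_length_le hle] at hax'
    exact hxy (hP.eq_of_prefix x hx y hy (hax' ▸ hpy))
  have hdy : ℓ a < y.2.length := by
    by_contra! hle
    rw [List.take_of_length_le hle] at hay'
    exact hxy (hP.eq_of_prefix y hy x hx (hay' ▸ hpx)).symm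
  have hcoh := hP.coherent x hx y hy _ hdx hdy (hax'.symm.trans hay')
  have hax2 : owners u ℓ a ++ [a] = (leafOwners u ℓ x).take (ℓ a + 1) := by
    have := List.prefix_iff_eq_take.1 hax
    rw [this, List.length_append, hL.length_owners, List.length_singleton,
      List.take_append_of_le_length]
    rw [hL.length_leafOwners (hP.le_length x hx)]
    exact hdx
  refine hL.eq_of_siblings ha hb hu hab ?_ hby
  rw [hax2, hcoh]
  exact (List.take_prefix _ _).trans (List.prefix_append _ _)

omit hL hw in
theorem mem_strings {i t : ℕ} {σ : BStr} : σ ∈ strings u ℓ i t ↔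
    ∃ j ≤ t, (i ∈ owners u ℓ j ∨ i = j) ∧ σ = (code u ℓ j).take (ℓ i) := by
  induction t with
  | zero =>
    rw [strings]
    split_ifs with h <;> simp [h]
  | succ t ih =>
    rw [strings, List.mem_append, ih]
    simp only [Nat.le_succ_iff, or_and_right, exists_or, exists_eq_left]
    rw [← or_and_right]
    refine or_congr_right ?_
    split_ifs with h <;> simp [h]

theorem isLayeredSolution_strings (t : ℕ) :
    IsLayeredSolution u ℓ t fun i => {σ | σ ∈ strings u ℓ i t} := by
  refine ⟨fun i hi => ⟨_, mem_strings.2 ⟨i, hi.le, Or.inr rfl, rfl⟩⟩, ?_, ?_, ?_⟩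
  · rintro i hi σ hσ
    obtain ⟨j, -, hij, rfl⟩ := mem_strings.1 hσ
    simp [length_code hL hw, hL.le_of_mem_or_eq hij]
  · rintro i hi0 hi σ hσ
    obtain ⟨j, hj, hij, rfl⟩ := mem_strings.1 hσ
    have hui : u i ∈ owners u ℓ i := by
      have := (hL.2 i hi0).2
      rw [hL.owners_eq hi0, List.mem_append, List.mem_replicate]
      exact Or.inr ⟨by omega, rfl⟩
    have huj : u i ∈ owners u ℓ j := by
      rcases hij with h | rfl
      · exact (hL.prefix_of_mem h).subset (List.mem_append_left _ hui)
      · exact hui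
    have hlt := (hL.2 i hi0).2
    refine ⟨_, mem_strings.2 ⟨j, hj, Or.inl huj, rfl⟩, ?_, fun h => ?_⟩
    · exact List.take_prefix_take_left hlt.le
    · have h1 := hL.le_of_mem_or_eq hij
      have := congrArg List.length h
      simp [length_code hL hw] at this
      omega
  · rintro i k hi0 hi hk0 hk hne hu σ hσ ρ hρ h
    obtain ⟨j, -, hij, rfl⟩ := mem_strings.1 hσ
    obtain ⟨j', -, hij', rfl⟩ := mem_strings.1 hρ
    exact hne (eq_of_take_prefix hL hw hi0 hk0 hu hij hij' h)

end Existence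

section Computability

theorem primrec_list_replicate {α : Type*} [Primcodable α] :
    Primrec₂ (List.replicate : ℕ → α → List α) :=
  (Primrec.list_map (Primrec.list_range.comp Primrec.fst)
    (Primrec.snd.comp Primrec.fst).to₂).to₂.of_eq fun n a => by simp [List.map_const']

theorem primrecRel_mem {α : Type*} [Primcodable α] :
    PrimrecRel fun (a : α) (L : List α) => a ∈ L := by
  have h : PrimrecRel fun (L : List α) (b : α) => ∃ a ∈ L, a = b :=
    PrimrecRel.exists_mem_list Primrec.eq
  exact (h.comp₂ Primrec₂.right Primrec₂.left).of_eq fun a L => by simp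

theorem primrecRel_eligible : PrimrecRel Eligible :=
  primrecRel_mem.comp (Primrec.fst.comp Primrec.snd)
    (Primrec.list_drop.comp
      (Primrec.nat_sub.comp (Primrec.list_length.comp (Primrec.snd.comp Primrec.snd))
        (Primrec.const 1)) Primrec.fst)

theorem primrecRel_precedes : PrimrecRel Precedes :=
  PrimrecPred.or
    (Primrec.nat_lt.comp (Primrec.fst.comp Primrec.snd) (Primrec.fst.comp Primrec.fst))
    (PrimrecPred.and
      (Primrec.eq.comp (Primrec.fst.comp Primrec.snd) (Primrec.fst.comp Primrec.fst))
      (Primrec.nat_le.comp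
        (Primrec.list_length.comp (Primrec.snd.comp Primrec.snd))
        (Primrec.list_length.comp (Primrec.snd.comp Primrec.fst))))

theorem primrecRel_isBest : PrimrecRel
    fun (x : ℕ × BStr) (p : List ℕ × List (ℕ × BStr)) => IsBest p.1 p.2 x := by
  have h : PrimrecRel fun (y : ℕ × BStr) (q : List ℕ × (ℕ × BStr)) =>
      ¬ Eligible q.1 y ∨ Precedes q.2 y :=
    PrimrecPred.or
      (primrecRel_eligible.comp (Primrec.fst.comp Primrec.snd) Primrec.fst).not
      (primrecRel_precedes.comp (Primrec.snd.comp Primrec.snd) Primrec.fst)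
  exact PrimrecPred.and
    (primrecRel_eligible.comp (Primrec.fst.comp Primrec.snd) Primrec.fst)
    (h.forall_mem_list.comp (Primrec.snd.comp Primrec.snd)
      (Primrec.pair (Primrec.fst.comp Primrec.snd) Primrec.fst))

theorem primrec_pick : Primrec₂ pick :=
  Primrec.list_headI.comp (primrecRel_isBest.listFilter.comp Primrec.snd Primrec.id)

theorem primrec_padTo : Primrec₂ padTo :=
  Primrec.list_append.comp Primrec.fst
    (primrec_list_replicate.comp
      (Primrec.nat_sub.comp Primrec.snd (Primrec.list_length.comp Primrec.fst))
      (Primrec.const false))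

theorem primrec_residue :
    Primrec fun p : List ℕ × ℕ × (ℕ × BStr) => residue p.1 p.2.1 p.2.2 := by
  have hx : Primrec fun p : List ℕ × ℕ × (ℕ × BStr) => p.2.2.2 :=
    Primrec.snd.comp (Primrec.snd.comp Primrec.snd)
  have hlen := Primrec.list_length.comp hx
  have hL : Primrec fun p : List ℕ × ℕ × (ℕ × BStr) => p.1.length :=
    Primrec.list_length.comp Primrec.fst
  have hidx : Primrec fun q : (List ℕ × ℕ × (ℕ × BStr)) × ℕ => q.1.2.2.2.length + q.2 :=
    Primrec.nat_add.comp (hlen.comp Primrec.fst) Primrec.snd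
  refine Primrec.list_append.comp
    (Primrec.list_map (Primrec.list_range.comp (Primrec.nat_sub.comp hL hlen)) ?_)
    (Primrec.list_cons.comp (Primrec.pair (Primrec.fst.comp Primrec.snd)
      (primrec_padTo.comp hx hL)) (Primrec.const []))
  exact Primrec.pair
    ((Primrec.list_getD 0).comp (Primrec.fst.comp Primrec.fst) hidx)
    (Primrec.list_append.comp (primrec_padTo.comp (hx.comp Primrec.fst) hidx)
      (Primrec.const [true]))

theorem primrec_serve :
    Primrec fun p : List ℕ × ℕ × List (ℕ × BStr) => serve p.1 p.2.1 p.2.2 := by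
  have hF : Primrec fun p : List ℕ × ℕ × List (ℕ × BStr) => p.2.2 :=
    Primrec.snd.comp Primrec.snd
  have hpick : Primrec fun p : List ℕ × ℕ × List (ℕ × BStr) => pick p.1 p.2.2 :=
    primrec_pick.comp Primrec.fst hF
  have hne : PrimrecRel fun x y : ℕ × BStr => x ≠ y := PrimrecPred.not Primrec.eq
  exact Primrec.list_append.comp (hne.listFilter.comp hF hpick)
    (primrec_residue.comp
      (Primrec.pair Primrec.fst (Primrec.pair (Primrec.fst.comp Primrec.snd) hpick)))

variable {u ℓ : ℕ → ℕ}

theorem computable_owners (hu : Computable u) (hℓ : Computable ℓ) : Computable (owners u ℓ) := by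
  let g : Unit → List (List ℕ) → Option (List ℕ) := fun _ T =>
    bif decide (u T.length < T.length) then
      some (T.getD (u T.length) [] ++
        List.replicate (ℓ T.length - ℓ (u T.length)) (u T.length))
    else some []
  have hlen : Computable fun p : Unit × List (List ℕ) => p.2.length :=
    Computable.list_length.comp Computable.snd
  have hulen := hu.comp hlen
  have hg : Computable₂ g := by
    refine Computable.cond ((PrimrecRel.decide Primrec.nat_lt).to_comp.comp hulen hlen)
      (Computable.option_some.comp (Computable.list_append.comp
        ((Primrec.list_getD []).to_comp.comp Computable.snd hulen)
        (primrec_list_replicate.to_comp.comp ?_ hulen)))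
      (Computable.const _)
    exact Primrec.nat_sub.to_comp.comp (hℓ.comp hlen) (hℓ.comp hulen)
  have h : Computable₂ fun (_ : Unit) n => owners u ℓ n := by
    refine Computable.nat_strong_rec _ hg fun _ n => ?_
    simp only [g, List.length_map, List.length_range]
    conv_rhs => rw [owners]
    by_cases hn : u n < n <;> simp [hn]
  exact h.comp (Computable.const ()) Computable.id

theorem Computable.comp₃ {α β γ δ σ : Type*} [Primcodable α] [Primcodable β] [Primcodable γ]
    [Primcodable δ] [Primcodable σ] {g : β → γ → δ → σ} {a : α → β} {b : α → γ} {c : α → δ}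
    (hg : Computable fun p : β × γ × δ => g p.1 p.2.1 p.2.2) (ha : Computable a)
    (hb : Computable b) (hc : Computable c) : Computable fun x => g (a x) (b x) (c x) :=
  hg.comp (ha.pair (hb.pair hc))

theorem computable_leaves (hu : Computable u) (hℓ : Computable ℓ) : Computable (leaves u ℓ) := by
  have hk : Computable fun p : ℕ × ℕ × List (ℕ × BStr) => p.2.1 + 1 :=
    Computable.succ.comp (Computable.fst.comp Computable.snd)
  have hstep : Computable fun p : ℕ × ℕ × List (ℕ × BStr) =>
      serve (owners u ℓ (p.2.1 + 1)) (p.2.1 + 1) p.2.2 :=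
    Computable.comp₃ (g := serve) primrec_serve.to_comp ((computable_owners hu hℓ).comp hk) hk
      (Computable.snd.comp Computable.snd)
  refine (Computable.nat_rec Computable.id (Computable.const [(0, [])]) hstep.to₂).of_eq
    fun n => ?_
  induction n with
  | zero => rfl
  | succ n ih => exact congrArg (serve (owners u ℓ (n + 1)) (n + 1)) ih

theorem computable_code (hu : Computable u) (hℓ : Computable ℓ) : Computable (code u ℓ) := by
  have hk : Computable fun p : ℕ × ℕ => p.2 + 1 := Computable.succ.comp Computable.snd
  have h : Computable fun n : ℕ => Nat.casesOn (motive := fun _ => BStr) n []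
      fun k => padTo (pick (owners u ℓ (k + 1)) (leaves u ℓ k)).2 (ℓ (k + 1)) :=
    Computable.nat_casesOn Computable.id (Computable.const _)
      (primrec_padTo.to_comp.comp
        (Computable.snd.comp (primrec_pick.to_comp.comp ((computable_owners hu hℓ).comp hk)
          ((computable_leaves hu hℓ).comp Computable.snd)))
        (hℓ.comp hk))
  exact h.of_eq fun n => by cases n <;> rfl

theorem computable_strings (hu : Computable u) (hℓ : Computable ℓ) :
    Computable fun p : ℕ × ℕ => strings u ℓ p.1 p.2 := by
  let added : ℕ → ℕ → List BStr := fun i t =>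
    bif decide (i ∈ owners u ℓ t ++ [t]) then [(code u ℓ t).take (ℓ i)] else []
  have hadded : Computable₂ added :=
    Computable.cond
      (primrecRel_mem.decide.to_comp.comp Computable.fst
        (Computable.list_concat.comp ((computable_owners hu hℓ).comp Computable.snd)
          Computable.snd))
      (Computable.list_cons.comp
        (Primrec.list_take.to_comp.comp (hℓ.comp Computable.fst)
          ((computable_code hu hℓ).comp Computable.snd)) (Computable.const []))
      (Computable.const [])
  have h : Computable fun p : ℕ × ℕ => Nat.rec (motive := fun _ => List BStr) (added p.1 0)
      (fun t T => T ++ added p.1 (t + 1)) p.2 := by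
    refine Computable.nat_rec (h := fun p q => q.2 ++ added p.1 (q.1 + 1)) Computable.snd
      (hadded.comp Computable.fst (Computable.const 0)) ?_
    exact Computable.list_append.comp (Computable.snd.comp Computable.snd)
      (hadded.comp (Computable.fst.comp Computable.fst)
        (Computable.succ.comp (Computable.fst.comp Computable.snd)))
  refine h.of_eq fun ⟨i, t⟩ => ?_
  have hadd (t : ℕ) : added i t =
      if i ∈ owners u ℓ t ∨ i = t then [(code u ℓ t).take (ℓ i)] else [] := by
    simp only [added, List.mem_append, List.mem_singleton, Bool.cond_decide]
  induction t with
  | zero => exact hadd 0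
  | succ t ih => simp only [strings, ← hadd, ← ih]

end Computability

theorem LayeredKC.sum_le_one {ℓ : ℕ → ℕ}
    (hw : (∑' i : ℕ, if 0 < i then ((2 : ℝ≥0∞) ^ (ℓ i))⁻¹ else 0) ≤ 1) (n : ℕ) :
    ∑ j ∈ Finset.Ioc 0 n, (2 : ℝ)⁻¹ ^ ℓ j ≤ 1 := by
  have h : ∑ j ∈ Finset.Ioc 0 n, ENNReal.ofReal ((2 : ℝ)⁻¹ ^ ℓ j) ≤ 1 := by
    refine le_trans (le_of_eq (Finset.sum_congr rfl fun j hj => ?_))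
      ((ENNReal.sum_le_tsum (Finset.Ioc 0 n)).trans hw)
    rw [if_pos (Finset.mem_Ioc.1 hj).1, ENNReal.ofReal_pow (by positivity),
      ENNReal.ofReal_inv_of_pos two_pos, ENNReal.ofReal_ofNat, ENNReal.inv_pow]
  rw [← ENNReal.ofReal_sum_of_nonneg fun _ _ => by positivity] at h
  exact ENNReal.ofReal_le_one.1 h

/-- The layered Kraft-Chaitin theorem: every infinite layered KC-sequence of weight
at most 1 has a uniform solution; if the sequence is computable, there is a uniform
solution by finite sets (lists) which is computable. -/
theorem stmt4 (u ℓ : ℕ → ℕ) (hL : LayeredKC u ℓ)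
    (hw : (∑' i : ℕ, if 0 < i then ((2 : ℝ≥0∞) ^ (ℓ i))⁻¹ else 0) ≤ 1) :
    (∃ S : ℕ → ℕ → Set BStr,
      (∀ i t, i < t → S i t ⊆ S i (t + 1)) ∧
      (∀ t, IsLayeredSolution u ℓ t (fun i => S i t))) ∧
    (Computable (fun i => (u i, ℓ i)) →
      ∃ S : ℕ → ℕ → List BStr,
        Computable (fun p : ℕ × ℕ => S p.1 p.2) ∧
        (∀ i t, i < t → ∀ σ ∈ S i t, σ ∈ S i (t + 1)) ∧
        (∀ t, IsLayeredSolution u ℓ t (fun i => {σ | σ ∈ S i t}))) := by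
  have hw' := LayeredKC.sum_le_one hw
  have hmono (i t : ℕ) (_ : i < t) (σ : BStr) (hσ : σ ∈ strings u ℓ i t) :
      σ ∈ strings u ℓ i (t + 1) := List.mem_append_left _ hσ
  refine ⟨⟨fun i t => {σ | σ ∈ strings u ℓ i t}, hmono, isLayeredSolution_strings hL hw'⟩,
    fun hc => ⟨strings u ℓ, computable_strings ?_ ?_, hmono, isLayeredSolution_strings hL hw'⟩⟩
  · exact Computable.fst.comp hc
  · exact Computable.snd.comp hc
end
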